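/- (Corollary B.4) The centralizer of the periodic Temperley–Lieb algebra on the gl(1|1) spin chain: the commutant {T ∈ End(H) : T e_j = e_j T for all 1 ≤ j ≤ N} of the operators e_1,…,e_N on H = (ℂ²)^{⊗N} equals the unital subalgebra of End(H) generated by the operators {F_(2k+1), F†_(2k+1) : 0 ≤ k ≤ L−1} together with F_(N), F†_(N) and S^z. -/

import Mathlib

open Complex Matrix

noncomputable section

namespace SpinChain

/-- The state space of the `N`-site spin chain, `(ℂ²)^{⊗N}` realised as functions on
spin configurations. -/
abbrev V (N : ℕ) := (Fin N → Fin 2) → ℂ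

/-- Operators on the spin chain, realised as matrices. -/
abbrev Op (N : ℕ) := Matrix (Fin N → Fin 2) (Fin N → Fin 2) ℂ

def sigmaX : Matrix (Fin 2) (Fin 2) ℂ := !![0, 1; 1, 0]
def sigmaY : Matrix (Fin 2) (Fin 2) ℂ := !![0, -I; I, 0]
def sigmaZ : Matrix (Fin 2) (Fin 2) ℂ := !![1, 0; 0, -1]
def sigmaPlus : Matrix (Fin 2) (Fin 2) ℂ := ((1 : ℂ)/2) • (sigmaX + I • sigmaY)
def sigmaMinus : Matrix (Fin 2) (Fin 2) ℂ := ((1 : ℂ)/2) • (sigmaX - I • sigmaY)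

variable (N : ℕ)

/-- The operator acting as the 2×2 matrix `a` on the `j`-th tensor factor and as the
identity on the others. -/
def site (a : Matrix (Fin 2) (Fin 2) ℂ) (j : Fin N) : Op N :=
  Matrix.of fun x y =>
    a (x j) (y j) * ∏ k ∈ Finset.univ.filter (fun k => k ≠ j), (if x k = y k then (1 : ℂ) else 0)

/-- Jordan–Wigner string `∏_{k<j} diag(z 0, z 1)_k`. -/
def string (z : Fin 2 → ℂ) (j : Fin N) : Op N :=
  (((List.finRange N).filter (fun k => decide (k < j))).map
    (fun k => site N (Matrix.diagonal z) k)).prod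

/-- Jordan–Wigner fermion `c_j := i^{1−j}·(∏_{k<j} diag(−i,i)_k)·σ⁻_j`; here the index
`j : Fin N` labels the physical site `j+1`. -/
def c (j : Fin N) : Op N :=
  (I ^ (-(j : ℤ))) • (string N ![-I, I] j * site N sigmaMinus j)

/-- Jordan–Wigner fermion `c_j† := i^{j−1}·(∏_{k<j} diag(i,−i)_k)·σ⁺_j`. -/
def cd (j : Fin N) : Op N :=
  (I ^ ((j : ℕ))) • (string N ![I, -I] j * site N sigmaPlus j)

/-- The `gl(1|1)` fermion `f_j := i^j c_j` (physical index `j = j.val + 1`). -/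
def f (j : Fin N) : Op N := (I ^ ((j : ℕ) + 1)) • c N j

/-- The `gl(1|1)` fermion `f_j† := i^j c_j†`. -/
def fd (j : Fin N) : Op N := (I ^ ((j : ℕ) + 1)) • cd N j

/-- Cyclic successor on site indices. -/
def fsucc {N : ℕ} (j : Fin N) : Fin N := ⟨(j.val + 1) % N, Nat.mod_lt _ j.pos⟩

/-- Periodic Temperley–Lieb generators
`e_j = (f_j+f_{j+1})(f_j†+f_{j+1}†)`, with `e_N = (f_N+f_1)(f_N†+f_1†)`. -/
def e (j : Fin N) : Op N := (f N j + f N (fsucc j)) * (fd N j + fd N (fsucc j))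

/-- `F_(m) := Σ_{j_1<⋯<j_m} f_{j_1}⋯f_{j_m}`. -/
def Fg (m : ℕ) : Op N :=
  ∑ s ∈ Finset.univ.powersetCard m, ((s.sort (· ≤ ·)).map (f N)).prod

/-- `F†_(m) := Σ_{j_1<⋯<j_m} f†_{j_1}⋯f†_{j_m}`. -/
def Fdg (m : ℕ) : Op N :=
  ∑ s ∈ Finset.univ.powersetCard m, ((s.sort (· ≤ ·)).map (fd N)).prod

/-- `S^z := (1/2) Σ_j σ^z_j`. -/
def Sz : Op N := ((1 : ℂ)/2) • ∑ j : Fin N, site N sigmaZ j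


/-- The generating set of the centralizer: the odd symmetry generators
`F_(2k+1)`, `F†_(2k+1)` (`0 ≤ k ≤ L−1`), the top products `F_(N)`, `F†_(N)`,
and `S^z`. -/
def centGens (L : ℕ) : Set (Op (2 * L)) :=
  {T | (∃ k : ℕ, k < L ∧ T = Fg (2 * L) (2 * k + 1)) ∨
       (∃ k : ℕ, k < L ∧ T = Fdg (2 * L) (2 * k + 1)) ∨
       T = Fg (2 * L) (2 * L) ∨ T = Fdg (2 * L) (2 * L) ∨ T = Sz (2 * L)}

/-- Fermionic modes `u i`, `d i` obeying the canonical anticommutation relations, an idempotent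
`E` commuting with them, and a signed involution `(σ, ε)` encoding a symplectic form. -/
structure SymplecticModes (ι A : Type*) [DecidableEq ι] [Ring A] [Algebra ℂ A] where
  u : ι → A
  d : ι → A
  E : A
  σ : ι → ι
  ε : ι → ℂ
  uu : ∀ i j, u i * u j = -(u j * u i)
  dd : ∀ i j, d i * d j = -(d j * d i)
  du : ∀ i j, d i * u j = (if i = j then 1 else 0) - u j * d i
  EE : E * E = E
  Eu : ∀ i, E * u i = u i * E
  Ed : ∀ i, E * d i = d i * E
  σσ : ∀ i, σ (σ i) = i
  εσ : ∀ i, ε (σ i) = -ε i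
  εε : ∀ i, ε i * ε i = 1

namespace SymplecticModes

variable {ι A : Type*} [DecidableEq ι] [Ring A] [Algebra ℂ A]
  (M : SymplecticModes ι A)

def us (i : ι) : A := M.ε i • M.u (M.σ i)
def ds (i : ι) : A := M.ε i • M.d (M.σ i)
def X (i j : ι) : A := M.u i * M.ds j + M.u j * M.ds i

theorem eq_σ_iff (i j : ι) : i = M.σ j ↔ j = M.σ i :=
  ⟨fun h => by rw [h, M.σσ], fun h => by rw [h, M.σσ]⟩

theorem d_us (i j : ι) :
    M.d i * M.us j = (if i = M.σ j then algebraMap ℂ A (M.ε j) else 0) - M.us j * M.d i := by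
  simp only [us, mul_smul_comm, M.du, smul_mul_assoc, smul_sub, smul_ite, smul_zero]
  rw [Algebra.algebraMap_eq_smul_one]

theorem ds_u (i j : ι) :
    M.ds i * M.u j = (if i = M.σ j then algebraMap ℂ A (M.ε i) else 0) - M.u j * M.ds i := by
  simp only [ds, mul_smul_comm, M.du, smul_mul_assoc, smul_sub, smul_ite, smul_zero]
  rw [Algebra.algebraMap_eq_smul_one]
  simp only [M.eq_σ_iff i j, eq_comm]

theorem us_u (i j : ι) : M.us i * M.u j = -(M.u j * M.us i) := by
  simp only [us, mul_smul_comm, smul_mul_assoc, M.uu (M.σ i) j, smul_neg]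

theorem d_ds (i j : ι) : M.d i * M.ds j = -(M.ds j * M.d i) := by
  simp only [ds, mul_smul_comm, smul_mul_assoc, M.dd i, smul_neg]

theorem E_us (i : ι) : M.E * M.us i = M.us i * M.E := by
  simp only [us, mul_smul_comm, smul_mul_assoc, M.Eu]

theorem E_ds (i : ι) : M.E * M.ds i = M.ds i * M.E := by
  simp only [ds, mul_smul_comm, smul_mul_assoc, M.Ed]

variable [Fintype ι]

def num : A := ∑ i, M.u i * M.d i
def om : A := ∑ i, M.us i * M.u i
def la : A := ∑ i, M.d i * M.ds i
def psi (T : A) : A := ∑ i, M.u i * T * M.d i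
def phi (T : A) : A := ∑ i, M.d i * T * M.u i
def theta (T : A) : A := ∑ i, M.us i * T * M.u i
def theta' (T : A) : A := ∑ i, M.d i * T * M.ds i

theorem sum_sharp (F : A → A → A) (hF : ∀ (a b : ℂ) x y, F (a • x) (b • y) = (a * b) • F x y) :
    ∑ i, F (M.us i) (M.ds i) = ∑ i, F (M.u i) (M.d i) := by
  let e : ι ≃ ι := ⟨M.σ, M.σ, M.σσ, M.σσ⟩
  rw [← Equiv.sum_comp e (fun i => F (M.u i) (M.d i))]
  refine Finset.sum_congr rfl fun i _ => ?_
  simp only [us, ds, hF, M.εε, one_smul]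
  rfl

theorem num_u (j : ι) : M.num * M.u j = M.u j * M.num + M.u j := by
  have : ∀ i, M.u i * M.d i * M.u j = M.u j * (M.u i * M.d i) + if i = j then M.u j else 0 := by
    intro i
    rw [mul_assoc, M.du, mul_sub, ← mul_assoc, M.uu i j, ← mul_assoc]
    split_ifs with h
    · subst h; noncomm_ring
    · noncomm_ring
  rw [num, Finset.sum_mul, Finset.mul_sum, Finset.sum_congr rfl fun i _ => this i,
    Finset.sum_add_distrib]
  simp

theorem d_num (j : ι) : M.d j * M.num = M.num * M.d j + M.d j := by
  have : ∀ i, M.d j * (M.u i * M.d i) = M.u i * M.d i * M.d j + if i = j then M.d j else 0 := by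
    intro i
    rw [← mul_assoc, M.du, sub_mul, mul_assoc, M.dd j i, mul_assoc]
    split_ifs with h h' h'
    · subst h; noncomm_ring
    · exact absurd h.symm h'
    · exact absurd h'.symm h
    · noncomm_ring
  rw [num, Finset.sum_mul, Finset.mul_sum, Finset.sum_congr rfl fun i _ => this i,
    Finset.sum_add_distrib]
  simp

theorem sum_d_u : ∑ i, M.d i * M.u i = (Fintype.card ι : A) - M.num := by
  simp [M.du, num]

theorem num_us (j : ι) : M.num * M.us j = M.us j * M.num + M.us j := by
  simp only [us, mul_smul_comm, smul_mul_assoc, M.num_u, smul_add]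

theorem ds_num (j : ι) : M.ds j * M.num = M.num * M.ds j + M.ds j := by
  simp only [ds, mul_smul_comm, smul_mul_assoc, M.d_num, smul_add]

theorem om_u (j : ι) : M.om * M.u j = M.u j * M.om := by
  rw [om, Finset.sum_mul, Finset.mul_sum]
  refine Finset.sum_congr rfl fun i _ => ?_
  linear_combination (norm := noncomm_ring) M.us i * M.uu i j - M.us_u i j * M.u i

theorem la_d (j : ι) : M.la * M.d j = M.d j * M.la := by
  rw [la, Finset.sum_mul, Finset.mul_sum]
  refine Finset.sum_congr rfl fun i _ => ?_
  linear_combination (norm := noncomm_ring) M.d i * M.d_ds j i - M.dd j i * M.ds i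

theorem d_om (i : ι) : M.d i * M.om = M.om * M.d i - 2 • M.us i := by
  have : ∀ j, M.d i * (M.us j * M.u j) = M.us j * M.u j * M.d i
      + ((if j = M.σ i then algebraMap ℂ A (M.ε j) else 0) * M.u j
      - M.us j * if i = j then 1 else 0) := by
    intro j
    have h1 := M.d_us i j
    simp only [M.eq_σ_iff i j] at h1
    linear_combination (norm := noncomm_ring) h1 * M.u j - M.us j * M.du i j
  rw [om, Finset.mul_sum, Finset.sum_congr rfl fun j _ => this j, Finset.sum_add_distrib,
    Finset.sum_sub_distrib, Finset.sum_mul]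
  simp only [ite_mul, zero_mul, mul_ite, mul_one, mul_zero, Finset.sum_ite_eq,
    Finset.sum_ite_eq', Finset.mem_univ, if_true, M.εσ, map_neg]
  rw [us, Algebra.smul_def]
  noncomm_ring

theorem la_u (i : ι) : M.la * M.u i = M.u i * M.la - 2 • M.ds i := by
  have : ∀ k, M.d k * M.ds k * M.u i = M.u i * (M.d k * M.ds k)
      + (M.d k * (if k = M.σ i then algebraMap ℂ A (M.ε k) else 0)
      - (if k = i then 1 else 0) * M.ds k) := by
    intro k
    linear_combination (norm := noncomm_ring) M.d k * M.ds_u k i - M.du k i * M.ds k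
  rw [la, Finset.sum_mul, Finset.sum_congr rfl fun j _ => this j, Finset.sum_add_distrib,
    Finset.sum_sub_distrib, Finset.mul_sum]
  simp only [ite_mul, zero_mul, mul_ite, one_mul, mul_zero,
    Finset.sum_ite_eq', Finset.mem_univ, if_true, M.εσ, map_neg]
  rw [ds, Algebra.smul_def, mul_neg, ← Algebra.commutes]
  noncomm_ring

theorem la_num : M.la * M.num = M.num * M.la + 2 • M.la := by
  rw [la, Finset.mul_sum, Finset.sum_mul, Finset.smul_sum, ← Finset.sum_add_distrib]
  refine Finset.sum_congr rfl fun i _ => ?_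
  linear_combination (norm := noncomm_ring) M.d i * M.ds_num i + M.d_num i * M.ds i

theorem E_num : M.E * M.num = M.num * M.E := by
  rw [num, Finset.mul_sum, Finset.sum_mul]
  refine Finset.sum_congr rfl fun i _ => ?_
  linear_combination (norm := noncomm_ring) M.Eu i * M.d i + M.u i * M.Ed i

/-! ### The maps `psi`, `phi` and `theta` -/

theorem psi_sharp (T : A) : ∑ i, M.us i * T * M.ds i = M.psi T :=
  M.sum_sharp (fun x y => x * T * y) fun a b x y => by
    simp only [mul_smul_comm, smul_mul_assoc, smul_smul, mul_comm]

/-- The Casimir identity for elements commuting with the symplectic Lie algebra. -/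
theorem casimir {T : A} (hT : ∀ i j, M.X i j * T = T * M.X i j) :
    M.num * ((Fintype.card ι : A) + 2 - M.num) * T + T * M.num
      = M.om * (M.la * T) + M.psi (M.phi T) - M.theta' (M.theta T) := by
  have h0 : ∑ j, ∑ i, M.us j * M.d i * (M.X i j * T - T * M.X i j) = 0 :=
    Finset.sum_eq_zero fun j _ => Finset.sum_eq_zero fun i _ => by rw [hT, sub_self, mul_zero]
  have h1 : ∑ j, ∑ i, M.us j * M.d i * (M.u i * M.ds j * T)
      = (Fintype.card ι + 1 - M.num) * M.num * T := by
    have : ∀ j, ∑ i, M.us j * M.d i * (M.u i * M.ds j * T)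
        = ((Fintype.card ι : A) + 1 - M.num) * (M.us j * M.ds j) * T := by
      intro j
      have e : ∀ i, M.us j * M.d i * (M.u i * M.ds j * T)
          = M.us j * (M.d i * M.u i) * (M.ds j * T) := fun i => by noncomm_ring
      rw [Finset.sum_congr rfl fun i _ => e i, ← Finset.sum_mul, ← Finset.mul_sum, M.sum_d_u]
      have c := (Nat.cast_commute (Fintype.card ι) (M.us j)).eq
      linear_combination (norm := noncomm_ring) M.num_us j * M.ds j * T - c * M.ds j * T
    rw [Finset.sum_congr rfl fun j _ => this j, ← Finset.sum_mul, ← Finset.mul_sum]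
    have := M.psi_sharp 1
    simp only [mul_one, psi] at this
    rw [this, num]
  have h2 : ∑ j, ∑ i, M.us j * M.d i * (M.u j * M.ds i * T)
      = M.num * T - M.om * (M.la * T) := by
    have : ∀ j, ∑ i, M.us j * M.d i * (M.u j * M.ds i * T)
        = M.us j * M.ds j * T - M.us j * M.u j * (M.la * T) := by
      intro j
      have e : ∀ i, M.us j * M.d i * (M.u j * M.ds i * T)
          = M.us j * ((if i = j then 1 else 0) * M.ds i) * T
            - M.us j * M.u j * (M.d i * M.ds i * T) := fun i => by
        linear_combination (norm := noncomm_ring) M.us j * M.du i j * M.ds i * T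
      rw [Finset.sum_congr rfl fun i _ => e i, Finset.sum_sub_distrib, ← Finset.mul_sum,
        ← Finset.sum_mul, ← Finset.mul_sum, ← Finset.sum_mul, la]
      simp
    rw [Finset.sum_congr rfl fun j _ => this j, Finset.sum_sub_distrib, ← Finset.sum_mul,
      ← Finset.sum_mul]
    have := M.psi_sharp 1
    simp only [mul_one, psi] at this
    rw [this, num, om]
  have h3 : ∑ j, ∑ i, M.us j * M.d i * (T * (M.u i * M.ds j)) = M.psi (M.phi T) := by
    rw [← M.psi_sharp, phi]
    refine Finset.sum_congr rfl fun j _ => ?_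
    rw [Finset.mul_sum, Finset.sum_mul]
    exact Finset.sum_congr rfl fun i _ => by noncomm_ring
  have h4 : ∑ j, ∑ i, M.us j * M.d i * (T * (M.u j * M.ds i))
      = -(T * M.num) - M.theta' (M.theta T) := by
    have e : ∀ j i, M.us j * M.d i * (T * (M.u j * M.ds i))
        = (if i = M.σ j then algebraMap ℂ A (M.ε j) else 0) * (T * (M.u j * M.ds i))
          - M.d i * (M.us j * T * M.u j) * M.ds i := fun j i => by
      linear_combination (norm := noncomm_ring) M.d_us i j * (T * (M.u j * M.ds i))
    rw [Finset.sum_congr rfl fun j _ => Finset.sum_congr rfl fun i _ => e j i]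
    simp only [Finset.sum_sub_distrib]
    congr 1
    · simp only [ite_mul, zero_mul, Finset.sum_ite_eq', Finset.mem_univ, if_true]
      rw [num, Finset.mul_sum, ← Finset.sum_neg_distrib]
      refine Finset.sum_congr rfl fun j _ => ?_
      rw [ds, M.σσ, M.εσ, ← Algebra.smul_def, mul_smul_comm, mul_smul_comm, smul_smul, mul_neg,
        M.εε, neg_smul, one_smul]
    · rw [Finset.sum_comm, theta', theta]
      refine Finset.sum_congr rfl fun i _ => ?_
      rw [Finset.mul_sum, Finset.sum_mul]
  have e : ∀ j i, M.us j * M.d i * (M.X i j * T - T * M.X i j)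
      = M.us j * M.d i * (M.u i * M.ds j * T) + M.us j * M.d i * (M.u j * M.ds i * T)
      - M.us j * M.d i * (T * (M.u i * M.ds j)) - M.us j * M.d i * (T * (M.u j * M.ds i)) :=
    fun j i => by rw [X]; noncomm_ring
  rw [Finset.sum_congr rfl fun j _ => Finset.sum_congr rfl fun i _ => e j i] at h0
  simp only [Finset.sum_sub_distrib, Finset.sum_add_distrib, h1, h2, h3, h4] at h0
  have c := (Nat.cast_commute (Fintype.card ι) M.num).eq
  linear_combination (norm := noncomm_ring) h0 - c * T

end SymplecticModes

section Number

open Polynomial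

variable {A : Type*} [Ring A] [Algebra ℂ A]

theorem aeval_mul_of_semiconj {a b z : A} (h : a * z = z * b) (p : ℂ[X]) :
    aeval a p * z = z * aeval b p := by
  induction p using Polynomial.induction_on' with
  | add p q hp hq => rw [map_add, map_add, add_mul, mul_add, hp, hq]
  | monomial n c =>
    have : a ^ n * z = z * b ^ n := ((show SemiconjBy z b a from h.symm).pow_right n).eq.symm
    rw [aeval_monomial, aeval_monomial, mul_assoc, this, ← mul_assoc, ← mul_assoc,
      Algebra.commutes]

theorem aeval_mul_of_eigen {a x : A} {m : ℂ} (h : a * x = m • x) (p : ℂ[X]) :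
    aeval a p * x = p.eval m • x := by
  have h' : a * x = x * algebraMap ℂ A m := by rw [h, ← Algebra.commutes, Algebra.smul_def]
  rw [aeval_mul_of_semiconj h', aeval_algebraMap_apply_eq_algebraMap_eval, ← Algebra.commutes,
    Algebra.smul_def]

theorem mul_aeval_of_eigen {a x : A} {m : ℂ} (h : x * a = m • x) (p : ℂ[X]) :
    x * aeval a p = p.eval m • x := by
  have h' : algebraMap ℂ A m * x = x * a := by rw [h, Algebra.smul_def]
  rw [← aeval_mul_of_semiconj h', aeval_algebraMap_apply_eq_algebraMap_eval, Algebra.smul_def]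

/-- A sum of `k` commuting idempotents is annihilated by `X (X - 1) ⋯ (X - k)`. -/
theorem aeval_descPochhammer_sum {ι : Type*} (n : ι → A) (s : Finset ι)
    (hn : ∀ i, n i * n i = n i) (hc : ∀ i j, n i * n j = n j * n i) :
    aeval (∑ i ∈ s, n i) (descPochhammer ℂ (s.card + 1)) = 0 := by
  classical
  induction s using Finset.induction_on with
  | empty => simp
  | insert i s hi ih =>
    rw [Finset.sum_insert hi, Finset.card_insert_of_notMem hi]
    set a := ∑ j ∈ s, n j with ha
    have hcom : n i * a = a * n i := by
      rw [ha, Finset.mul_sum, Finset.sum_mul]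
      exact Finset.sum_congr rfl fun j _ => hc i j
    have h1 : (n i + a) * n i = n i * (a + 1) := by
      linear_combination (norm := noncomm_ring) hn i - hcom
    have h2 : (n i + a) * (1 - n i) = (1 - n i) * a := by
      linear_combination (norm := noncomm_ring) hcom - hn i
    have e1 := aeval_mul_of_semiconj h1 (descPochhammer ℂ (s.card + 1 + 1))
    have e2 := aeval_mul_of_semiconj h2 (descPochhammer ℂ (s.card + 1 + 1))
    rw [descPochhammer_succ_right, map_mul (aeval a), ih, zero_mul, mul_zero] at e2
    rw [descPochhammer_succ_left, map_mul (aeval (a + 1)), aeval_comp] at e1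
    simp only [map_sub, aeval_X, map_one, add_sub_cancel_right, ih, mul_zero] at e1
    rw [← descPochhammer_succ_left] at e1
    rw [← descPochhammer_succ_right] at e2
    linear_combination (norm := noncomm_ring) e1 + e2

theorem descPochhammer_eval_ne_zero {k : ℕ} {m : ℂ} (hm : ∀ j : ℕ, j < k → m ≠ j) :
    (descPochhammer ℂ k).eval m ≠ 0 := by
  rw [descPochhammer_eval_eq_prod_range]
  exact Finset.prod_ne_zero_iff.2 fun j hj => sub_ne_zero.2 (hm j (Finset.mem_range.1 hj))

/-- A polynomial cutting out the kernel of an element with spectrum in `{0, …, k}`. -/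
theorem exists_vacuum_polynomial {a : A} {k : ℕ} (ha : aeval a (descPochhammer ℂ (k + 1)) = 0) :
    ∃ p : ℂ[X], p.eval 0 = 1 ∧ a * aeval a p = 0 := by
  set g := (descPochhammer ℂ k).comp (X - 1) with hg
  have h0 : g.eval 0 ≠ 0 := by
    rw [hg, eval_comp]
    refine descPochhammer_eval_ne_zero fun j _ h => ?_
    simp only [eval_sub, eval_X, eval_one, zero_sub] at h
    have : ((j + 1 : ℕ) : ℂ) = 0 := by push_cast; rw [← h]; ring
    exact Nat.succ_ne_zero j (Nat.cast_eq_zero.1 this)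
  refine ⟨(g.eval 0)⁻¹ • g, by simp [h0], ?_⟩
  rw [map_smul, mul_smul_comm]
  rw [descPochhammer_succ_left, map_mul, aeval_X] at ha
  rw [ha, smul_zero]

/-- Spectral decomposition of an element with spectrum in `{0, …, k}`. -/
theorem exists_spectral_projections {a : A} {k : ℕ}
    (ha : aeval a (descPochhammer ℂ (k + 1)) = 0) :
    ∃ p : ℕ → ℂ[X], ∑ i ∈ Finset.range (k + 1), aeval a (p i) = 1 ∧
      ∀ i ∈ Finset.range (k + 1), a * aeval a (p i) = (i : ℂ) • aeval a (p i) := by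
  have hinj : Set.InjOn (fun i : ℕ => (i : ℂ)) (Finset.range (k + 1)) :=
    fun i _ j _ h => Nat.cast_injective h
  refine ⟨fun i => Lagrange.basis (Finset.range (k + 1)) (fun i : ℕ => (i : ℂ)) i, ?_, ?_⟩
  · rw [← map_sum, Lagrange.sum_basis hinj ⟨0, by simp⟩, map_one]
  · intro i hi
    have hd : descPochhammer ℂ (k + 1)
        = Lagrange.nodal (Finset.range (k + 1)) (fun i : ℕ => (i : ℂ)) := by
      clear ha hi hinj
      induction k with
      | zero => simp [Lagrange.nodal]
      | succ k ih =>
        rw [descPochhammer_succ_right, ih, Lagrange.nodal, Lagrange.nodal,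
          Finset.prod_range_succ _ (k + 1)]
        simp
    have hb : (X - C (i : ℂ)) * Lagrange.basis (Finset.range (k + 1)) (fun i : ℕ => (i : ℂ)) i
        = C (Lagrange.nodalWeight (Finset.range (k + 1)) (fun i : ℕ => (i : ℂ)) i)
          * descPochhammer ℂ (k + 1) := by
      rw [hd, Lagrange.basis_eq_prod_sub_inv_mul_nodal_div hi,
        Lagrange.nodal_eq_mul_nodal_erase hi, mul_div_cancel_left₀]
      · ring
      · exact X_sub_C_ne_zero _
    have := congrArg (aeval a) hb
    rw [map_mul, map_mul, ha, mul_zero, map_sub, aeval_X, aeval_C, sub_mul, sub_eq_zero] at this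
    rw [this, Algebra.smul_def]

end Number

theorem eq_zero_of_eq_neg {A : Type*} [Ring A] [Algebra ℂ A] {x : A} (h : x = -x) : x = 0 := by
  have : (2 : ℂ) • x = 0 := by
    rw [two_smul]
    nth_rw 1 [h]
    simp
  simpa using this

namespace SymplecticModes

open Polynomial

variable {ι A : Type*} [DecidableEq ι] [Ring A] [Algebra ℂ A]
  (M : SymplecticModes ι A)

theorem u_sq (i : ι) : M.u i * M.u i = 0 := eq_zero_of_eq_neg (M.uu i i)
theorem ud_idem (i : ι) : M.u i * M.d i * (M.u i * M.d i) = M.u i * M.d i := by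
  have h := M.du i i
  rw [if_pos rfl] at h
  linear_combination (norm := noncomm_ring) M.u i * h * M.d i - M.u_sq i * M.d i * M.d i

theorem ud_comm (i j : ι) :
    M.u i * M.d i * (M.u j * M.d j) = M.u j * M.d j * (M.u i * M.d i) := by
  rcases eq_or_ne i j with rfl | hij
  · rfl
  have h1 := M.du i j
  have h2 := M.du j i
  rw [if_neg hij] at h1
  rw [if_neg hij.symm] at h2
  linear_combination (norm := noncomm_ring) M.u i * h1 * M.d j - M.u j * h2 * M.d i
    - M.uu i j * M.d i * M.d j + M.u j * M.u i * M.dd j i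

/-! ### Commutation with the symplectic Lie algebra -/

theorem d_X (i a b : ι) : M.d i * M.X a b = M.X a b * M.d i
    + (if i = a then M.ds b else 0) + (if i = b then M.ds a else 0) := by
  have h1 := M.du i a
  have h2 := M.du i b
  have e1 : (if i = a then M.ds b else 0) = (if i = a then 1 else 0) * M.ds b := by simp
  have e2 : (if i = b then M.ds a else 0) = (if i = b then 1 else 0) * M.ds a := by simp
  rw [SymplecticModes.X, e1, e2]
  linear_combination (norm := noncomm_ring) h1 * M.ds b + h2 * M.ds a - M.u a * M.d_ds i b
    - M.u b * M.d_ds i a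

theorem X_us (a b i : ι) : M.X a b * M.us i = M.us i * M.X a b
    + (if b = i then M.u a else 0) + (if a = i then M.u b else 0) := by
  have key : ∀ c, M.ds c * M.us i = (if c = i then 1 else 0) - M.us i * M.ds c := by
    intro c
    have h := M.d_us (M.σ c) i
    have e : (M.σ c = M.σ i) ↔ c = i :=
      ⟨fun h => by rw [← M.σσ c, h, M.σσ], fun h => by rw [h]⟩
    rw [ds, smul_mul_assoc, h, smul_sub, ← mul_smul_comm]
    congr 1
    simp only [e]
    split_ifs with hc
    · rw [hc, Algebra.smul_def, ← map_mul, M.εε, map_one]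
    · simp
  have e1 : (if b = i then M.u a else 0) = M.u a * (if b = i then 1 else 0) := by simp
  have e2 : (if a = i then M.u b else 0) = M.u b * (if a = i then 1 else 0) := by simp
  rw [SymplecticModes.X, e1, e2]
  linear_combination (norm := noncomm_ring) M.u a * key b + M.u b * key a - M.us_u i a * M.ds b
    - M.us_u i b * M.ds a

theorem X_u (a b i : ι) : M.X a b * M.u i = M.u i * M.X a b
    + M.u a * (if b = M.σ i then algebraMap ℂ A (M.ε b) else 0)
    + M.u b * (if a = M.σ i then algebraMap ℂ A (M.ε a) else 0) := by
  rw [SymplecticModes.X]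
  linear_combination (norm := noncomm_ring) M.u a * M.ds_u b i + M.u b * M.ds_u a i
    - M.uu i a * M.ds b - M.uu i b * M.ds a

variable [Fintype ι]

theorem aeval_num_eq_zero :
    aeval M.num (descPochhammer ℂ (Fintype.card ι + 1)) = 0 :=
  aeval_descPochhammer_sum (fun i => M.u i * M.d i) Finset.univ M.ud_idem M.ud_comm

theorem intCast_ne_of_outside {k : ℕ} {m : ℤ} (hm : m < 0 ∨ (k : ℤ) < m) :
    ∀ j : ℕ, j < k + 1 → (m : ℂ) ≠ j := by
  intro j hj h
  have : m = j := by exact_mod_cast h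
  omega

theorem eq_zero_of_num_mul {T : A} {m : ℤ} (h : M.num * T = (m : ℂ) • T)
    (hm : m < 0 ∨ (Fintype.card ι : ℤ) < m) : T = 0 := by
  have := aeval_mul_of_eigen h (descPochhammer ℂ (Fintype.card ι + 1))
  rw [M.aeval_num_eq_zero, zero_mul] at this
  exact (smul_eq_zero.1 this.symm).resolve_left
    (descPochhammer_eval_ne_zero (intCast_ne_of_outside hm))

theorem eq_zero_of_mul_num {T : A} {m : ℤ} (h : T * M.num = (m : ℂ) • T)
    (hm : m < 0 ∨ (Fintype.card ι : ℤ) < m) : T = 0 := by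
  have := mul_aeval_of_eigen h (descPochhammer ℂ (Fintype.card ι + 1))
  rw [M.aeval_num_eq_zero, mul_zero] at this
  exact (smul_eq_zero.1 this.symm).resolve_left
    (descPochhammer_eval_ne_zero (intCast_ne_of_outside hm))

/-- `T` has left number `m'` and right number `m`. -/
def HasDeg (T : A) (m' m : ℤ) : Prop := M.num * T = (m' : ℂ) • T ∧ T * M.num = (m : ℂ) • T

/-- `T` is supported on the corner cut out by `E`. -/
def Corner (T : A) : Prop := M.E * T = T ∧ T * M.E = T

/-- `T` commutes with the symplectic Lie algebra. -/
def SpInv (T : A) : Prop := ∀ i j, M.X i j * T = T * M.X i j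

/-- `T` maps the vacuum to the vacuum and annihilates everything else. -/
def IsVac (T : A) : Prop :=
  M.Corner T ∧ (∀ i, M.d i * T = 0) ∧ ∀ i, T * M.u i = 0

/-- Any two vacuum operators are proportional. -/
def VacUnique : Prop := ∀ T T', M.IsVac T → M.IsVac T' → T' ≠ 0 → ∃ c : ℂ, T = c • T'

variable {M}

theorem HasDeg.bounds {T : A} {m' m : ℤ} (h : M.HasDeg T m' m) (hT : T ≠ 0) :
    0 ≤ m' ∧ m' ≤ Fintype.card ι ∧ 0 ≤ m ∧ m ≤ Fintype.card ι := by
  have h1 := mt (M.eq_zero_of_num_mul h.1) hT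
  have h2 := mt (M.eq_zero_of_mul_num h.2) hT
  omega

variable (M)

theorem num_mul_d (i : ι) (T : A) {m : ℂ} (h : M.num * T = m • T) :
    M.num * (M.d i * T) = (m - 1) • (M.d i * T) := by
  have h' := M.d_num i
  rw [sub_smul, one_smul, ← mul_smul_comm, ← h]
  linear_combination (norm := noncomm_ring) -(h' * T)

theorem num_mul_us (i : ι) (T : A) {m : ℂ} (h : M.num * T = m • T) :
    M.num * (M.us i * T) = (m + 1) • (M.us i * T) := by
  have h' := M.num_us i
  rw [add_smul, one_smul, ← mul_smul_comm, ← h]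
  linear_combination (norm := noncomm_ring) (h' * T)

theorem mul_u_num (i : ι) (T : A) {m : ℂ} (h : T * M.num = m • T) :
    (T * M.u i) * M.num = (m - 1) • (T * M.u i) := by
  have h' := M.num_u i
  rw [sub_smul, one_smul, ← smul_mul_assoc, ← h]
  linear_combination (norm := noncomm_ring) -(T * h')

theorem d_mul_eq_zero {T : A} (h : M.num * T = 0) (i : ι) : M.d i * T = 0 := by
  refine M.eq_zero_of_num_mul (m := -1) ?_ (Or.inl (by norm_num))
  have := M.num_mul_d i T (m := 0) (by rw [h, zero_smul])
  simpa using this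

theorem mul_u_eq_zero {T : A} (h : T * M.num = 0) (i : ι) : T * M.u i = 0 := by
  refine M.eq_zero_of_mul_num (m := -1) ?_ (Or.inl (by norm_num))
  have := M.mul_u_num i T (m := 0) (by rw [h, zero_smul])
  simpa using this

theorem num_mul_eq_zero {T : A} (h : ∀ i, M.d i * T = 0) : M.num * T = 0 := by
  rw [num, Finset.sum_mul]
  exact Finset.sum_eq_zero fun i _ => by rw [mul_assoc, h, mul_zero]

theorem mul_num_eq_zero {T : A} (h : ∀ i, T * M.u i = 0) : T * M.num = 0 := by
  rw [num, Finset.mul_sum]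
  exact Finset.sum_eq_zero fun i _ => by rw [← mul_assoc, h, zero_mul]

/-- A polynomial in the number operator projecting on the vacuum. -/
def vacPoly : ℂ[X] := (exists_vacuum_polynomial M.aeval_num_eq_zero).choose

theorem vacPoly_eval : M.vacPoly.eval 0 = 1 :=
  (exists_vacuum_polynomial M.aeval_num_eq_zero).choose_spec.1

theorem num_mul_vac : M.num * aeval M.num M.vacPoly = 0 :=
  (exists_vacuum_polynomial M.aeval_num_eq_zero).choose_spec.2

theorem num_comm_aeval (p : ℂ[X]) : M.num * aeval M.num p = aeval M.num p * M.num :=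
  (aeval_mul_of_semiconj (rfl : M.num * M.num = M.num * M.num) p).symm

theorem E_comm_aeval (p : ℂ[X]) : M.E * aeval M.num p = aeval M.num p * M.E :=
  (aeval_mul_of_semiconj M.E_num.symm p).symm

theorem vac_mul {T : A} (h : M.num * T = 0) : aeval M.num M.vacPoly * T = T := by
  rw [aeval_mul_of_eigen (m := 0) (by rw [h, zero_smul]), M.vacPoly_eval, one_smul]

theorem mul_vac {T : A} (h : T * M.num = 0) : T * aeval M.num M.vacPoly = T := by
  rw [mul_aeval_of_eigen (m := 0) (by rw [h, zero_smul]), M.vacPoly_eval, one_smul]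

theorem isVac_vac : M.IsVac (aeval M.num M.vacPoly * M.E) := by
  refine ⟨⟨?_, ?_⟩, fun i => ?_, fun i => ?_⟩
  · rw [← mul_assoc, M.E_comm_aeval, mul_assoc, M.EE]
  · rw [mul_assoc, M.EE]
  · rw [← mul_assoc, M.d_mul_eq_zero M.num_mul_vac, zero_mul]
  · rw [mul_assoc, M.Eu, ← mul_assoc, M.mul_u_eq_zero, zero_mul]
    rw [← M.num_comm_aeval, M.num_mul_vac]

variable {M}

theorem IsVac.exists_smul (hv : M.VacUnique) {T : A} (h : M.IsVac T) :
    ∃ c : ℂ, T = c • (aeval M.num M.vacPoly * M.E) := by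
  by_cases h0 : aeval M.num M.vacPoly * M.E = 0
  · refine ⟨0, ?_⟩
    rw [zero_smul, ← M.vac_mul (M.num_mul_eq_zero h.2.1), ← h.1.1, ← mul_assoc, h0, zero_mul]
  · exact hv _ _ h M.isVac_vac h0

end SymplecticModes

namespace SymplecticModes

open Polynomial

variable {ι A : Type*} [DecidableEq ι] [Ring A] [Algebra ℂ A]
  (M : SymplecticModes ι A)

theorem ds_ds (i j : ι) : M.ds i * M.ds j = -(M.ds j * M.ds i) := by
  simp only [ds, smul_mul_assoc, mul_smul_comm, M.dd (M.σ i) (M.σ j), smul_neg, smul_comm (M.ε i)]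

variable [Fintype ι]

theorem la_ds (i : ι) : M.la * M.ds i = M.ds i * M.la := by
  rw [ds, mul_smul_comm, smul_mul_assoc, M.la_d]

theorem E_la : M.E * M.la = M.la * M.E := by
  rw [la, Finset.mul_sum, Finset.sum_mul]
  refine Finset.sum_congr rfl fun i _ => ?_
  linear_combination (norm := noncomm_ring) M.Ed i * M.ds i + M.d i * M.E_ds i

variable {M}

theorem SpInv.phi {T : A} (h : M.SpInv T) : M.SpInv (M.phi T) := by
  intro a b
  have e : ∀ i, M.X a b * (M.d i * T * M.u i) - M.d i * T * M.u i * M.X a b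
      = M.d i * T * M.u a * (if b = M.σ i then algebraMap ℂ A (M.ε b) else 0)
      + M.d i * T * M.u b * (if a = M.σ i then algebraMap ℂ A (M.ε a) else 0)
      - (if i = a then M.ds b else 0) * T * M.u i - (if i = b then M.ds a else 0) * T * M.u i := by
    intro i
    linear_combination (norm := noncomm_ring)
      M.d i * T * M.X_u a b i + M.d i * h a b * M.u i - M.d_X i a b * T * M.u i
  rw [← sub_eq_zero, SymplecticModes.phi, Finset.mul_sum, Finset.sum_mul,
    ← Finset.sum_sub_distrib, Finset.sum_congr rfl fun i _ => e i]
  simp only [Finset.sum_sub_distrib, Finset.sum_add_distrib, M.eq_σ_iff b, M.eq_σ_iff a,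
    mul_ite, ite_mul, mul_zero, zero_mul, Finset.sum_ite_eq',
    Finset.mem_univ, if_true]
  rw [ds, ds, ← Algebra.commutes, ← Algebra.commutes, ← Algebra.smul_def, ← Algebra.smul_def]
  simp only [smul_mul_assoc]
  abel

theorem SpInv.theta {T : A} (h : M.SpInv T) : M.SpInv (M.theta T) := by
  intro a b
  have e : ∀ i, M.X a b * (M.us i * T * M.u i) - M.us i * T * M.u i * M.X a b
      = M.us i * T * M.u a * (if b = M.σ i then algebraMap ℂ A (M.ε b) else 0)
      + M.us i * T * M.u b * (if a = M.σ i then algebraMap ℂ A (M.ε a) else 0)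
      + (if b = i then M.u a else 0) * T * M.u i + (if a = i then M.u b else 0) * T * M.u i := by
    intro i
    linear_combination (norm := noncomm_ring)
      M.us i * T * M.X_u a b i + M.us i * h a b * M.u i + M.X_us a b i * T * M.u i
  rw [← sub_eq_zero, SymplecticModes.theta, Finset.mul_sum, Finset.sum_mul,
    ← Finset.sum_sub_distrib, Finset.sum_congr rfl fun i _ => e i]
  simp only [Finset.sum_add_distrib, M.eq_σ_iff b, M.eq_σ_iff a,
    mul_ite, ite_mul, mul_zero, zero_mul, Finset.sum_ite_eq, Finset.sum_ite_eq',
    Finset.mem_univ, if_true]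
  rw [us, us, ← Algebra.commutes, ← Algebra.commutes, ← Algebra.smul_def, ← Algebra.smul_def]
  simp only [M.σσ, M.εσ, neg_smul, neg_mul, smul_neg, smul_mul_assoc, smul_smul, M.εε, one_smul]
  abel

theorem SpInv.la_mul {T : A} (h : M.SpInv T) : M.SpInv (M.la * T) := by
  intro a b
  have e : M.X a b * M.la = M.la * M.X a b := by
    rw [SymplecticModes.X]
    linear_combination (norm := noncomm_ring) -(M.u a * M.la_ds b) - M.u b * M.la_ds a
      - M.la_u a * M.ds b - M.la_u b * M.ds a + 2 * M.ds_ds a b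
  linear_combination (norm := noncomm_ring) e * T + M.la * h a b

theorem Corner.phi {T : A} (h : M.Corner T) : M.Corner (M.phi T) := by
  constructor
  · rw [SymplecticModes.phi, Finset.mul_sum]
    refine Finset.sum_congr rfl fun i _ => ?_
    linear_combination (norm := noncomm_ring) M.Ed i * T * M.u i + M.d i * h.1 * M.u i
  · rw [SymplecticModes.phi, Finset.sum_mul]
    refine Finset.sum_congr rfl fun i _ => ?_
    linear_combination (norm := noncomm_ring) M.d i * h.2 * M.u i - M.d i * T * M.Eu i

theorem Corner.theta {T : A} (h : M.Corner T) : M.Corner (M.theta T) := by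
  constructor
  · rw [SymplecticModes.theta, Finset.mul_sum]
    refine Finset.sum_congr rfl fun i _ => ?_
    linear_combination (norm := noncomm_ring) M.E_us i * T * M.u i + M.us i * h.1 * M.u i
  · rw [SymplecticModes.theta, Finset.sum_mul]
    refine Finset.sum_congr rfl fun i _ => ?_
    linear_combination (norm := noncomm_ring) M.us i * h.2 * M.u i - M.us i * T * M.Eu i

theorem Corner.la_mul {T : A} (h : M.Corner T) : M.Corner (M.la * T) :=
  ⟨by rw [← mul_assoc, M.E_la, mul_assoc, h.1], by rw [mul_assoc, h.2]⟩

theorem HasDeg.phi {T : A} {m' m : ℤ} (h : M.HasDeg T m' m) :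
    M.HasDeg (M.phi T) (m' - 1) (m - 1) := by
  constructor
  · rw [SymplecticModes.phi, Finset.mul_sum, Finset.smul_sum]
    refine Finset.sum_congr rfl fun i _ => ?_
    rw [← mul_assoc, M.num_mul_d i T h.1, smul_mul_assoc]
    push_cast; rfl
  · rw [SymplecticModes.phi, Finset.sum_mul, Finset.smul_sum]
    refine Finset.sum_congr rfl fun i _ => ?_
    rw [mul_assoc (M.d i), mul_assoc (M.d i), M.mul_u_num i T h.2, mul_smul_comm]
    push_cast; rfl

theorem HasDeg.theta {T : A} {m' m : ℤ} (h : M.HasDeg T m' m) :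
    M.HasDeg (M.theta T) (m' + 1) (m - 1) := by
  constructor
  · rw [SymplecticModes.theta, Finset.mul_sum, Finset.smul_sum]
    refine Finset.sum_congr rfl fun i _ => ?_
    rw [← mul_assoc, M.num_mul_us i T h.1, smul_mul_assoc]
    push_cast; rfl
  · rw [SymplecticModes.theta, Finset.sum_mul, Finset.smul_sum]
    refine Finset.sum_congr rfl fun i _ => ?_
    rw [mul_assoc (M.us i), mul_assoc (M.us i), M.mul_u_num i T h.2, mul_smul_comm]
    push_cast; rfl

theorem HasDeg.la_mul {T : A} {m' m : ℤ} (h : M.HasDeg T m' m) :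
    M.HasDeg (M.la * T) (m' - 2) m := by
  constructor
  · have e := M.la_num
    have h1 := h.1
    have : ((m' - 2 : ℤ) : ℂ) • (M.la * T) = M.la * (M.num * T) - 2 • (M.la * T) := by
      rw [h1, mul_smul_comm, ← Nat.cast_smul_eq_nsmul ℂ, ← sub_smul]
      push_cast; rfl
    rw [this]
    linear_combination (norm := noncomm_ring) -(e * T)
  · rw [mul_assoc, h.2, mul_smul_comm]

variable (M)

/-- The span of the normally ordered monomials in `om`, `la` and the number operator. -/
def howeSpan : Submodule ℂ A :=
  Submodule.span ℂ {T | ∃ (k l : ℕ) (p : ℂ[X]), T = M.om ^ k * M.la ^ l * aeval M.num p * M.E}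

/-- The span of the monomials in `om` and the number operator. -/
def omSpan : Submodule ℂ A :=
  Submodule.span ℂ {T | ∃ (k : ℕ) (p : ℂ[X]), T = M.om ^ k * aeval M.num p * M.E}

/-- The span of the operators sending the vacuum to powers of `om`. -/
def omVacSpan : Submodule ℂ A :=
  Submodule.span ℂ {T | ∃ k : ℕ, T = M.om ^ k * aeval M.num M.vacPoly * M.E}

theorem omVacSpan_le_omSpan : M.omVacSpan ≤ M.omSpan :=
  Submodule.span_mono fun _ ⟨k, h⟩ => ⟨k, M.vacPoly, h⟩

theorem mem_howeSpan (k l : ℕ) (p : ℂ[X]) :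
    M.om ^ k * M.la ^ l * aeval M.num p * M.E ∈ M.howeSpan :=
  Submodule.subset_span ⟨k, l, p, rfl⟩

theorem mem_omSpan (k : ℕ) (p : ℂ[X]) : M.om ^ k * aeval M.num p * M.E ∈ M.omSpan :=
  Submodule.subset_span ⟨k, p, rfl⟩

theorem om_mul_mem {T : A} (h : T ∈ M.howeSpan) : M.om * T ∈ M.howeSpan := by
  induction h using Submodule.span_induction with
  | mem T h =>
    obtain ⟨k, l, p, rfl⟩ := h
    have := M.mem_howeSpan (k + 1) l p
    rw [pow_succ'] at this
    simpa only [mul_assoc] using this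
  | zero => simp
  | add x y _ _ hx hy => rw [mul_add]; exact add_mem hx hy
  | smul c x _ hx => rw [mul_smul_comm]; exact Submodule.smul_mem _ _ hx

theorem psi_add (S T : A) : M.psi (S + T) = M.psi S + M.psi T := by
  simp [psi, mul_add, add_mul, Finset.sum_add_distrib]

theorem psi_smul (c : ℂ) (T : A) : M.psi (c • T) = c • M.psi T := by
  simp [psi, Finset.smul_sum]

theorem theta'_add (S T : A) : M.theta' (S + T) = M.theta' S + M.theta' T := by
  simp [theta', mul_add, add_mul, Finset.sum_add_distrib]

theorem theta'_smul (c : ℂ) (T : A) : M.theta' (c • T) = c • M.theta' T := by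
  simp [theta', Finset.smul_sum]

theorem psi_om_mul (T : A) : M.psi (M.om * T) = M.om * M.psi T := by
  rw [psi, psi, Finset.mul_sum]
  refine Finset.sum_congr rfl fun i _ => ?_
  linear_combination (norm := noncomm_ring) -(M.om_u i * T * M.d i)

theorem psi_om_pow_mul (k : ℕ) (T : A) : M.psi (M.om ^ k * T) = M.om ^ k * M.psi T := by
  induction k with
  | zero => simp
  | succ k ih => rw [pow_succ', mul_assoc, psi_om_mul, ih, mul_assoc]

theorem theta'_om_mul (T : A) : M.theta' (M.om * T) = M.om * M.theta' T - 2 • M.psi T := by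
  rw [theta', theta', ← M.psi_sharp, Finset.mul_sum, Finset.smul_sum, ← Finset.sum_sub_distrib]
  refine Finset.sum_congr rfl fun i _ => ?_
  linear_combination (norm := noncomm_ring) M.d_om i * T * M.ds i

theorem aeval_comp_sub_one (p : ℂ[X]) (a : A) :
    aeval a (p.comp (Polynomial.X - 1)) = aeval (a - 1) p := by
  rw [aeval_comp]; simp

theorem aeval_mul_E_d (p : ℂ[X]) (i : ι) :
    aeval M.num p * M.E * M.d i = M.d i * (aeval M.num (p.comp (Polynomial.X - 1)) * M.E) := by
  have h : M.num * M.d i = M.d i * (M.num - 1) := by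
    linear_combination (norm := noncomm_ring) -(M.d_num i)
  rw [aeval_comp_sub_one, mul_assoc, M.Ed, ← mul_assoc, ← mul_assoc, aeval_mul_of_semiconj h]

theorem aeval_mul_E_ds (p : ℂ[X]) (i : ι) :
    aeval M.num p * M.E * M.ds i = M.ds i * (aeval M.num (p.comp (Polynomial.X - 1)) * M.E) := by
  rw [ds, mul_smul_comm, smul_mul_assoc, M.aeval_mul_E_d]

theorem psi_mul_aeval (T : A) (p : ℂ[X]) : M.psi (T * (aeval M.num p * M.E))
    = M.psi T * (aeval M.num (p.comp (Polynomial.X - 1)) * M.E) := by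
  rw [psi, psi, Finset.sum_mul]
  refine Finset.sum_congr rfl fun i _ => ?_
  linear_combination (norm := noncomm_ring) M.u i * T * M.aeval_mul_E_d p i

theorem theta'_mul_aeval (T : A) (p : ℂ[X]) : M.theta' (T * (aeval M.num p * M.E))
    = M.theta' T * (aeval M.num (p.comp (Polynomial.X - 1)) * M.E) := by
  rw [theta', theta', Finset.sum_mul]
  refine Finset.sum_congr rfl fun i _ => ?_
  linear_combination (norm := noncomm_ring) M.d i * T * M.aeval_mul_E_ds p i

theorem la_pow_d (l : ℕ) (i : ι) : M.la ^ l * M.d i = M.d i * M.la ^ l :=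
  ((show Commute M.la (M.d i) from M.la_d i).pow_left l).eq

theorem la_pow_ds (l : ℕ) (i : ι) : M.la ^ l * M.ds i = M.ds i * M.la ^ l :=
  ((show Commute M.la (M.ds i) from M.la_ds i).pow_left l).eq

theorem num_la_pow (l : ℕ) : M.num * M.la ^ l = M.la ^ l * (M.num - 2 * l) := by
  induction l with
  | zero => simp
  | succ l ih =>
    have c := (Nat.cast_commute l M.la).eq
    rw [pow_succ, ← mul_assoc, ih]
    push_cast
    linear_combination (norm := noncomm_ring) -(M.la ^ l * M.la_num) - 2 * M.la ^ l * c

theorem psi_la_pow (l : ℕ) : M.psi (M.la ^ l) = M.la ^ l * (M.num - 2 * l) := by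
  rw [← num_la_pow, psi, num, Finset.sum_mul]
  exact Finset.sum_congr rfl fun i _ => by rw [mul_assoc, M.la_pow_d, mul_assoc]

theorem theta'_la_pow (l : ℕ) : M.theta' (M.la ^ l) = M.la ^ (l + 1) := by
  rw [pow_succ', theta', la, Finset.sum_mul]
  exact Finset.sum_congr rfl fun i _ => by rw [mul_assoc, ← la, M.la_pow_ds, mul_assoc]

theorem psi_mem {T : A} (h : T ∈ M.howeSpan) : M.psi T ∈ M.howeSpan := by
  induction h using Submodule.span_induction with
  | mem T h =>
    obtain ⟨k, l, p, rfl⟩ := h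
    rw [mul_assoc, mul_assoc, psi_om_pow_mul, psi_mul_aeval, psi_la_pow]
    convert M.mem_howeSpan k l ((Polynomial.X - 2 * (l : ℂ[X])) * p.comp (Polynomial.X - 1)) using 1
    simp [mul_assoc, map_ofNat]
  | zero => simp [psi]
  | add x y _ _ hx hy => rw [psi_add]; exact add_mem hx hy
  | smul c x _ hx => rw [psi_smul]; exact Submodule.smul_mem _ _ hx

theorem theta'_mem {T : A} (h : T ∈ M.howeSpan) : M.theta' T ∈ M.howeSpan := by
  induction h using Submodule.span_induction with
  | mem T h =>
    obtain ⟨k, l, p, rfl⟩ := h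
    induction k with
    | zero =>
      rw [pow_zero, one_mul, mul_assoc, theta'_mul_aeval, theta'_la_pow]
      convert M.mem_howeSpan 0 (l + 1) (p.comp (Polynomial.X - 1)) using 1
      simp [mul_assoc]
    | succ k ih =>
      have e : M.om ^ (k + 1) * M.la ^ l * aeval M.num p * M.E
        = M.om * (M.om ^ k * M.la ^ l * aeval M.num p * M.E) := by
        rw [pow_succ']; simp only [mul_assoc]
      rw [e, theta'_om_mul]
      exact sub_mem (M.om_mul_mem ih) (Submodule.smul_of_tower_mem _ 2
        (M.psi_mem (M.mem_howeSpan k l p)))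
  | zero => simp [theta']
  | add x y _ _ hx hy => rw [theta'_add]; exact add_mem hx hy
  | smul c x _ hx => rw [theta'_smul]; exact Submodule.smul_mem _ _ hx

theorem psi_mem_omSpan {T : A} (h : T ∈ M.omSpan) : M.psi T ∈ M.omSpan := by
  induction h using Submodule.span_induction with
  | mem T h =>
    obtain ⟨k, p, rfl⟩ := h
    have e := M.psi_mul_aeval (M.la ^ 0) p
    rw [psi_la_pow] at e
    rw [mul_assoc, psi_om_pow_mul, ← one_mul (aeval M.num p * M.E), ← pow_zero M.la, e]
    convert M.mem_omSpan k (Polynomial.X * p.comp (Polynomial.X - 1)) using 1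
    simp [mul_assoc]
  | zero => simp [psi]
  | add x y _ _ hx hy => rw [psi_add]; exact add_mem hx hy
  | smul c x _ hx => rw [psi_smul]; exact Submodule.smul_mem _ _ hx

variable {M}

theorem HasDeg.isVac {T : A} (hd : M.HasDeg T 0 0) (hc : M.Corner T) : M.IsVac T :=
  ⟨hc, M.d_mul_eq_zero (by simpa using hd.1), M.mul_u_eq_zero (by simpa using hd.2)⟩

/-- First fundamental theorem: operators commuting with the symplectic Lie algebra are
generated by `om`, `la` and the number operator. -/
theorem SpInv.mem_howeSpan (hv : M.VacUnique) {T : A} {m' m : ℤ} (hT : M.SpInv T)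
    (hc : M.Corner T) (hd : M.HasDeg T m' m) : T ∈ M.howeSpan := by
  obtain ⟨K, hK⟩ : ∃ K : ℕ, 2 * m + m' < K :=
    ⟨(2 * m + m' + 1).toNat, by omega⟩
  induction K generalizing T m m' with
  | zero =>
    by_cases h0 : T = 0
    · rw [h0]; exact zero_mem _
    · have := hd.bounds h0
      omega
  | succ K ih =>
    by_cases h0 : T = 0
    · rw [h0]; exact zero_mem _
    obtain ⟨b1, b2, b3, b4⟩ := hd.bounds h0
    by_cases hm : m = 0 ∧ m' = 0
    · obtain ⟨rfl, rfl⟩ := hm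
      obtain ⟨c, rfl⟩ := (hd.isVac hc).exists_smul hv
      refine Submodule.smul_mem _ _ ?_
      simpa using M.mem_howeSpan 0 0 M.vacPoly
    have key := M.casimir hT
    have h1 := ih hT.la_mul hc.la_mul hd.la_mul (by omega)
    have h2 := ih hT.phi hc.phi hd.phi (by omega)
    have h3 := ih hT.theta hc.theta hd.theta (by omega)
    have h4 := sub_mem (add_mem (M.om_mul_mem h1) (M.psi_mem h2)) (M.theta'_mem h3)
    rw [← key, mul_assoc] at h4
    have e : M.num * (((Fintype.card ι : A) + 2 - M.num) * T) + T * M.num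
        = ((m' * (Fintype.card ι + 2 - m') + m : ℤ) : ℂ) • T := by
      have e1 : ((Fintype.card ι : A) + 2 - M.num) * T
          = ((Fintype.card ι : ℂ) + 2 - m') • T := by
        rw [sub_mul, hd.1, add_mul, sub_smul, add_smul, Nat.cast_smul_eq_nsmul, nsmul_eq_mul,
          two_mul, two_smul]
      rw [e1, mul_smul_comm, hd.1, hd.2, smul_smul, ← add_smul]
      push_cast
      ring_nf
    rw [e] at h4
    refine (Submodule.smul_mem_iff _ ?_).1 h4
    rw [Int.cast_ne_zero]
    have : 0 ≤ m' * (Fintype.card ι + 2 - m') := mul_nonneg b1 (by omega)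
    rcases eq_or_lt_of_le b1 with h | h
    · omega
    · have : 0 < m' * (Fintype.card ι + 2 - m') := mul_pos h (by omega)
      omega

theorem mem_omVacSpan {T : A} (hT : T ∈ M.howeSpan) (h : T * M.num = 0) :
    T ∈ M.omVacSpan := by
  rw [← M.mul_vac h]
  clear h
  induction hT using Submodule.span_induction with
  | mem T h =>
    obtain ⟨k, l, p, rfl⟩ := h
    have e : aeval M.num p * M.E * aeval M.num M.vacPoly
        = p.eval 0 • (aeval M.num M.vacPoly * M.E) := by
      rw [mul_assoc, M.E_comm_aeval, ← mul_assoc, aeval_mul_of_eigen (m := 0), smul_mul_assoc]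
      rw [M.num_mul_vac, zero_smul]
    rw [mul_assoc _ (aeval M.num p), mul_assoc _ (_ * _), e, mul_smul_comm]
    refine Submodule.smul_mem _ _ ?_
    cases l with
    | zero => exact Submodule.subset_span ⟨k, by simp [mul_assoc]⟩
    | succ l =>
      have : M.la * aeval M.num M.vacPoly = 0 := by
        rw [la, Finset.sum_mul]
        refine Finset.sum_eq_zero fun i _ => ?_
        rw [mul_assoc, ds, smul_mul_assoc, M.d_mul_eq_zero M.num_mul_vac, smul_zero, mul_zero]
      rw [pow_succ, ← mul_assoc (M.om ^ k), mul_assoc _ M.la, ← mul_assoc M.la, this]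
      simp
  | zero => simp
  | add x y _ _ hx hy => rw [add_mul]; exact add_mem hx hy
  | smul c x _ hx => rw [smul_mul_assoc]; exact Submodule.smul_mem _ _ hx

/-- Operators `C` commuting with the symplectic Lie algebra and skew with respect to the
creation operators do not involve `la`. -/
theorem SpInv.mem_omSpan (hv : M.VacUnique) {C : A} {m' m : ℤ} (hC : M.SpInv C)
    (hc : M.Corner C) (hd : M.HasDeg C m' m)
    (hs : ∀ i j, M.u i * C * M.u j = -(M.u j * C * M.u i)) : C ∈ M.omSpan := by
  obtain ⟨K, hK⟩ : ∃ K : ℕ, m < K := ⟨(m + 1).toNat, by omega⟩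
  induction K generalizing C m m' with
  | zero =>
    by_cases h0 : C = 0
    · rw [h0]; exact zero_mem _
    · have := hd.bounds h0
      omega
  | succ K ih =>
    by_cases h0 : C = 0
    · rw [h0]; exact zero_mem _
    obtain ⟨b1, b2, b3, b4⟩ := hd.bounds h0
    by_cases hm : m = 0
    · subst hm
      exact M.omVacSpan_le_omSpan (mem_omVacSpan (hC.mem_howeSpan hv hc hd) (by simpa using hd.2))
    have key : M.psi (M.phi C) = C * M.num + ((Fintype.card ι : A) - M.num) * (C * M.num) := by
      have e : ∀ i j, M.u i * (M.d j * C * M.u j) * M.d i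
          = C * ((if j = i then 1 else 0) * (M.u j * M.d i))
            + M.d j * M.u j * (C * (M.u i * M.d i)) := by
        intro i j
        have e1 : C * ((if j = i then 1 else 0) * (M.u j * M.d i))
          = (if j = i then 1 else 0) * (C * (M.u j * M.d i)) := by split_ifs <;> simp
        rw [e1]
        linear_combination (norm := noncomm_ring) (M.du j i * C * M.u j * M.d i)
          - M.d j * hs i j * M.d i
      have e' : ∀ i, M.u i * (M.phi C) * M.d i = C * (M.u i * M.d i)
          + ((Fintype.card ι : A) - M.num) * (C * (M.u i * M.d i)) := by
        intro i
        rw [SymplecticModes.phi, Finset.mul_sum, Finset.sum_mul,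
          Finset.sum_congr rfl fun j _ => e i j, Finset.sum_add_distrib, ← Finset.mul_sum,
          ← Finset.sum_mul, M.sum_d_u]
        simp
      rw [psi, Finset.sum_congr rfl fun i _ => e' i, Finset.sum_add_distrib, ← Finset.mul_sum,
        ← Finset.mul_sum, ← Finset.mul_sum, num]
    have hs' : ∀ i j, M.u i * M.phi C * M.u j = -(M.u j * M.phi C * M.u i) := by
      have e : ∀ i j, M.u i * M.phi C * M.u j
          = C * (M.u i * M.u j) + ((Fintype.card ι : A) - M.num) * (C * (M.u i * M.u j)) := by
        intro i j
        have e : ∀ k, M.u i * (M.d k * C * M.u k) * M.u j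
            = C * ((if k = i then 1 else 0) * (M.u k * M.u j))
              + M.d k * M.u k * (C * (M.u i * M.u j)) := by
          intro k
          have e1 : C * ((if k = i then 1 else 0) * (M.u k * M.u j))
            = (if k = i then 1 else 0) * (C * (M.u k * M.u j)) := by split_ifs <;> simp
          rw [e1]
          linear_combination (norm := noncomm_ring) (M.du k i * C * M.u k * M.u j)
            - M.d k * hs i k * M.u j
        rw [SymplecticModes.phi, Finset.mul_sum, Finset.sum_mul,
          Finset.sum_congr rfl fun k _ => e k, Finset.sum_add_distrib, ← Finset.mul_sum,
          ← Finset.sum_mul, M.sum_d_u]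
        simp
      intro i j
      rw [e, e, M.uu i j]
      noncomm_ring
    have h := M.psi_mem_omSpan (ih hC.phi hc.phi hd.phi hs' (by omega))
    have e : C * M.num + ((Fintype.card ι : A) - M.num) * (C * M.num)
        = ((m * (Fintype.card ι + 1 - m') : ℤ) : ℂ) • C := by
      rw [hd.2, mul_smul_comm, sub_mul, hd.1, ← nsmul_eq_mul, ← Nat.cast_smul_eq_nsmul ℂ,
        ← sub_smul, smul_smul, ← add_smul]
      push_cast
      ring_nf
    rw [key, e] at h
    refine (Submodule.smul_mem_iff _ ?_).1 h
    rw [Int.cast_ne_zero]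
    exact mul_ne_zero hm (by omega)

/-- Operators commuting with all bilinears `u i * d j` are polynomials in the number operator. -/
theorem exists_aeval_of_gl_inv (hv : M.VacUnique) {T : A} {m' m : ℤ}
    (hT : ∀ i j, M.u i * M.d j * T = T * (M.u i * M.d j))
    (hc : M.Corner T) (hd : M.HasDeg T m' m) : ∃ p : ℂ[X], T = aeval M.num p * M.E := by
  obtain ⟨K, hK⟩ : ∃ K : ℕ, m < K := ⟨(m + 1).toNat, by omega⟩
  induction K generalizing T m m' with
  | zero =>
    by_cases h0 : T = 0
    · exact ⟨0, by simp [h0]⟩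
    · have := hd.bounds h0
      omega
  | succ K ih =>
    by_cases h0 : T = 0
    · exact ⟨0, by simp [h0]⟩
    obtain ⟨b1, b2, b3, b4⟩ := hd.bounds h0
    have hmm : m' = m := by
      have : M.num * T = T * M.num := by
        rw [num, Finset.sum_mul, Finset.mul_sum]
        exact Finset.sum_congr rfl fun i _ => hT i i
      rw [hd.1, hd.2] at this
      exact_mod_cast smul_left_injective ℂ h0 this
    subst hmm
    by_cases hm : m' = 0
    · subst hm
      obtain ⟨c, hc'⟩ := (hd.isVac hc).exists_smul hv
      exact ⟨c • M.vacPoly, by rw [hc']; simp⟩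
    have key : M.psi (M.phi T) = T * M.num + ((Fintype.card ι : A) - M.num) * (T * M.num) := by
      have e' : ∀ i, M.u i * (M.phi T) * M.d i = T * (M.u i * M.d i)
          + ((Fintype.card ι : A) - M.num) * (T * (M.u i * M.d i)) := by
        intro i
        have e : ∀ j, M.u i * (M.d j * T * M.u j) * M.d i
            = M.u i * (M.d j * M.u j) * M.d i * T := by
          intro j
          linear_combination (norm := noncomm_ring) -(M.u i * M.d j * hT j i)
        rw [SymplecticModes.phi, Finset.mul_sum, Finset.sum_mul,
          Finset.sum_congr rfl fun j _ => e j, ← Finset.sum_mul, ← Finset.sum_mul,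
          ← Finset.mul_sum, M.sum_d_u, ← hT]
        have c := (Nat.cast_commute (Fintype.card ι) (M.u i)).eq
        linear_combination (norm := noncomm_ring) M.num_u i * M.d i * T - c * M.d i * T
      rw [psi, Finset.sum_congr rfl fun i _ => e' i, Finset.sum_add_distrib, ← Finset.mul_sum,
        ← Finset.mul_sum, ← Finset.mul_sum, num]
    have hT' : ∀ a b, M.u a * M.d b * M.phi T = M.phi T * (M.u a * M.d b) := by
      intro a b
      have e : ∀ i, M.u a * M.d b * (M.d i * T * M.u i) - M.d i * T * M.u i * (M.u a * M.d b)
          = M.d i * T * (M.u a * (if b = i then 1 else 0))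
          - (if i = a then 1 else 0) * M.d b * T * M.u i := by
        intro i
        linear_combination (norm := noncomm_ring)
          M.d i * T * M.u a * M.du b i - M.d i * T * M.uu i a * M.d b + M.d i * hT a b * M.u i
          - M.du i a * M.d b * T * M.u i + M.u a * M.dd b i * T * M.u i
      rw [← sub_eq_zero, SymplecticModes.phi, Finset.mul_sum, Finset.sum_mul,
        ← Finset.sum_sub_distrib, Finset.sum_congr rfl fun i _ => e i]
      simp [Finset.sum_sub_distrib, mul_assoc]
    obtain ⟨p, hp⟩ := ih hT' hc.phi hd.phi (by omega)
    have e : T * M.num + ((Fintype.card ι : A) - M.num) * (T * M.num)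
        = ((m' * (Fintype.card ι + 1 - m') : ℤ) : ℂ) • T := by
      rw [hd.2, mul_smul_comm, sub_mul, hd.1, ← nsmul_eq_mul, ← Nat.cast_smul_eq_nsmul ℂ,
        ← sub_smul, smul_smul, ← add_smul]
      push_cast
      ring_nf
    have e2 := M.psi_mul_aeval (M.la ^ 0) p
    rw [psi_la_pow] at e2
    rw [e, hp, ← one_mul (aeval M.num p * M.E), ← pow_zero M.la, e2] at key
    have hne : ((m' * (Fintype.card ι + 1 - m') : ℤ) : ℂ) ≠ 0 := by
      rw [Int.cast_ne_zero]
      exact mul_ne_zero hm (by omega)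
    refine ⟨((m' * (Fintype.card ι + 1 - m') : ℤ) : ℂ)⁻¹ •
      (Polynomial.X * p.comp (Polynomial.X - 1)), ?_⟩
    rw [map_smul, smul_mul_assoc, eq_inv_smul_iff₀ hne, ← key]
    simp [mul_assoc]

end SymplecticModes

namespace SymplecticModes

open Polynomial

variable {ι A : Type*} [DecidableEq ι] [Ring A] [Algebra ℂ A]
  (M : SymplecticModes ι A)

/-- `z` anticommutes with all the modes. -/
structure IsOdd (z : A) : Prop where
  u : ∀ i, z * M.u i = -(M.u i * z)
  d : ∀ i, z * M.d i = -(M.d i * z)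

variable {M} {z : A}

theorem IsOdd.us (h : M.IsOdd z) (i : ι) : z * M.us i = -(M.us i * z) := by
  rw [SymplecticModes.us, mul_smul_comm, h.u, smul_mul_assoc, smul_neg]

theorem IsOdd.ds (h : M.IsOdd z) (i : ι) : z * M.ds i = -(M.ds i * z) := by
  rw [SymplecticModes.ds, mul_smul_comm, h.d, smul_mul_assoc, smul_neg]

theorem IsOdd.X (h : M.IsOdd z) (i j : ι) : z * M.X i j = M.X i j * z := by
  rw [SymplecticModes.X]
  linear_combination (norm := noncomm_ring) h.u i * M.ds j + h.u j * M.ds i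
    - M.u i * h.ds j - M.u j * h.ds i

variable [Fintype ι]

theorem IsOdd.num (h : M.IsOdd z) : Commute z M.num :=
  Commute.sum_right _ _ _ fun i _ => by
    show _ = _
    linear_combination (norm := noncomm_ring) h.u i * M.d i - M.u i * h.d i

theorem IsOdd.om (h : M.IsOdd z) : Commute z M.om :=
  Commute.sum_right _ _ _ fun i _ => by
    show _ = _
    linear_combination (norm := noncomm_ring) h.us i * M.u i - M.us i * h.u i

theorem IsOdd.la (h : M.IsOdd z) : Commute z M.la :=
  Commute.sum_right _ _ _ fun i _ => by
    show _ = _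
    linear_combination (norm := noncomm_ring) h.d i * M.ds i - M.d i * h.ds i

theorem IsOdd.aeval (h : M.IsOdd z) (p : ℂ[X]) : z * aeval M.num p = aeval M.num p * z :=
  (aeval_mul_of_semiconj h.num.eq.symm p).symm

end SymplecticModes

/-- Symplectic modes together with two further fermionic modes `r` and `q`. -/
structure BlockModes (ι A : Type*) [DecidableEq ι] [Ring A] [Algebra ℂ A] extends
    SymplecticModes ι A where
  r : A
  dr : A
  q : A
  dq : A
  rr : r * r = 0
  qq : q * q = 0
  drdr : dr * dr = 0
  dqdq : dq * dq = 0
  qr : q * r = -(r * q)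
  dqdr : dq * dr = -(dr * dq)
  dr_r : dr * r = 1 - r * dr
  dq_q : dq * q = 1 - q * dq
  dr_q : dr * q = -(q * dr)
  dq_r : dq * r = -(r * dq)
  odd_r : toSymplecticModes.IsOdd r
  odd_dr : toSymplecticModes.IsOdd dr
  odd_q : toSymplecticModes.IsOdd q
  odd_dq : toSymplecticModes.IsOdd dq
  E_eq : E = dr * r * (dq * q)

namespace BlockModes

open Polynomial

variable {ι A : Type*} [DecidableEq ι] [Ring A] [Algebra ℂ A]
  (M : BlockModes ι A)

theorem dr_E : M.dr * M.E = 0 := by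
  rw [M.E_eq]
  linear_combination (norm := noncomm_ring) M.drdr * M.r * (M.dq * M.q)

theorem dq_E : M.dq * M.E = 0 := by
  rw [M.E_eq]
  linear_combination (norm := noncomm_ring) M.dqdr * M.r * (M.dq * M.q)
    - M.dr * M.dq_r * M.dq * M.q + M.dr * M.r * M.dqdq * M.q

theorem E_q : M.E * M.q = 0 := by
  rw [M.E_eq]
  linear_combination (norm := noncomm_ring) M.dr * M.r * M.dq * M.qq

theorem E_r : M.E * M.r = 0 := by
  rw [M.E_eq]
  linear_combination (norm := noncomm_ring) M.dr * M.r * M.dq * M.qr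
    - M.dr * M.r * M.dq_r * M.q + M.dr * M.rr * M.dq * M.q

theorem rEdr : M.r * M.E * M.dr = M.r * M.dr * (M.dq * M.q) := by
  rw [M.E_eq]
  linear_combination (norm := noncomm_ring) M.r * M.dr_r * M.dq * M.q * M.dr
    + M.r * M.dq * M.dr_q - M.r * M.dqdr * M.q - M.rr * M.dr * M.dq * M.q * M.dr

theorem qEdq : M.q * M.E * M.dq = M.dr * M.r * (M.q * M.dq) := by
  have h : M.q * M.E = M.dr * M.r * M.q := by
    rw [M.E_eq]
    linear_combination (norm := noncomm_ring) M.dr * M.r * M.q * M.dq_q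
      - M.dr * M.qr * M.dq * M.q + M.dr_q * M.r * M.dq * M.q - M.dr * M.r * M.qq * M.dq
  rw [h]; noncomm_ring

theorem rqE : M.r * M.q * M.E = M.r * M.q := by
  rw [M.E_eq]
  linear_combination (norm := noncomm_ring)
    M.r * M.dr_q * M.r * M.dq * M.q - M.r * M.dr * M.qr * M.dq * M.q
    + M.r * M.dr_r * M.q * M.dq * M.q - M.rr * M.dr * M.q * M.dq * M.q + M.r * M.q * M.dq_q
    - M.r * M.qq * M.dq

theorem resolution : 1 = M.E + M.r * M.E * M.dr + M.q * M.E * M.dq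
    + M.r * M.q * M.E * (M.dq * M.dr) := by
  rw [M.rEdr, M.qEdq, M.rqE, M.E_eq]
  have h : M.r * M.q * (M.dq * M.dr) = M.r * M.dr * (M.q * M.dq) := by
    linear_combination (norm := noncomm_ring) M.r * M.q * M.dqdr - M.r * M.dr_q * M.dq
  rw [h, M.dr_r, M.dq_q]
  noncomm_ring
end BlockModes

open MulOpposite

namespace SymplecticModes

open Polynomial

variable {ι A : Type*} [DecidableEq ι] [Ring A] [Algebra ℂ A]
  (M : SymplecticModes ι A)

/-- The dual modes in the opposite algebra, with creators and annihilators exchanged. -/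
def dual : SymplecticModes ι Aᵐᵒᵖ where
  u i := op (M.d i)
  d i := op (M.u i)
  E := op M.E
  σ := M.σ
  ε := M.ε
  uu i j := by rw [← op_mul, ← op_mul, M.dd j i, op_neg]
  dd i j := by rw [← op_mul, ← op_mul, M.uu j i, op_neg]
  du i j := by
    rw [← op_mul, ← op_mul, M.du j i, op_sub]
    congr 1
    by_cases h : i = j
    · simp [h]
    · simp [h, Ne.symm h]
  EE := by rw [← op_mul, M.EE]
  Eu i := by rw [← op_mul, ← op_mul, M.Ed]
  Ed i := by rw [← op_mul, ← op_mul, M.Eu]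
  σσ := M.σσ
  εσ := M.εσ
  εε := M.εε

theorem dual_ds (i : ι) : M.dual.ds i = op (M.us i) := rfl
theorem dual_us (i : ι) : M.dual.us i = op (M.ds i) := rfl

theorem dual_X (i j : ι) : M.dual.X i j = -((M.ε i * M.ε j) • op (M.X (M.σ i) (M.σ j))) := by
  have e : M.dual.X i j = op (M.us j * M.d i + M.us i * M.d j) := rfl
  rw [e, ← op_smul, ← op_neg, SymplecticModes.X, us, us, ds, ds, M.σσ, M.σσ, M.εσ, M.εσ]
  congr 1
  simp only [mul_smul_comm, smul_mul_assoc, smul_add, smul_smul, neg_smul, smul_neg, mul_neg]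
  have h1 := M.εε i
  have h2 := M.εε j
  have e1 : M.ε i * M.ε j * M.ε j = M.ε i := by rw [mul_assoc, h2, mul_one]
  have e2 : M.ε i * M.ε j * M.ε i = M.ε j := by rw [mul_right_comm, h1, one_mul]
  rw [e1, e2]
  abel

variable {M}

theorem SpInv.dual {T : A} (h : M.SpInv T) : M.dual.SpInv (op T) := by
  intro i j
  rw [dual_X, neg_mul, mul_neg, smul_mul_assoc, mul_smul_comm, ← op_mul, ← op_mul, h]

theorem VacUnique.dual (h : M.VacUnique) : M.dual.VacUnique := by
  have key : ∀ T, M.dual.IsVac T → M.IsVac (unop T) := fun T hT =>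
    ⟨⟨congrArg unop hT.1.2, congrArg unop hT.1.1⟩, fun i => congrArg unop (hT.2.2 i),
      fun i => congrArg unop (hT.2.1 i)⟩
  intro T T' hT hT' h0
  obtain ⟨c, hc⟩ := h _ _ (key T hT) (key T' hT') fun h' => h0 (unop_injective h')
  exact ⟨c, unop_injective hc⟩

variable (M) [Fintype ι]

theorem dual_num : M.dual.num = op M.num := by
  simp only [num, dual, ← op_mul, Finset.op_sum]

theorem dual_om : M.dual.om = op M.la := by
  simp only [om, la, dual_us, Finset.op_sum, op_mul]
  exact Finset.sum_congr rfl fun i _ => rfl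

theorem dual_la : M.dual.la = op M.om := by
  simp only [om, la, dual_ds, Finset.op_sum, op_mul]
  exact Finset.sum_congr rfl fun i _ => rfl

end SymplecticModes

namespace BlockModes

open Polynomial

variable {ι A : Type*} [DecidableEq ι] [Ring A] [Algebra ℂ A]
  (M : BlockModes ι A)

/-- The dual modes in the opposite algebra, with creators and annihilators exchanged. -/
def dual : BlockModes ι Aᵐᵒᵖ where
  toSymplecticModes := M.toSymplecticModes.dual
  r := op M.dq
  dr := op M.q
  q := op M.dr
  dq := op M.r
  rr := by rw [← op_mul, M.dqdq, op_zero]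
  qq := by rw [← op_mul, M.drdr, op_zero]
  drdr := by rw [← op_mul, M.qq, op_zero]
  dqdq := by rw [← op_mul, M.rr, op_zero]
  qr := by rw [← op_mul, ← op_mul, M.dqdr, op_neg]
  dqdr := by rw [← op_mul, ← op_mul, M.qr, op_neg]
  dr_r := by rw [← op_mul, ← op_mul, M.dq_q, op_sub, op_one]
  dq_q := by rw [← op_mul, ← op_mul, M.dr_r, op_sub, op_one]
  dr_q := by rw [← op_mul, ← op_mul, M.dr_q, op_neg]
  dq_r := by rw [← op_mul, ← op_mul, M.dq_r, op_neg]
  odd_r := ⟨fun i => by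
      show op M.dq * op (M.d i) = -(op (M.d i) * op M.dq)
      rw [← op_mul, ← op_mul, M.odd_dq.d, op_neg, neg_neg], fun i => by
      show op M.dq * op (M.u i) = -(op (M.u i) * op M.dq)
      rw [← op_mul, ← op_mul, M.odd_dq.u, op_neg, neg_neg]⟩
  odd_dr := ⟨fun i => by
      show op M.q * op (M.d i) = -(op (M.d i) * op M.q)
      rw [← op_mul, ← op_mul, M.odd_q.d, op_neg, neg_neg], fun i => by
      show op M.q * op (M.u i) = -(op (M.u i) * op M.q)
      rw [← op_mul, ← op_mul, M.odd_q.u, op_neg, neg_neg]⟩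
  odd_q := ⟨fun i => by
      show op M.dr * op (M.d i) = -(op (M.d i) * op M.dr)
      rw [← op_mul, ← op_mul, M.odd_dr.d, op_neg, neg_neg], fun i => by
      show op M.dr * op (M.u i) = -(op (M.u i) * op M.dr)
      rw [← op_mul, ← op_mul, M.odd_dr.u, op_neg, neg_neg]⟩
  odd_dq := ⟨fun i => by
      show op M.r * op (M.d i) = -(op (M.d i) * op M.r)
      rw [← op_mul, ← op_mul, M.odd_r.d, op_neg, neg_neg], fun i => by
      show op M.r * op (M.u i) = -(op (M.u i) * op M.r)
      rw [← op_mul, ← op_mul, M.odd_r.u, op_neg, neg_neg]⟩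
  E_eq := by
    show op M.E = _
    rw [M.E_eq]
    simp only [← op_mul, mul_assoc]

structure LowL (S : A) : Prop where
  dr : M.dr * S = 0
  dq : M.dq * S = 0
  d : ∀ i, M.d i * S = 0

structure HighL (S : A) : Prop where
  r : M.r * S = 0
  q : M.q * S = 0
  u : ∀ i, M.u i * S = 0

structure LowR (S : A) : Prop where
  r : S * M.r = 0
  q : S * M.q = 0
  u : ∀ i, S * M.u i = 0

structure HighR (S : A) : Prop where
  dr : S * M.dr = 0
  dq : S * M.dq = 0
  d : ∀ i, S * M.d i = 0

/-- The commutation relations defining the commutant. -/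
structure Comm (T : A) : Prop where
  rdq : M.r * M.dq * T = T * (M.r * M.dq)
  udq : ∀ i, M.u i * M.dq * T = T * (M.u i * M.dq)
  rd : ∀ i, M.r * M.d i * T = T * (M.r * M.d i)
  sp : M.SpInv T

variable {M}

theorem Comm.dual {T : A} (h : M.Comm T) : M.dual.Comm (op T) where
  rdq := unop_injective h.rdq.symm
  udq i := unop_injective (h.rd i).symm
  rd i := unop_injective (h.udq i).symm
  sp := h.sp.dual

variable (M) [Fintype ι]

/-- The total number operator. -/
def Nh : A := M.r * M.dr + M.q * M.dq + M.num

theorem dual_Nh : M.dual.Nh = op M.Nh := by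
  have h : M.dual.num = op M.num := M.toSymplecticModes.dual_num
  rw [Nh, Nh, h]
  simp only [dual, ← op_mul, ← op_add]
  congr 1
  abel

/-- The properties of a subalgebra needed to contain the commutant. -/
structure Good (B : Subalgebra ℂ A) : Prop where
  r_om : ∀ k, M.r * M.om ^ k ∈ B
  dq_la : ∀ k, M.dq * M.la ^ k ∈ B
  Nh : M.Nh ∈ B
  ll : ∀ S, M.LowL S → M.LowR S → S ∈ B
  hl : ∀ S, M.HighL S → M.LowR S → S ∈ B
  lh : ∀ S, M.LowL S → M.HighR S → S ∈ B
  hh : ∀ S, M.HighL S → M.HighR S → S ∈ B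

variable {M}

theorem Good.dual {B : Subalgebra ℂ A} (h : M.Good B) : M.dual.Good B.op where
  r_om k := by
    have e : M.dual.om = op M.la := M.toSymplecticModes.dual_om
    rw [Subalgebra.mem_op, e, ← op_pow]
    show M.la ^ k * M.dq ∈ B
    rw [← (M.odd_dq.la.pow_right k).eq]
    exact h.dq_la k
  dq_la k := by
    have e : M.dual.la = op M.om := M.toSymplecticModes.dual_la
    rw [Subalgebra.mem_op, e, ← op_pow]
    show M.om ^ k * M.r ∈ B
    rw [← (M.odd_r.om.pow_right k).eq]
    exact h.r_om k
  Nh := by rw [dual_Nh]; exact h.Nh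
  ll S h1 h2 := h.ll (unop S)
    ⟨congrArg unop h2.q, congrArg unop h2.r, fun i => congrArg unop (h2.u i)⟩
    ⟨congrArg unop h1.dq, congrArg unop h1.dr, fun i => congrArg unop (h1.d i)⟩
  hl S h1 h2 := h.lh (unop S)
    ⟨congrArg unop h2.q, congrArg unop h2.r, fun i => congrArg unop (h2.u i)⟩
    ⟨congrArg unop h1.q, congrArg unop h1.r, fun i => congrArg unop (h1.u i)⟩
  lh S h1 h2 := h.hl (unop S)
    ⟨congrArg unop h2.dq, congrArg unop h2.dr, fun i => congrArg unop (h2.d i)⟩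
    ⟨congrArg unop h1.dq, congrArg unop h1.dr, fun i => congrArg unop (h1.d i)⟩
  hh S h1 h2 := h.hh (unop S)
    ⟨congrArg unop h2.dq, congrArg unop h2.dr, fun i => congrArg unop (h2.d i)⟩
    ⟨congrArg unop h1.q, congrArg unop h1.r, fun i => congrArg unop (h1.u i)⟩

end BlockModes

open MulOpposite

namespace BlockModes

open Polynomial

variable {ι A : Type*} [DecidableEq ι] [Ring A] [Algebra ℂ A]
  (M : BlockModes ι A)

theorem dqqE : M.dq * M.q * M.E = M.E := by
  linear_combination (norm := noncomm_ring) M.dq_q * M.E - M.q * M.dq_E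

theorem Edrr : M.E * M.dr * M.r = M.E := by
  linear_combination (norm := noncomm_ring) M.E * M.dr_r - M.E_r * M.dr

/-- The matrix block of `T` between the left state `a` and the right state `b`. -/
def blk (a b T : A) : A := M.E * a * T * b * M.E

variable {M}

theorem corner_blk (a b T : A) : M.Corner (M.blk a b T) := by
  constructor
  · rw [blk]
    linear_combination (norm := noncomm_ring) M.EE * a * T * b * M.E
  · rw [blk]
    linear_combination (norm := noncomm_ring) M.E * a * T * b * M.EE

theorem spInv_blk {a b T : A} (ha : ∀ i j, a * M.X i j = M.X i j * a)
    (hb : ∀ i j, b * M.X i j = M.X i j * b) (hT : M.SpInv T) : M.SpInv (M.blk a b T) := by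
  intro i j
  have hE : M.E * M.X i j = M.X i j * M.E := by
    rw [SymplecticModes.X]
    linear_combination (norm := noncomm_ring) M.Eu i * M.ds j + M.u i * M.E_ds j
      + M.Eu j * M.ds i + M.u j * M.E_ds i
  rw [blk]
  linear_combination (norm := noncomm_ring) -(hE * a * T * b * M.E) - M.E * ha i j * T * b * M.E
    + M.E * a * hT i j * b * M.E - M.E * a * T * hb i j * M.E - M.E * a * T * b * hE

namespace Comm

variable {T : A}

theorem blk_one_r (h : M.Comm T) : M.blk 1 M.r T = 0 := by
  rw [blk]
  linear_combination (norm := noncomm_ring) -(M.E * T * M.r * M.dqqE) - M.E * h.rdq * M.q * M.E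
    + M.E_r * M.dq * T * M.q * M.E

theorem blk_q_r (h : M.Comm T) : M.blk M.dq M.r T = 0 := by
  rw [blk]
  linear_combination (norm := noncomm_ring) -(M.E * M.dq * T * M.r * M.dqqE)
    - M.E * M.dq * h.rdq * M.q * M.E + M.E * M.dq_r * M.dq * T * M.q * M.E
    - M.E * M.r * M.dqdq * T * M.q * M.E

theorem blk_rq_r (h : M.Comm T) : M.blk (M.dq * M.dr) M.r T = 0 := by
  rw [blk]
  linear_combination (norm := noncomm_ring) -(M.E * M.dq * M.dr * T * M.r * M.dqqE)
    - M.E * M.dq * M.dr * h.rdq * M.q * M.E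
    + M.E * (M.dq * M.dr_r * M.dq + M.dqdq - M.dq_r * M.dr * M.dq) * T * M.q * M.E
    + M.E_r * M.dq * M.dr * M.dq * T * M.q * M.E

theorem blk_r_r (h : M.Comm T) : M.blk M.dr M.r T = M.blk M.dq M.q T := by
  rw [blk, blk]
  linear_combination (norm := noncomm_ring) -(M.E * M.dr * T * M.r * M.dqqE)
    - M.E * M.dr * h.rdq * M.q * M.E + M.Edrr * M.dq * T * M.q * M.E

theorem blk_q_one (h : M.Comm T) : M.blk M.dq 1 T = 0 := by
  rw [blk]
  linear_combination (norm := noncomm_ring) -(M.Edrr * M.dq * T * M.E)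
    + M.E * M.dr * h.rdq * M.E + M.E * M.dr * T * M.r * M.dq_E

theorem blk_q_rq (h : M.Comm T) : M.blk M.dq (M.r * M.q) T = 0 := by
  rw [blk]
  linear_combination (norm := noncomm_ring) -(M.Edrr * M.dq * T * M.r * M.q * M.E)
    + M.E * M.dr * h.rdq * M.r * M.q * M.E + M.E * M.dr * T * M.r * M.dq_r * M.q * M.E
    - M.E * M.dr * T * M.rr * M.dq * M.q * M.E

theorem u_blk_rq_one (h : M.Comm T) (i : ι) : M.u i * M.blk (M.dq * M.dr) 1 T = 0 := by
  rw [blk]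
  linear_combination (norm := noncomm_ring) -(M.Eu i * M.dq * M.dr * T * M.E)
    + M.E * M.u i * M.dqdr * T * M.E - M.E * M.odd_dr.u i * M.dq * T * M.E
    + M.E * M.dr * h.udq i * M.E + M.E * M.dr * T * M.u i * M.dq_E

theorem blk_one_one_u (h : M.Comm T) (i : ι) : M.blk 1 1 T * M.u i = M.u i * M.blk M.dq M.q T := by
  rw [blk, blk]
  linear_combination (norm := noncomm_ring) M.E * T * M.Eu i - M.E * T * M.u i * M.dqqE
    - M.E * h.udq i * M.q * M.E + M.Eu i * M.dq * T * M.q * M.E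

theorem blk_r_one_u (h : M.Comm T) (i : ι) :
    M.blk M.dr 1 T * M.u i = M.u i * M.blk (M.dq * M.dr) M.q T := by
  rw [blk, blk]
  linear_combination (norm := noncomm_ring) M.E * M.dr * T * M.Eu i
    - M.E * M.dr * T * M.u i * M.dqqE - M.E * M.dr * h.udq i * M.q * M.E
    + M.E * M.odd_dr.u i * M.dq * T * M.q * M.E - M.E * M.u i * M.dqdr * T * M.q * M.E
    + M.Eu i * M.dq * M.dr * T * M.q * M.E

theorem blk_rq_one_u (h : M.Comm T) (i : ι) : M.blk (M.dq * M.dr) 1 T * M.u i = 0 := by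
  rw [blk]
  linear_combination (norm := noncomm_ring) M.E * M.dq * M.dr * T * M.Eu i
    - M.E * M.dq * M.dr * T * M.u i * M.dqqE - M.E * M.dq * M.dr * h.udq i * M.q * M.E
    + M.E * M.dqdr * M.u i * M.dq * T * M.q * M.E
    - M.E * M.dr * M.odd_dq.u i * M.dq * T * M.q * M.E
    + M.E * M.dr * M.u i * M.dqdq * T * M.q * M.E

theorem blk_r_r_u (h : M.Comm T) (i : ι) :
    M.blk M.dr M.r T * M.u i = M.u i * M.blk (M.dq * M.dr) (M.r * M.q) T := by
  rw [blk, blk]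
  linear_combination (norm := noncomm_ring) M.E * M.dr * T * M.r * M.Eu i
    + M.E * M.dr * T * M.odd_r.u i * M.E + M.E * M.dr * T * M.u i * M.r * M.dqqE
    - M.E * M.dr * T * M.u i * M.dq_r * M.q * M.E - M.E * M.dr * h.udq i * M.r * M.q * M.E
    + M.E * M.odd_dr.u i * M.dq * T * M.r * M.q * M.E
    - M.E * M.u i * M.dqdr * T * M.r * M.q * M.E
    + M.Eu i * M.dq * M.dr * T * M.r * M.q * M.E

theorem d_blk_one_one (h : M.Comm T) (i : ι) : M.blk M.dq M.q T * M.d i = M.d i * M.blk 1 1 T := by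
  have e : M.d i * (M.E * (1 * (T * (1 * M.E)))) = M.E * (M.dr * (T * (M.r * M.E))) * M.d i :=
    congrArg unop (h.dual.blk_one_one_u i)
  rw [← h.blk_r_r]
  simp only [blk]
  linear_combination (norm := noncomm_ring) -e

theorem d_blk_r_r (h : M.Comm T) (i : ι) :
    M.blk (M.dq * M.dr) (M.r * M.q) T * M.d i = M.d i * M.blk M.dr M.r T := by
  have e : M.d i * (M.E * (M.dq * (T * (M.q * M.E))))
      = M.E * ((M.dr * M.dq) * (T * ((M.q * M.r) * M.E))) * M.d i :=
    congrArg unop (h.dual.blk_r_r_u i)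
  rw [h.blk_r_r]
  simp only [blk]
  linear_combination (norm := noncomm_ring) -e + M.E * M.dqdr * T * M.r * M.q * M.E * M.d i
    - M.E * M.dr * M.dq * T * M.qr * M.E * M.d i

end Comm

/-- The block decomposition of an operator in the commutant. -/
theorem Comm.eq_sum {T : A} (h : M.Comm T) : T =
    (M.blk 1 1 T + M.r * M.blk M.dr M.r T * M.dr + M.q * M.blk M.dq M.q T * M.dq
      + M.r * M.q * M.blk (M.dq * M.dr) (M.r * M.q) T * (M.dq * M.dr))
    + (M.r * M.blk M.dr 1 T + M.r * M.q * M.blk (M.dq * M.dr) M.q T * M.dq)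
    + (M.blk 1 M.q T * M.dq + M.r * M.blk M.dr (M.r * M.q) T * (M.dq * M.dr))
    + M.r * M.q * M.blk (M.dq * M.dr) 1 T + M.blk 1 (M.r * M.q) T * (M.dq * M.dr)
    + M.r * M.blk M.dr M.q T * M.dq := by
  have e := M.resolution
  have h1 := h.blk_one_r
  have h2 := h.blk_q_r
  have h3 := h.blk_rq_r
  have h4 := h.blk_q_one
  have h5 := h.blk_q_rq
  simp only [blk] at *
  linear_combination (norm := noncomm_ring) e * T + (M.E + M.r * M.E * M.dr + M.q * M.E * M.dq
    + M.r * M.q * M.E * (M.dq * M.dr)) * T * e + h1 * M.dr + M.q * h2 * M.dr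
    + M.r * M.q * h3 * M.dr + M.q * h4 + M.q * h5 * (M.dq * M.dr)

theorem rE : M.r * M.E = M.r - M.r * M.q * M.dq := by
  rw [M.E_eq]
  linear_combination (norm := noncomm_ring) M.r * M.dr_r * M.dq * M.q
    - M.rr * M.dr * M.dq * M.q + M.r * M.dq_q

theorem rEdq : M.r * M.E * M.dq = M.r * M.dq := by
  rw [rE]
  linear_combination (norm := noncomm_ring) -(M.r * M.q * M.dqdq)

end BlockModes

open MulOpposite

namespace BlockModes

open Polynomial

variable {ι A : Type*} [DecidableEq ι] [Ring A] [Algebra ℂ A] [Fintype ι]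
  (M : BlockModes ι A)

theorem E_Nh : M.E * M.Nh = M.num * M.E := by
  rw [Nh]
  linear_combination (norm := noncomm_ring) M.E_r * M.dr + M.E_q * M.dq + M.E_num

theorem Nh_E : M.Nh * M.E = M.E * M.num := by
  rw [Nh]
  linear_combination (norm := noncomm_ring) M.r * M.dr_E + M.q * M.dq_E - M.E_num

theorem Nh_r : M.Nh * M.r = M.r * M.Nh + M.r := by
  rw [Nh]
  linear_combination (norm := noncomm_ring) M.r * M.dr_r + M.q * M.dq_r - M.qr * M.dq
    - M.odd_r.num.eq - M.rr * M.dr - M.rr * M.dr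

theorem Nh_q : M.Nh * M.q = M.q * M.Nh + M.q := by
  rw [Nh]
  linear_combination (norm := noncomm_ring) M.r * M.dr_q + M.q * M.dq_q - M.qr * M.dr
    - M.odd_q.num.eq - M.qq * M.dq - M.qq * M.dq

theorem dr_Nh : M.dr * M.Nh = M.Nh * M.dr + M.dr := by
  rw [Nh]
  linear_combination (norm := noncomm_ring) M.dr_r * M.dr + M.dr_q * M.dq - M.q * M.dqdr
    + M.odd_dr.num.eq - M.r * M.drdr - M.r * M.drdr

theorem dq_Nh : M.dq * M.Nh = M.Nh * M.dq + M.dq := by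
  rw [Nh]
  linear_combination (norm := noncomm_ring) M.dq_r * M.dr + M.dq_q * M.dq - M.r * M.dqdr
    + M.odd_dq.num.eq - M.q * M.dqdq - M.q * M.dqdq

variable {M}

theorem hasDeg_blk {a b T : A} {k l m' m : ℤ} (ha : a * M.Nh = M.Nh * a + (k : ℂ) • a)
    (hb : M.Nh * b = b * M.Nh + (l : ℂ) • b) (h1 : M.Nh * T = (m' : ℂ) • T)
    (h2 : T * M.Nh = (m : ℂ) • T) : M.HasDeg (M.blk a b T) (m' - k) (m - l) := by
  constructor
  · have e : M.num * M.blk a b T = M.E * (a * (M.Nh * T) - (k : ℂ) • a * T) * b * M.E := by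
      rw [blk]
      linear_combination (norm := noncomm_ring) -(M.E_Nh * a * T * b * M.E)
        - M.E * ha * T * b * M.E
    rw [e, h1, blk]
    simp only [mul_smul_comm, smul_mul_assoc, ← mul_assoc, ← sub_smul]
    push_cast
    rfl
  · have e : M.blk a b T * M.num = M.E * a * ((T * M.Nh) * b - T * (l : ℂ) • b) * M.E := by
      rw [blk]
      linear_combination (norm := noncomm_ring) -(M.E * a * T * b * M.Nh_E)
        - M.E * a * T * hb * M.E
    rw [e, h2, blk]
    simp only [mul_smul_comm, smul_mul_assoc, ← mul_assoc, ← sub_smul]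
    push_cast
    rfl

theorem aeval_mem_of_mem {B : Subalgebra ℂ A} {x : A} (hx : x ∈ B) (p : ℂ[X]) :
    aeval x p ∈ B :=
  Algebra.adjoin_le (Set.singleton_subset_iff.2 hx) (aeval_mem_adjoin_singleton ℂ x)

theorem Good.aeval_Nh_sub_one {B : Subalgebra ℂ A} (hB : M.Good B) (p : ℂ[X]) :
    aeval (M.Nh - 1) p ∈ B :=
  aeval_mem_of_mem (B.sub_mem hB.Nh B.one_mem) p

theorem aeval_sub_one_mul_rE (p : ℂ[X]) :
    aeval (M.num - 1) p * (M.r * M.E) = M.r * M.E * aeval (M.Nh - 1) p := by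
  refine aeval_mul_of_semiconj ?_ p
  linear_combination (norm := noncomm_ring) -(M.odd_r.num.eq * M.E) - M.r * M.E_Nh

theorem aeval_mul_rqdq (p : ℂ[X]) :
    aeval M.num p * (M.r * M.q * M.dq) = M.r * M.q * M.dq * aeval (M.Nh - 1) p := by
  refine aeval_mul_of_semiconj ?_ p
  have e1 := M.odd_r.num.eq
  have e2 := M.odd_q.num.eq
  have e3 := M.odd_dq.num.eq
  rw [Nh]
  linear_combination (norm := noncomm_ring) -(e1 * M.q * M.dq) - M.r * e2 * M.dq
    - M.r * M.q * e3 - M.r * M.q * M.dq_r * M.dr + M.r * M.qr * M.dq * M.dr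
    - M.rr * M.q * M.dq * M.dr - M.r * M.q * M.dq_q * M.dq + M.r * M.qq * M.dq * M.dq

theorem aeval_mul_rdq (p : ℂ[X]) :
    aeval M.num p * (M.r * M.dq) = M.r * M.dq * aeval (M.Nh - 1) p := by
  refine aeval_mul_of_semiconj ?_ p
  have e1 := M.odd_r.num.eq
  have e3 := M.odd_dq.num.eq
  rw [Nh]
  linear_combination (norm := noncomm_ring) -(e1 * M.dq)
    - M.r * e3 - M.r * M.dq_r * M.dr + M.rr * M.dq * M.dr - M.r * M.dq_q * M.dq
    + M.r * M.q * M.dqdq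

variable {B : Subalgebra ℂ A} {T : A} {m' m : ℤ}

theorem exists_partner (hB : M.Good B) {C : A} (hC : C ∈ M.omSpan) :
    ∃ D ∈ M.howeSpan, (∀ i, D * M.u i = M.u i * C) ∧ M.r * D + M.r * M.q * C * M.dq ∈ B := by
  induction hC using Submodule.span_induction with
  | zero => exact ⟨0, Submodule.zero_mem _, by simp, by simp⟩
  | add C C' _ _ h h' =>
    obtain ⟨D, h1, h2, h3⟩ := h
    obtain ⟨D', h1', h2', h3'⟩ := h'
    refine ⟨D + D', Submodule.add_mem _ h1 h1', fun i => by rw [add_mul, h2, h2', mul_add], ?_⟩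
    convert B.add_mem h3 h3' using 1
    noncomm_ring
  | smul c C _ h =>
    obtain ⟨D, h1, h2, h3⟩ := h
    refine ⟨c • D, Submodule.smul_mem _ _ h1, fun i => by
      rw [smul_mul_assoc, h2, mul_smul_comm], ?_⟩
    convert B.smul_mem h3 c using 1
    simp only [smul_add, mul_smul_comm, smul_mul_assoc]
  | mem C hC =>
    obtain ⟨k, p, rfl⟩ := hC
    refine ⟨M.om ^ k * aeval M.num (p.comp (Polynomial.X - 1)) * M.E, ?_, fun i => ?_, ?_⟩
    · simpa using M.mem_howeSpan k 0 (p.comp (Polynomial.X - 1))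
    · have h1 : aeval (M.num - 1) p * M.u i = M.u i * aeval M.num p := by
        refine aeval_mul_of_semiconj ?_ p
        linear_combination (norm := noncomm_ring) M.num_u i
      have h2 : M.om ^ k * M.u i = M.u i * M.om ^ k :=
        ((show Commute M.om (M.u i) from M.om_u i).pow_left k).eq
      rw [SymplecticModes.aeval_comp_sub_one]
      linear_combination (norm := noncomm_ring) M.om ^ k * aeval (M.num - 1) p * M.Eu i
        + M.om ^ k * h1 * M.E + h2 * aeval M.num p * M.E
    · rw [SymplecticModes.aeval_comp_sub_one]
      have h0 := (M.odd_r.om.pow_right k).eq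
      have h0' := (M.odd_q.om.pow_right k).eq
      have h1 := M.odd_r.aeval p
      have h1' := M.odd_q.aeval p
      have h2 : M.r * aeval (M.num - 1) p = aeval (M.num - 1) p * M.r := by
        rw [← SymplecticModes.aeval_comp_sub_one]; exact M.odd_r.aeval _
      have e : M.r * (M.om ^ k * aeval (M.num - 1) p * M.E)
          + M.r * M.q * (M.om ^ k * aeval M.num p * M.E) * M.dq
          = M.r * M.om ^ k * aeval (M.Nh - 1) p := by
        linear_combination (norm := noncomm_ring) h0 * aeval (M.num - 1) p * M.E
          + M.om ^ k * h2 * M.E + M.om ^ k * M.aeval_sub_one_mul_rE p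
          + M.om ^ k * M.aeval_mul_rqdq p
          + M.r * h0' * aeval M.num p * M.E * M.dq + h0 * M.q * aeval M.num p * M.E * M.dq
          + M.om ^ k * M.r * h1' * M.E * M.dq + M.om ^ k * h1 * M.q * M.E * M.dq
          + M.om ^ k * aeval M.num p * M.rqE * M.dq
          + M.om ^ k * M.rE * aeval (M.Nh - 1) p - h0 * aeval (M.Nh - 1) p
      rw [e]
      exact B.mul_mem (hB.r_om k) (hB.aeval_Nh_sub_one p)

theorem Good.vac_mem (hB : M.Good B) : aeval M.num M.vacPoly * M.E ∈ B := by
  have h := M.isVac_vac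
  refine hB.ll _ ⟨?_, ?_, h.2.1⟩ ⟨?_, ?_, h.2.2⟩
  · rw [← mul_assoc, M.odd_dr.aeval, mul_assoc, M.dr_E, mul_zero]
  · rw [← mul_assoc, M.odd_dq.aeval, mul_assoc, M.dq_E, mul_zero]
  · rw [mul_assoc, M.E_r, mul_zero]
  · rw [mul_assoc, M.E_q, mul_zero]

theorem Good.r_mul_mem (hB : M.Good B) {D : A} (hD : D ∈ M.omVacSpan) : M.r * D ∈ B := by
  induction hD using Submodule.span_induction with
  | zero => simp
  | add C C' _ _ h h' => rw [mul_add]; exact B.add_mem h h'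
  | smul c C _ h => rw [mul_smul_comm]; exact B.smul_mem h c
  | mem C hC =>
    obtain ⟨k, rfl⟩ := hC
    rw [mul_assoc, ← mul_assoc M.r]
    exact B.mul_mem (hB.r_om k) hB.vac_mem

theorem Good.raising_mem (hv : M.VacUnique) (hB : M.Good B) (hT : M.Comm T)
    (h1 : M.Nh * T = (m' : ℂ) • T) (h2 : T * M.Nh = (m : ℂ) • T) :
    M.r * M.blk M.dr 1 T + M.r * M.q * M.blk (M.dq * M.dr) M.q T * M.dq ∈ B := by
  have hC : M.blk (M.dq * M.dr) M.q T ∈ M.omSpan := by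
    refine SymplecticModes.SpInv.mem_omSpan hv (m' := m' - 2) (m := m - 1)
      (spInv_blk (fun i j => ?_) (M.odd_q.X) hT.sp) (corner_blk _ _ _)
      (hasDeg_blk ?_ ?_ h1 h2) fun i j => ?_
    · linear_combination (norm := noncomm_ring) M.dq * M.odd_dr.X i j + M.odd_dq.X i j * M.dr
    · have e : ((2 : ℤ) : ℂ) • (M.dq * M.dr) = M.dq * M.dr + M.dq * M.dr := by
        rw [← two_smul ℂ]; norm_num
      rw [e]
      linear_combination (norm := noncomm_ring) M.dq * M.dr_Nh + M.dq_Nh * M.dr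
    · simpa using M.Nh_q
    · rw [← hT.blk_r_one_u, ← hT.blk_r_one_u]
      linear_combination (norm := noncomm_ring) M.blk M.dr 1 T * M.uu i j
  have hD : M.blk M.dr 1 T ∈ M.howeSpan := by
    refine SymplecticModes.SpInv.mem_howeSpan hv (m' := m' - 1) (m := m - 0)
      (spInv_blk M.odd_dr.X (by simp) hT.sp) (corner_blk _ _ _)
      (hasDeg_blk ?_ ?_ h1 h2)
    · simpa using M.dr_Nh
    · simp
  obtain ⟨D, hD1, hD2, hD3⟩ := exists_partner hB hC
  have h3 : M.blk M.dr 1 T - D ∈ M.omVacSpan := by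
    refine SymplecticModes.mem_omVacSpan (Submodule.sub_mem _ hD hD1)
      (SymplecticModes.mul_num_eq_zero _ fun i => ?_)
    rw [sub_mul, hT.blk_r_one_u, hD2, sub_self]
  convert B.add_mem (hB.r_mul_mem h3) hD3 using 1
  noncomm_ring

theorem dual_degree (h1 : M.Nh * T = (m' : ℂ) • T) (h2 : T * M.Nh = (m : ℂ) • T) :
    M.dual.Nh * op T = (m : ℂ) • op T ∧ op T * M.dual.Nh = (m' : ℂ) • op T := by
  rw [dual_Nh, ← op_mul, ← op_mul, h1, h2, op_smul, op_smul]
  exact ⟨rfl, rfl⟩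

theorem Good.lowering_mem (hv : M.VacUnique) (hB : M.Good B) (hT : M.Comm T)
    (h1 : M.Nh * T = (m' : ℂ) • T) (h2 : T * M.Nh = (m : ℂ) • T) :
    M.blk 1 M.q T * M.dq + M.r * M.blk M.dr (M.r * M.q) T * (M.dq * M.dr) ∈ B := by
  have e : (M.E * (1 * (T * (M.q * M.E)))) * M.dq
      + M.r * ((M.E * (M.dr * (T * ((M.q * M.r) * M.E)))) * (M.dr * M.dq)) ∈ B :=
    Good.raising_mem hv.dual hB.dual hT.dual (dual_degree h1 h2).1 (dual_degree h1 h2).2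
  convert e using 1
  rw [blk, blk]
  linear_combination (norm := noncomm_ring)
    M.r * M.E * M.dr * T * M.r * M.q * M.E * M.dqdr
    - M.r * M.E * M.dr * T * M.qr * M.E * M.dr * M.dq

theorem Good.top_raising_mem (hB : M.Good B) (hT : M.Comm T) :
    M.r * M.q * M.blk (M.dq * M.dr) 1 T ∈ B := by
  have e2 := hT.u_blk_rq_one
  have e1 := hT.blk_rq_one_u
  have hc : M.blk (M.dq * M.dr) 1 T * M.E = M.blk (M.dq * M.dr) 1 T := (corner_blk _ _ _).2
  refine hB.hl _ ⟨?_, ?_, fun i => ?_⟩ ⟨?_, ?_, fun i => ?_⟩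
  · linear_combination (norm := noncomm_ring) M.rr * M.q * M.blk (M.dq * M.dr) 1 T
  · linear_combination (norm := noncomm_ring) M.qr * M.q * M.blk (M.dq * M.dr) 1 T
      - M.r * M.qq * M.blk (M.dq * M.dr) 1 T
  · linear_combination (norm := noncomm_ring) M.r * M.q * e2 i
      - M.r * M.odd_q.u i * M.blk (M.dq * M.dr) 1 T + M.odd_r.u i * M.q * M.blk (M.dq * M.dr) 1 T
  · rw [← hc]
    linear_combination (norm := noncomm_ring) M.r * M.q * M.blk (M.dq * M.dr) 1 T * M.E_r
  · rw [← hc]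
    linear_combination (norm := noncomm_ring) M.r * M.q * M.blk (M.dq * M.dr) 1 T * M.E_q
  · rw [mul_assoc, e1, mul_zero]

theorem Good.top_lowering_mem (hB : M.Good B) (hT : M.Comm T) :
    M.blk 1 (M.r * M.q) T * (M.dq * M.dr) ∈ B := by
  have e : (M.E * (1 * (T * ((M.q * M.r) * M.E)))) * (M.dr * M.dq) ∈ B :=
    Good.top_raising_mem hB.dual hT.dual
  convert e using 1
  rw [blk]
  linear_combination (norm := noncomm_ring)
    M.E * T * M.r * M.q * M.E * M.dqdr - M.E * T * M.qr * M.E * M.dr * M.dq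

theorem Good.r_mul_dq_mem (hB : M.Good B) {D : A} (hD : D ∈ M.howeSpan) :
    M.r * D * M.dq ∈ B := by
  induction hD using Submodule.span_induction with
  | zero => simp
  | add C C' _ _ h h' => rw [mul_add, add_mul]; exact B.add_mem h h'
  | smul c C _ h => rw [mul_smul_comm, smul_mul_assoc]; exact B.smul_mem h c
  | mem C hC =>
    obtain ⟨k, l, p, rfl⟩ := hC
    have h0 := (M.odd_r.om.pow_right k).eq
    have h1 := (M.odd_r.la.pow_right l).eq
    have h2 := M.odd_r.aeval p
    have h3 := (M.odd_dq.la.pow_right l).eq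
    have e : M.r * (M.om ^ k * M.la ^ l * aeval M.num p * M.E) * M.dq
        = M.r * M.om ^ k * (M.dq * M.la ^ l) * aeval (M.Nh - 1) p := by
      linear_combination (norm := noncomm_ring)
        M.om ^ k * M.la ^ l * M.aeval_mul_rdq p
        + M.om ^ k * M.la ^ l * aeval M.num p * M.rEdq
        + M.om ^ k * M.la ^ l * h2 * M.E * M.dq
        + M.om ^ k * h1 * aeval M.num p * M.E * M.dq
        + h0 * M.la ^ l * aeval M.num p * M.E * M.dq
        - h0 * M.dq * M.la ^ l * aeval (M.Nh - 1) p
        - M.om ^ k * M.r * h3 * aeval (M.Nh - 1) p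
        - M.om ^ k * h1 * M.dq * aeval (M.Nh - 1) p
    rw [e]
    exact B.mul_mem (B.mul_mem (hB.r_om k) (hB.dq_la l)) (hB.aeval_Nh_sub_one p)

theorem Good.odd_pair_mem (hv : M.VacUnique) (hB : M.Good B) (hT : M.Comm T)
    (h1 : M.Nh * T = (m' : ℂ) • T) (h2 : T * M.Nh = (m : ℂ) • T) :
    M.r * M.blk M.dr M.q T * M.dq ∈ B := by
  refine hB.r_mul_dq_mem (SymplecticModes.SpInv.mem_howeSpan hv (m' := m' - 1) (m := m - 1)
    (spInv_blk M.odd_dr.X M.odd_q.X hT.sp) (corner_blk _ _ _) (hasDeg_blk ?_ ?_ h1 h2))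
  · simpa using M.dr_Nh
  · simpa using M.Nh_q

theorem Good.diagonal_mem (hv : M.VacUnique) (hB : M.Good B) (hT : M.Comm T)
    (h1 : M.Nh * T = (m' : ℂ) • T) (h2 : T * M.Nh = (m : ℂ) • T) :
    M.blk 1 1 T + M.r * M.blk M.dr M.r T * M.dr + M.q * M.blk M.dq M.q T * M.dq
      + M.r * M.q * M.blk (M.dq * M.dr) (M.r * M.q) T * (M.dq * M.dr) ∈ B := by
  obtain ⟨g, hg⟩ : ∃ g : ℂ[X], M.blk M.dr M.r T = aeval M.num g * M.E := by
    refine SymplecticModes.exists_aeval_of_gl_inv hv (m' := m' - 1) (m := m - 1) (fun i j => ?_)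
      (corner_blk _ _ _) (hasDeg_blk ?_ ?_ h1 h2)
    · linear_combination (norm := noncomm_ring) -(M.u i * hT.d_blk_r_r j) - hT.blk_r_r_u i * M.d j
    · simpa using M.dr_Nh
    · simpa using M.Nh_r
  have hg' : M.blk M.dq M.q T = aeval M.num g * M.E := by rw [← hT.blk_r_r, hg]
  have gu : ∀ i, aeval (M.num - 1) g * M.u i = M.u i * aeval M.num g := fun i =>
    aeval_mul_of_semiconj (by linear_combination (norm := noncomm_ring) M.num_u i) g
  have gd : ∀ i, aeval M.num g * M.d i = M.d i * aeval (M.num - 1) g := fun i =>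
    aeval_mul_of_semiconj (by linear_combination (norm := noncomm_ring) -M.d_num i) g
  have gu' : ∀ i, aeval M.num g * M.u i = M.u i * aeval (M.num + 1) g := fun i =>
    aeval_mul_of_semiconj (by linear_combination (norm := noncomm_ring) M.num_u i) g
  have gd' : ∀ i, aeval (M.num + 1) g * M.d i = M.d i * aeval M.num g := fun i =>
    aeval_mul_of_semiconj (by linear_combination (norm := noncomm_ring) -M.d_num i) g
  have Em : M.E * aeval (M.num - 1) g = aeval (M.num - 1) g * M.E := by
    rw [← SymplecticModes.aeval_comp_sub_one]; exact M.E_comm_aeval _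
  have Ep : aeval (M.num + 1) g * M.E = M.E * aeval (M.num + 1) g :=
    aeval_mul_of_semiconj (by linear_combination (norm := noncomm_ring) -M.E_num) g
  set S := M.blk 1 1 T - aeval (M.num - 1) g * M.E with hS
  have S1 : M.E * S = S := by
    rw [hS, mul_sub, (corner_blk 1 1 T).1, ← mul_assoc, Em, mul_assoc, M.EE]
  have S2 : S * M.E = S := by
    rw [hS, sub_mul, (corner_blk 1 1 T).2, mul_assoc, M.EE]
  have hSB : S ∈ B := by
    refine hB.ll _ ⟨?_, ?_, fun i => ?_⟩ ⟨?_, ?_, fun i => ?_⟩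
    · rw [← S1, ← mul_assoc, M.dr_E, zero_mul]
    · rw [← S1, ← mul_assoc, M.dq_E, zero_mul]
    · rw [hS]
      linear_combination (norm := noncomm_ring) -hT.d_blk_one_one i + hg' * M.d i
        + aeval M.num g * M.Ed i + gd i * M.E
    · rw [← S2, mul_assoc, M.E_r, mul_zero]
    · rw [← S2, mul_assoc, M.E_q, mul_zero]
    · rw [hS]
      linear_combination (norm := noncomm_ring) hT.blk_one_one_u i + M.u i * hg'
        - aeval (M.num - 1) g * M.Eu i - gu i * M.E
  set X := M.blk (M.dq * M.dr) (M.r * M.q) T - aeval (M.num + 1) g * M.E with hX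
  have Xu : ∀ i, M.u i * X = 0 := fun i => by
    rw [hX]
    linear_combination (norm := noncomm_ring) -hT.blk_r_r_u i + hg * M.u i
        + aeval M.num g * M.Eu i + gu' i * M.E
  have Xd : ∀ i, X * M.d i = 0 := fun i => by
    rw [hX]
    linear_combination (norm := noncomm_ring) hT.d_blk_r_r i + M.d i * hg
        - aeval (M.num + 1) g * M.Ed i - gd' i * M.E
  have hXB : M.r * M.q * X * (M.dq * M.dr) ∈ B := by
    refine hB.hh _ ⟨?_, ?_, fun i => ?_⟩ ⟨?_, ?_, fun i => ?_⟩
    · linear_combination (norm := noncomm_ring) M.rr * M.q * X * M.dq * M.dr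
    · linear_combination (norm := noncomm_ring) M.qr * M.q * X * M.dq * M.dr
        - M.r * M.qq * X * M.dq * M.dr
    · linear_combination (norm := noncomm_ring) M.r * M.q * Xu i * M.dq * M.dr
        - M.r * M.odd_q.u i * X * M.dq * M.dr + M.odd_r.u i * M.q * X * M.dq * M.dr
    · linear_combination (norm := noncomm_ring) M.r * M.q * X * M.dq * M.drdr
    · linear_combination (norm := noncomm_ring) M.r * M.q * X * M.dqdr * M.dq
        - M.r * M.q * X * M.dr * M.dqdq
    · linear_combination (norm := noncomm_ring) M.r * M.q * Xd i * M.dq * M.dr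
        + M.r * M.q * X * M.dq * M.odd_dr.d i - M.r * M.q * X * M.odd_dq.d i * M.dr
  have nE : aeval (M.Nh - 1) g * M.E = M.E * aeval (M.num - 1) g :=
    aeval_mul_of_semiconj (by linear_combination (norm := noncomm_ring) M.Nh_E) g
  have nE' : aeval (M.Nh + 1) g * M.E = M.E * aeval (M.num + 1) g :=
    aeval_mul_of_semiconj (by linear_combination (norm := noncomm_ring) M.Nh_E) g
  have nE0 : aeval M.Nh g * M.E = M.E * aeval M.num g := aeval_mul_of_semiconj M.Nh_E g
  have nr : aeval (M.Nh - 1) g * M.r = M.r * aeval M.Nh g :=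
    aeval_mul_of_semiconj (by linear_combination (norm := noncomm_ring) M.Nh_r) g
  have nq : aeval (M.Nh - 1) g * M.q = M.q * aeval M.Nh g :=
    aeval_mul_of_semiconj (by linear_combination (norm := noncomm_ring) M.Nh_q) g
  have nq' : aeval M.Nh g * M.q = M.q * aeval (M.Nh + 1) g :=
    aeval_mul_of_semiconj (by linear_combination (norm := noncomm_ring) M.Nh_q) g
  have E0 := M.E_comm_aeval g
  convert B.add_mem (B.add_mem (hB.aeval_Nh_sub_one g) hSB) hXB using 1
  rw [hS, hX, hg, hg']
  linear_combination (norm := noncomm_ring) -(aeval (M.Nh - 1) g * M.resolution)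
    - nE - Em - nr * M.E * M.dr - M.r * (nE0 + E0) * M.dr - nq * M.E * M.dq
    - M.q * (nE0 + E0) * M.dq - nr * M.q * M.E * (M.dq * M.dr)
    - M.r * nq' * M.E * (M.dq * M.dr) - M.r * M.q * (nE' - Ep) * (M.dq * M.dr)

/-- An operator in the commutant that is homogeneous on both sides lies in every good
subalgebra. -/
theorem Good.mem_of_comm (hv : M.VacUnique) (hB : M.Good B) (hT : M.Comm T)
    (h1 : M.Nh * T = (m' : ℂ) • T) (h2 : T * M.Nh = (m : ℂ) • T) : T ∈ B := by
  rw [hT.eq_sum]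
  exact B.add_mem (B.add_mem (B.add_mem (B.add_mem (B.add_mem (hB.diagonal_mem hv hT h1 h2)
    (hB.raising_mem hv hT h1 h2)) (hB.lowering_mem hv hT h1 h2)) (hB.top_raising_mem hT))
    (hB.top_lowering_mem hT)) (hB.odd_pair_mem hv hT h1 h2)

end BlockModes

section ElementarySums

variable {I A : Type*} [LinearOrder I] [Ring A]

/-- The ordered elementary symmetric sum of degree `m` in the family `g` over `s`. -/
def esum (g : I → A) (s : Finset I) (m : ℕ) : A :=
  ∑ t ∈ s.powersetCard m, ((t.sort (· ≤ ·)).map g).prod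

variable (g : I → A)

theorem esum_zero (s : Finset I) : esum g s 0 = 1 := by simp [esum]

theorem esum_empty (m : ℕ) : esum g ∅ (m + 1) = 0 := by
  rw [esum, Finset.powersetCard_eq_empty.2 (by simp), Finset.sum_empty]

theorem esum_eq_zero {s : Finset I} {m : ℕ} (h : s.card < m) : esum g s m = 0 := by
  rw [esum, Finset.powersetCard_eq_empty.2 h, Finset.sum_empty]

theorem esum_card (s : Finset I) : esum g s s.card = ((s.sort (· ≤ ·)).map g).prod := by
  rw [esum, Finset.powersetCard_self, Finset.sum_singleton]

theorem esum_insert {a : I} {s : Finset I} (h : ∀ x ∈ s, a < x) (m : ℕ) :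
    esum g (insert a s) (m + 1) = esum g s (m + 1) + g a * esum g s m := by
  have ha : a ∉ s := fun h' => (h a h').false
  have hd : Disjoint (s.powersetCard (m + 1)) ((s.powersetCard m).image (insert a)) := by
    rw [Finset.disjoint_left]
    intro t h1 h2
    obtain ⟨t', -, rfl⟩ := Finset.mem_image.1 h2
    exact ha ((Finset.mem_powersetCard.1 h1).1 (Finset.mem_insert_self a t'))
  have hi : Set.InjOn (insert a) (s.powersetCard m : Set (Finset I)) := by
    intro t h1 t' h2 h3
    have h1' : a ∉ t := fun h' => ha ((Finset.mem_powersetCard.1 h1).1 h')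
    have h2' : a ∉ t' := fun h' => ha ((Finset.mem_powersetCard.1 h2).1 h')
    rw [← Finset.erase_insert h1', h3, Finset.erase_insert h2']
  rw [esum, Finset.powersetCard_succ_insert ha, Finset.sum_union hd, Finset.sum_image hi]
  congr 1
  rw [esum, Finset.mul_sum]
  refine Finset.sum_congr rfl fun t ht => ?_
  have hts := (Finset.mem_powersetCard.1 ht).1
  rw [Finset.sort_insert _ (fun b hb => (h b (hts hb)).le) (fun h' => ha (hts h')),
    List.map_cons, List.prod_cons]

theorem esum_map {J : Type*} [LinearOrder J] (φ : I ↪o J) (g : J → A) (s : Finset I) (m : ℕ) :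
    esum g (s.map φ.toEmbedding) m = esum (g ∘ φ) s m := by
  induction s using Finset.induction_on_min generalizing m with
  | empty =>
    cases m with
    | zero => rw [esum_zero, esum_zero]
    | succ m => rw [Finset.map_empty, esum_empty, esum_empty]
  | insert a s h ih =>
    cases m with
    | zero => rw [esum_zero, esum_zero]
    | succ m =>
      rw [Finset.map_insert, esum_insert _ (by simpa using h), esum_insert _ h, ih, ih]
      rfl

theorem esum_one (s : Finset I) : esum g s 1 = ∑ i ∈ s, g i := by
  induction s using Finset.induction_on_min with
  | empty => rw [esum_empty, Finset.sum_empty]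
  | insert a s h ih =>
    rw [esum_insert _ h, esum_zero, ih, Finset.sum_insert fun h' => (h a h').false, mul_one,
      add_comm]

theorem esum_two_insert_max {a : I} {s : Finset I} (h : ∀ x ∈ s, x < a) :
    esum g (insert a s) 2 = esum g s 2 + (∑ i ∈ s, g i) * g a := by
  induction s using Finset.induction_on_min with
  | empty => rw [esum_insert _ (by simp), esum_empty]; simp [esum_empty]
  | insert b s hb ih =>
    have hab : b < a := h b (Finset.mem_insert_self b s)
    have h1 : b ∉ s := fun h' => (hb b h').false
    have h2 : a ∉ s := fun h' => (h a (Finset.mem_insert_of_mem h')).false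
    rw [Finset.insert_comm, esum_insert _ (by simpa [hab] using hb), esum_insert _ hb,
      ih fun x hx => h x (Finset.mem_insert_of_mem hx), esum_one, esum_one,
      Finset.sum_insert h1, Finset.sum_insert h2]
    noncomm_ring

variable {g}

theorem esum_anticomm {x : A} {s : Finset I} (hx : ∀ i, x * g i = -(g i * x)) (m : ℕ) :
    x * esum g s m = (-1) ^ m * (esum g s m * x) := by
  induction s using Finset.induction_on_min generalizing m with
  | empty =>
    cases m with
    | zero => simp [esum_zero]
    | succ m => simp [esum_empty]
  | insert a s h ih =>
    cases m with
    | zero => simp [esum_zero]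
    | succ m =>
      rw [esum_insert _ h, mul_add, ih, ← mul_assoc x, hx, neg_mul, mul_assoc (g a), ih m, pow_succ,
        ← mul_assoc (g a), ← ((Commute.neg_one_left (g a)).pow_left m).eq]
      noncomm_ring

variable [Algebra ℂ A]

theorem esum_recursions (hg : ∀ i j, g i * g j = -(g j * g i)) (s : Finset I) (k : ℕ) :
    esum g s 1 * esum g s (2 * k) = esum g s (2 * k + 1) ∧
      esum g s 2 * esum g s (2 * k) = (k + 1 : A) * esum g s (2 * k + 2) := by
  induction s using Finset.induction_on_min generalizing k with
  | empty => simp [esum_empty g 0, esum_empty g 1, esum_empty g (2 * k), esum_empty g (2 * k + 1)]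
  | insert a s h ih =>
    cases k with
    | zero => simp [esum_zero]
    | succ k =>
      have gg : g a * g a = 0 := eq_zero_of_eq_neg (hg a a)
      have h11 : esum g s 1 * esum g s 1 = 0 := by
        rw [esum_one]
        refine eq_zero_of_eq_neg ?_
        conv_lhs => rw [Finset.sum_mul_sum, Finset.sum_comm]
        rw [Finset.sum_mul_sum, ← Finset.sum_neg_distrib]
        exact Finset.sum_congr rfl fun i _ => by
          rw [← Finset.sum_neg_distrib]; exact Finset.sum_congr rfl fun j _ => hg _ _
      have h12 : esum g s 1 * esum g s 2 = esum g s 2 * esum g s 1 := by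
        rw [esum_one, Finset.sum_mul, Finset.mul_sum]
        exact Finset.sum_congr rfl fun i _ => by rw [esum_anticomm (hg i)]; simp
      have a1 := esum_anticomm (s := s) (hg a) 1
      have a2 := esum_anticomm (s := s) (hg a) 2
      obtain ⟨i1, i2⟩ := ih k
      obtain ⟨j1, j2⟩ := ih (k + 1)
      rw [esum_insert _ h, esum_insert _ h, esum_zero, show 2 * (k + 1) = 2 * k + 1 + 1 by ring,
        esum_insert _ h, esum_insert _ h, esum_insert _ h]
      rw [show 2 * (k + 1) = 2 * k + 1 + 1 by ring] at j1 j2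
      have a1' : esum g s 1 * g a = -(g a * esum g s 1) := by rw [a1]; simp
      have a2' : esum g s 2 * g a = g a * esum g s 2 := by rw [a2]; simp
      have c1 := (Nat.cast_commute (k + 1) (g a)).eq
      have c2 := (Nat.cast_commute (k + 1) (esum g s 1)).eq
      push_cast at c1 c2 j2 ⊢
      have h3 : esum g s 2 * esum g s (2 * k + 1) = (k + 1) * esum g s (2 * k + 1 + 1 + 1) := by
        linear_combination (norm := noncomm_ring) -(esum g s 2 * i1) - h12 * esum g s (2 * k)
          + esum g s 1 * i2 - c2 * esum g s (2 * k + 2) + (k + 1) * j1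
      refine ⟨?_, ?_⟩
      · linear_combination (norm := noncomm_ring) j1 + a1' * esum g s (2 * k + 1)
          + g a * esum g s 1 * i1 - g a * h11 * esum g s (2 * k) + gg * esum g s (2 * k + 1)
      · linear_combination (norm := noncomm_ring) j2 + a2' * esum g s (2 * k + 1)
          + g a * h3 + g a * a1' * esum g s (2 * k + 1) - gg * esum g s 1 * esum g s (2 * k + 1)
          + g a * j1 - c1 * esum g s (2 * k + 1 + 1 + 1)

theorem factorial_mul_esum (hg : ∀ i j, g i * g j = -(g j * g i)) (s : Finset I) (k : ℕ) :
    esum g s 1 * esum g s 2 ^ k = (k.factorial : A) * esum g s (2 * k + 1) := by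
  have h : ∀ k, esum g s 2 ^ k = (k.factorial : A) * esum g s (2 * k) := fun k => by
    induction k with
    | zero => simp [esum_zero]
    | succ k ih =>
      have c := (Nat.cast_commute k.factorial (esum g s 2)).eq
      rw [pow_succ', ih, ← mul_assoc, ← c, mul_assoc, (esum_recursions hg s k).2,
        Nat.factorial_succ, mul_comm (k + 1) k.factorial]
      push_cast
      rw [mul_assoc]
      rfl
  rw [h, ← mul_assoc, ← (Nat.cast_commute k.factorial (esum g s 1)).eq, mul_assoc,
    (esum_recursions hg s k).1]

end ElementarySums

open MulOpposite

namespace BlockModes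

open Polynomial

variable {ι A : Type*} [DecidableEq ι] [Ring A] [Algebra ℂ A]
  (M : BlockModes ι A)

/-- All the modes of `M`, including `r` and `q`, as one family. -/
def full : SymplecticModes (ι ⊕ Bool) A where
  u := Sum.elim M.u fun b => cond b M.q M.r
  d := Sum.elim M.d fun b => cond b M.dq M.dr
  E := 1
  σ := Sum.map M.σ not
  ε := Sum.elim M.ε fun b => cond b 1 (-1)
  uu := by
    rintro (i | _ | _) (j | _ | _)
    · exact M.uu i j
    all_goals simp [M.odd_r.u, M.odd_q.u, M.rr, M.qq, M.qr]
  dd := by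
    rintro (i | _ | _) (j | _ | _)
    · exact M.dd i j
    all_goals simp [M.odd_dr.d, M.odd_dq.d, M.drdr, M.dqdq, M.dqdr]
  du := by
    rintro (i | _ | _) (j | _ | _)
    · simp [M.du i j]
    all_goals
      simp [M.odd_dr.u, M.odd_dq.u, M.odd_r.d, M.odd_q.d, M.dr_r, M.dr_q, M.dq_r, M.dq_q]
  EE := one_mul 1
  Eu _ := by rw [one_mul, mul_one]
  Ed _ := by rw [one_mul, mul_one]
  σσ := by rintro (i | _ | _) <;> simp [M.σσ]
  εσ := by rintro (i | _ | _) <;> simp [M.εσ]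
  εε := by rintro (i | _ | _) <;> simp [M.εε]

variable {M}

theorem isVac_full_iff {T : A} : M.full.IsVac T ↔ M.LowL T ∧ M.LowR T := by
  constructor
  · rintro ⟨-, h1, h2⟩
    exact ⟨⟨h1 (.inr false), h1 (.inr true), fun i => h1 (.inl i)⟩,
      ⟨h2 (.inr false), h2 (.inr true), fun i => h2 (.inl i)⟩⟩
  · rintro ⟨h1, h2⟩
    refine ⟨⟨one_mul T, mul_one T⟩, ?_, ?_⟩
    · rintro (i | _ | _)
      exacts [h1.d i, h1.dr, h1.dq]
    · rintro (i | _ | _)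
      exacts [h2.u i, h2.r, h2.q]

theorem vacUnique_of_full (h : M.full.VacUnique) : M.VacUnique := by
  have key : ∀ T, M.IsVac T → M.full.IsVac T := by
    rintro T ⟨⟨h1, h2⟩, h3, h4⟩
    refine isVac_full_iff.2 ⟨⟨?_, ?_, h3⟩, ⟨?_, ?_, h4⟩⟩
    · rw [← h1, ← mul_assoc, M.dr_E, zero_mul]
    · rw [← h1, ← mul_assoc, M.dq_E, zero_mul]
    · rw [← h2, mul_assoc, M.E_r, mul_zero]
    · rw [← h2, mul_assoc, M.E_q, mul_zero]
  exact fun T S hT hS => h T S (key T hT) (key S hS)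

/-- The operators whose commutant is described by `Comm`. -/
def lieSet (M : BlockModes ι A) : Set A :=
  {x | x = M.r * M.dq ∨ (∃ i, x = M.u i * M.dq) ∨ (∃ i, x = M.r * M.d i) ∨ ∃ i j, x = M.X i j}

theorem comm_iff {T : A} : M.Comm T ↔ T ∈ Subalgebra.centralizer ℂ M.lieSet := by
  rw [Subalgebra.mem_centralizer_iff]
  constructor
  · rintro h x (rfl | ⟨i, rfl⟩ | ⟨i, rfl⟩ | ⟨i, j, rfl⟩)
    exacts [h.rdq, h.udq i, h.rd i, h.sp i j]
  · exact fun h => ⟨h _ (.inl rfl), fun i => h _ (.inr (.inl ⟨i, rfl⟩)),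
      fun i => h _ (.inr (.inr (.inl ⟨i, rfl⟩))),
      fun i j => h _ (.inr (.inr (.inr ⟨i, j, rfl⟩)))⟩

theorem X_eq_neg (M : BlockModes ι A) (i j : ι) :
    M.X i j = -(M.ds j * M.u i + M.ds i * M.u j) := by
  have h1 := M.ds_u j i
  have h2 := M.ds_u i j
  rw [h1, h2, SymplecticModes.X]
  simp only [M.eq_σ_iff i j]
  split_ifs with h
  · rw [h, M.εσ, map_neg]; abel
  · abel

theorem comm_of_highL_lowR {P : A} (h1 : M.HighL P) (h2 : M.LowR P) : M.Comm P := by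
  have hds : ∀ i j, M.ds i * M.u j * P = 0 := fun i j => by rw [mul_assoc, h1.u, mul_zero]
  refine ⟨?_, fun i => ?_, fun i => ?_, fun i j => ?_⟩
  · linear_combination (norm := noncomm_ring) M.dq_r * P - M.dq * h1.r - h2.r * M.dq
  · linear_combination (norm := noncomm_ring) M.odd_dq.u i * P - M.dq * h1.u i - h2.u i * M.dq
  · linear_combination (norm := noncomm_ring) M.odd_r.d i * P - M.d i * h1.r - h2.r * M.d i
  · trans 0
    · rw [X_eq_neg, neg_mul, add_mul, hds, hds, add_zero, neg_zero]
    · rw [SymplecticModes.X, mul_add, ← mul_assoc, ← mul_assoc, h2.u, h2.u, zero_mul, zero_mul,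
        add_zero]

theorem comm_of_lowL_highR {P : A} (h1 : M.LowL P) (h2 : M.HighR P) : M.Comm P := by
  have hds : ∀ i, M.ds i * P = 0 := fun i => by
    rw [SymplecticModes.ds, smul_mul_assoc, h1.d, smul_zero]
  have hds' : ∀ i, P * M.ds i = 0 := fun i => by
    rw [SymplecticModes.ds, mul_smul_comm, h2.d, smul_zero]
  refine ⟨?_, fun i => ?_, fun i => ?_, fun i j => ?_⟩
  · linear_combination (norm := noncomm_ring) M.r * h1.dq - P * M.dq_r + h2.dq * M.r
  · linear_combination (norm := noncomm_ring) M.u i * h1.dq - P * M.odd_dq.u i + h2.dq * M.u i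
  · linear_combination (norm := noncomm_ring) M.r * h1.d i - P * M.odd_r.d i + h2.d i * M.r
  · trans 0
    · rw [SymplecticModes.X, add_mul, mul_assoc, mul_assoc, hds, hds, mul_zero, mul_zero, add_zero]
    · rw [X_eq_neg, mul_neg, mul_add, ← mul_assoc, ← mul_assoc, hds', hds', zero_mul, zero_mul,
        add_zero, neg_zero]

theorem Comm.of_dual {T : A} (h : M.dual.Comm (op T)) : M.Comm T where
  rdq := (congrArg unop h.rdq).symm
  udq i := (congrArg unop (h.rd i)).symm
  rd i := (congrArg unop (h.udq i)).symm
  sp i j := by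
    have e := h.sp (M.σ i) (M.σ j)
    have hX : M.dual.X (M.σ i) (M.σ j) = -((M.ε i * M.ε j) • op (M.X i j)) := by
      refine (M.toSymplecticModes.dual_X _ _).trans ?_
      rw [M.σσ, M.σσ, M.εσ, M.εσ, neg_mul_neg]
    have hne : M.ε i * M.ε j ≠ 0 := mul_ne_zero (left_ne_zero_of_mul_eq_one (M.εε i))
      (left_ne_zero_of_mul_eq_one (M.εε j))
    rw [hX, neg_mul, mul_neg, neg_inj, smul_mul_assoc, mul_smul_comm] at e
    exact (congrArg unop (smul_right_injective _ hne e)).symm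

variable [Fintype ι]

theorem X_om (i j : ι) : Commute (M.X i j) M.om := by
  have h1 := M.om_u i
  have h2 := M.om_u j
  have hd : ∀ k, M.ds k * M.om = M.om * M.ds k + 2 • M.u k := fun k => by
    rw [SymplecticModes.ds, smul_mul_assoc, M.d_om, smul_sub, mul_smul_comm, SymplecticModes.us,
      M.σσ, M.εσ, smul_comm (M.ε k) 2, smul_smul, mul_neg, M.εε]
    simp
  show _ = _
  rw [SymplecticModes.X]
  linear_combination (norm := noncomm_ring) M.u i * hd j + M.u j * hd i - h1 * M.ds j
    - h2 * M.ds i + 2 • M.uu i j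

theorem comm_r_om (k : ℕ) : M.Comm (M.r * M.om ^ k) := by
  have ho : M.r * M.om ^ k = M.om ^ k * M.r := (M.odd_r.om.pow_right k).eq
  have hq : M.dq * M.om ^ k = M.om ^ k * M.dq := (M.odd_dq.om.pow_right k).eq
  refine ⟨?_, fun i => ?_, fun i => ?_, fun i j => ?_⟩
  · linear_combination (norm := noncomm_ring) M.r * M.dq_r * M.om ^ k - M.rr * M.dq * M.om ^ k
      - ho * M.r * M.dq - M.om ^ k * M.rr * M.dq
  · have hu : M.om ^ k * M.u i = M.u i * M.om ^ k :=
      ((show Commute _ _ from M.om_u i).pow_left k).eq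
    linear_combination (norm := noncomm_ring) M.u i * M.dq_r * M.om ^ k
      - M.odd_r.u i * M.dq * M.om ^ k + M.r * M.u i * hq - M.r * hu * M.dq
  · linear_combination (norm := noncomm_ring) M.r * M.odd_r.d i * M.om ^ k
      - M.rr * M.d i * M.om ^ k - ho * M.r * M.d i - M.om ^ k * M.rr * M.d i
  · have h1 := M.odd_r.X i j
    have h2 : M.X i j * M.om ^ k = M.om ^ k * M.X i j := ((M.X_om i j).pow_right k).eq
    linear_combination (norm := noncomm_ring) M.r * h2 - h1 * M.om ^ k

theorem comm_dq_la (k : ℕ) : M.Comm (M.dq * M.la ^ k) := by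
  refine Comm.of_dual ?_
  have h := M.dual.comm_r_om k
  have e : M.dual.om = op M.la := M.toSymplecticModes.dual_om
  rw [e, ← op_pow] at h
  rw [(M.odd_dq.la.pow_right k).eq, op_mul]
  exact h

theorem full_num : M.full.num = M.Nh := by
  simp [SymplecticModes.num, full, Nh]
  abel

theorem comm_Nh : M.Comm M.Nh := by
  have key : ∀ i j, Commute M.Nh (M.full.u i * M.full.d j) := fun i j => by
    rw [← full_num]
    show _ = _
    linear_combination (norm := noncomm_ring) M.full.num_u i * M.full.d j
      - M.full.u i * M.full.d_num j
  refine ⟨(key (.inr false) (.inr true)).eq.symm, fun i => (key (.inl i) (.inr true)).eq.symm,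
    fun i => (key (.inr false) (.inl i)).eq.symm, fun i j => ?_⟩
  have h : ∀ i j, Commute M.Nh (M.u i * M.ds j) := fun i j => by
    rw [SymplecticModes.ds, mul_smul_comm]
    exact (key (.inl i) (.inl _)).smul_right _
  exact ((h i j).add_right (h j i)).eq.symm

theorem Good.of_tops {B : Subalgebra ℂ A} (hv : M.full.VacUnique)
    (hr : ∀ k, M.r * M.om ^ k ∈ B) (hd : ∀ k, M.dq * M.la ^ k ∈ B) (hN : M.Nh ∈ B) {P Q : A}
    (hP : P ∈ B) (hQ : Q ∈ B) (hP' : M.LowR P) (hQ' : M.LowL Q)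
    (hl : ∀ S, M.HighL S → ∃ c : ℂ, c ≠ 0 ∧ P * Q * S = c • S)
    (hh : ∀ S, M.HighR S → ∃ c : ℂ, c ≠ 0 ∧ S * (P * Q) = c • S) : M.Good B := by
  have hll : ∀ S, M.LowL S → M.LowR S → S ∈ B := fun S h1 h2 => by
    obtain ⟨c, hc⟩ := (isVac_full_iff.2 ⟨h1, h2⟩).exists_smul hv
    rw [hc, full_num]
    exact B.smul_mem (B.mul_mem (aeval_mem_of_mem hN _) B.one_mem) c
  have left : ∀ S, M.LowL (Q * S) := fun S =>
    ⟨by rw [← mul_assoc, hQ'.dr, zero_mul], by rw [← mul_assoc, hQ'.dq, zero_mul],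
      fun i => by rw [← mul_assoc, hQ'.d, zero_mul]⟩
  have right : ∀ S, M.LowR (S * P) := fun S =>
    ⟨by rw [mul_assoc, hP'.r, mul_zero], by rw [mul_assoc, hP'.q, mul_zero],
      fun i => by rw [mul_assoc, hP'.u, mul_zero]⟩
  have fromL : ∀ S, M.HighL S → Q * S ∈ B → S ∈ B := fun S h h' => by
    obtain ⟨c, hc, e⟩ := hl S h
    rw [← inv_smul_smul₀ hc S, ← e, mul_assoc]
    exact B.smul_mem (B.mul_mem hP h') _
  have fromR : ∀ S, M.HighR S → S * P ∈ B → S ∈ B := fun S h h' => by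
    obtain ⟨c, hc, e⟩ := hh S h
    rw [← inv_smul_smul₀ hc S, ← e, ← mul_assoc]
    exact B.smul_mem (B.mul_mem h' hQ) _
  refine ⟨hr, hd, hN, hll, fun S h1 h2 => fromL S h1 (hll _ (left S) ?_),
    fun S h1 h2 => fromR S h2 (hll _ ?_ (right S)), fun S h1 h2 => fromL S h1 (fromR _ ?_
      (hll _ (mul_assoc Q S P ▸ left _) (right _)))⟩
  · exact ⟨by rw [mul_assoc, h2.r, mul_zero], by rw [mul_assoc, h2.q, mul_zero],
      fun i => by rw [mul_assoc, h2.u, mul_zero]⟩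
  · exact ⟨by rw [← mul_assoc, h1.dr, zero_mul], by rw [← mul_assoc, h1.dq, zero_mul],
      fun i => by rw [← mul_assoc, h1.d, zero_mul]⟩
  · exact ⟨by rw [mul_assoc, h2.dr, mul_zero], by rw [mul_assoc, h2.dq, mul_zero],
      fun i => by rw [mul_assoc, h2.d, mul_zero]⟩

theorem Good.centralizer_le {B : Subalgebra ℂ A} (hv : M.full.VacUnique) (hB : M.Good B) :
    Subalgebra.centralizer ℂ M.lieSet ≤ B := by
  intro T hT
  have ha := M.full.aeval_num_eq_zero
  rw [full_num] at ha
  obtain ⟨p, hp1, hp2⟩ := exists_spectral_projections ha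
  rw [← one_mul T, ← mul_one (1 * T), ← hp1, Finset.sum_mul, Finset.sum_mul]
  refine B.sum_mem fun i hi => ?_
  rw [Finset.mul_sum]
  refine B.sum_mem fun j hj => ?_
  have hN := comm_iff.1 (comm_Nh (M := M))
  have hC := comm_iff.2 (Subalgebra.mul_mem _ (Subalgebra.mul_mem _ (aeval_mem_of_mem hN (p i)) hT)
    (aeval_mem_of_mem hN (p j)))
  refine hB.mem_of_comm (vacUnique_of_full hv) hC (m' := i) (m := j) ?_ ?_
  · rw [← mul_assoc, ← mul_assoc, hp2 i hi, smul_mul_assoc, smul_mul_assoc, Int.cast_natCast]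
  · rw [mul_assoc _ _ M.Nh, aeval_mul_of_semiconj (rfl : M.Nh * M.Nh = M.Nh * M.Nh), hp2 j hj,
      mul_smul_comm, Int.cast_natCast]

end BlockModes

section IntervalSums

variable {A : Type*} [Ring A]

/-- The sum of `g j` over `a ≤ j < b`. -/
def isum (g : ℕ → A) (a b : ℕ) : A := ∑ j ∈ Finset.Ico a b, g j

variable (g h : ℕ → A)

theorem isum_add {a b c : ℕ} (h1 : a ≤ b) (h2 : b ≤ c) :
    isum g a b + isum g b c = isum g a c := Finset.sum_Ico_consecutive g h1 h2

theorem isum_self (a : ℕ) : isum g a a = 0 := by simp [isum]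

theorem isum_succ (a : ℕ) : isum g a (a + 1) = g a := by simp [isum]

theorem isum_succ_right {a b : ℕ} (h : a ≤ b) : isum g a (b + 1) = isum g a b + g b := by
  rw [← isum_add g h (Nat.le_succ b), isum_succ]

theorem isum_two (a : ℕ) : isum g a (a + 2) = g a + g (a + 1) := by
  rw [isum_succ_right g (Nat.le_succ a), isum_succ]

theorem sum_isum_even (n : ℕ) : ∑ k ∈ Finset.range n, isum g (2 * k) (2 * k + 2)
    = isum g 0 (2 * n) := by
  induction n with
  | zero => simp [isum_self]
  | succ n ih =>
    rw [Finset.sum_range_succ, ih, isum_add g (Nat.zero_le _) (by omega)]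
    rfl

variable {g} in
theorem isum_anticomm (hg : ∀ i j, g i * g j = -(g j * g i)) (a b c d : ℕ) :
    isum g a b * isum g c d = -(isum g c d * isum g a b) := by
  rw [isum, isum, Finset.sum_mul_sum, Finset.sum_mul_sum, Finset.sum_comm,
    ← Finset.sum_neg_distrib]
  refine Finset.sum_congr rfl fun i _ => ?_
  rw [← Finset.sum_neg_distrib]
  exact Finset.sum_congr rfl fun j _ => hg _ _

/-- A subgroup containing the interval sums that make up the block modes contains each term. -/
theorem mem_of_isum_mem (H : AddSubgroup A) {n : ℕ} (h1 : isum g 0 (2 * n + 2) ∈ H)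
    (h2 : isum g 0 (2 * n + 1) ∈ H) (h3 : ∀ k < n, isum g (2 * k) (2 * k + 2) ∈ H)
    (h4 : ∀ k < n, isum g (2 * k + 1) (2 * n + 1) ∈ H) {j : ℕ} (hj : j < 2 * n + 2) :
    g j ∈ H := by
  have even : ∀ k ≤ n, isum g 0 (2 * k) ∈ H := fun k hk => by
    rw [← sum_isum_even]
    exact H.sum_mem fun i hi => h3 i (by rw [Finset.mem_range] at hi; omega)
  have odd : ∀ k ≤ n, isum g 0 (2 * k + 1) ∈ H := fun k hk => by
    rcases hk.lt_or_eq with hk | rfl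
    · have := H.sub_mem h2 (h4 k hk)
      rwa [← isum_add g (Nat.zero_le (2 * k + 1)) (by omega), add_sub_cancel_right] at this
    · exact h2
  have all : ∀ m ≤ 2 * n + 2, isum g 0 m ∈ H := fun m hm => by
    rcases Nat.even_or_odd' m with ⟨k, rfl | rfl⟩
    · rcases (show k ≤ n + 1 by omega).lt_or_eq with hk | rfl
      · exact even k (by omega)
      · exact h1
    · exact odd k (by omega)
  have := H.sub_mem (all (j + 1) (by omega)) (all j (by omega))
  rwa [isum_succ_right g (Nat.zero_le j), add_sub_cancel_left] at this

variable {g} in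
theorem esum_two_range [Algebra ℂ A] (hg : ∀ i j, g i * g j = -(g j * g i)) (n : ℕ) :
    esum g (Finset.range (2 * n + 2)) 2 = isum g 0 (2 * n + 2) * g (2 * n + 1)
      + ∑ k ∈ Finset.range n, isum g (2 * k) (2 * k + 2) * isum g (2 * k + 1) (2 * n + 1) := by
  have step : ∀ m, esum g (Finset.range (m + 1)) 2
      = esum g (Finset.range m) 2 + isum g 0 m * g m := fun m => by
    rw [Finset.range_add_one, esum_two_insert_max _ fun x hx => Finset.mem_range.1 hx, isum,
      Finset.range_eq_Ico]
  have sq : ∀ j, g j * g j = 0 := fun j => eq_zero_of_eq_neg (hg j j)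
  induction n with
  | zero =>
    rw [step, step, Finset.range_zero, esum_empty]
    simp [isum_self, isum_succ, isum_two, add_mul, sq]
  | succ n ih =>
    have e : ∑ k ∈ Finset.range n, isum g (2 * k) (2 * k + 2) * isum g (2 * k + 1) (2 * (n + 1) + 1)
        = ∑ k ∈ Finset.range n, isum g (2 * k) (2 * k + 2) * isum g (2 * k + 1) (2 * n + 1)
          + isum g 0 (2 * n) * (g (2 * n + 1) + g (2 * n + 1 + 1)) := by
      rw [← sum_isum_even, Finset.sum_mul, ← Finset.sum_add_distrib]
      refine Finset.sum_congr rfl fun k hk => ?_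
      rw [← isum_two, ← mul_add, isum_add _ (by rw [Finset.mem_range] at hk; omega) (by omega)]
      rfl
    rw [show 2 * (n + 1) + 2 = 2 * n + 2 + 1 + 1 by ring, step, step, ih, Finset.sum_range_succ, e,
      show 2 * (n + 1) + 1 = 2 * n + 1 + 2 by ring, isum_two, isum_two,
      isum_succ_right g (Nat.zero_le (2 * n + 2 + 1)), isum_succ_right g (Nat.zero_le (2 * n + 2)),
      isum_succ_right g (Nat.zero_le (2 * n + 1)), isum_succ_right g (Nat.zero_le (2 * n))]
    linear_combination (norm := noncomm_ring) - sq (2 * n + 2 + 1)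

theorem number_eq (n : ℕ) :
    -(isum g 0 (2 * n + 2) * isum h 0 (2 * n + 1)) + g (2 * n + 1) * isum h 0 (2 * n + 2)
      + (∑ k ∈ Finset.range n, isum g (2 * k) (2 * k + 2) * isum h (2 * k + 1) (2 * n + 1)
        + ∑ k ∈ Finset.range n, isum g (2 * k + 1) (2 * n + 1) * isum h (2 * k) (2 * k + 2))
      = ∑ j ∈ Finset.range (2 * n + 2), (-1) ^ (j + 1) * (g j * h j) := by
  induction n with
  | zero =>
    simp [isum_two, isum_succ, Finset.sum_range_succ]
    noncomm_ring
  | succ n ih =>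
    have e1 : ∑ k ∈ Finset.range n,
        isum g (2 * k) (2 * k + 2) * isum h (2 * k + 1) (2 * (n + 1) + 1)
        = ∑ k ∈ Finset.range n, isum g (2 * k) (2 * k + 2) * isum h (2 * k + 1) (2 * n + 1)
          + isum g 0 (2 * n) * (h (2 * n + 1) + h (2 * n + 1 + 1)) := by
      rw [← sum_isum_even, Finset.sum_mul, ← Finset.sum_add_distrib]
      refine Finset.sum_congr rfl fun k hk => ?_
      rw [← isum_two, ← mul_add, isum_add _ (by rw [Finset.mem_range] at hk; omega) (by omega)]
      rfl
    have e2 : ∑ k ∈ Finset.range n,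
        isum g (2 * k + 1) (2 * (n + 1) + 1) * isum h (2 * k) (2 * k + 2)
        = ∑ k ∈ Finset.range n, isum g (2 * k + 1) (2 * n + 1) * isum h (2 * k) (2 * k + 2)
          + (g (2 * n + 1) + g (2 * n + 1 + 1)) * isum h 0 (2 * n) := by
      rw [← sum_isum_even, Finset.mul_sum, ← Finset.sum_add_distrib]
      refine Finset.sum_congr rfl fun k hk => ?_
      rw [← isum_two, ← add_mul, isum_add _ (by rw [Finset.mem_range] at hk; omega) (by omega)]
      rfl
    rw [show 2 * (n + 1) + 2 = 2 * n + 2 + 1 + 1 by ring, Finset.sum_range_succ _ (2 * n + 2 + 1),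
      Finset.sum_range_succ _ (2 * n + 2), ← ih, Finset.sum_range_succ _ n,
      Finset.sum_range_succ _ n, e1, e2,
      show 2 * (n + 1) + 1 = 2 * n + 1 + 2 by ring, isum_two, isum_two, isum_two, isum_two]
    simp only [isum_succ_right g (Nat.zero_le _), isum_succ_right h (Nat.zero_le _)]
    have p1 : (-1 : A) ^ (2 * n + 2 + 1) = -1 := Odd.neg_one_pow ⟨n + 1, by ring⟩
    have p2 : (-1 : A) ^ (2 * n + 2 + 1 + 1) = 1 := Even.neg_one_pow ⟨n + 2, by ring⟩
    rw [p1, p2]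
    noncomm_ring

end IntervalSums

/-- Adjoin two further fermionic modes to a family of symplectic modes. -/
def SymplecticModes.withPair {ι A : Type*} [DecidableEq ι] [Ring A] [Algebra ℂ A]
    (M : SymplecticModes ι A) (r dr q dq : A) (rr : r * r = 0) (qq : q * q = 0)
    (drdr : dr * dr = 0) (dqdq : dq * dq = 0) (qr : q * r = -(r * q))
    (dqdr : dq * dr = -(dr * dq)) (dr_r : dr * r = 1 - r * dr) (dq_q : dq * q = 1 - q * dq)
    (dr_q : dr * q = -(q * dr)) (dq_r : dq * r = -(r * dq)) (odd_r : M.IsOdd r)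
    (odd_dr : M.IsOdd dr) (odd_q : M.IsOdd q) (odd_dq : M.IsOdd dq) : BlockModes ι A where
  u := M.u
  d := M.d
  E := dr * r * (dq * q)
  σ := M.σ
  ε := M.ε
  uu := M.uu
  dd := M.dd
  du := M.du
  EE := by
    have h1 : dr * r * (dr * r) = dr * r := by
      linear_combination (norm := noncomm_ring) dr_r * (dr * r) - r * drdr * r
    have h2 : dq * q * (dq * q) = dq * q := by
      linear_combination (norm := noncomm_ring) dq_q * (dq * q) - q * dqdq * q
    have h3 : dq * q * (dr * r) = dr * r * (dq * q) := by
      linear_combination (norm := noncomm_ring) dq * dr_q * r - dqdr * q * r + dr * dq * qr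
        - dr * dq_r * q
    linear_combination (norm := noncomm_ring) dr * r * h3 * (dq * q) + h1 * (dq * q) * (dq * q)
      + dr * r * h2
  Eu i := by
    linear_combination (norm := noncomm_ring) dr * r * dq * odd_q.u i - dr * r * odd_dq.u i * q
      + dr * odd_r.u i * dq * q - odd_dr.u i * r * dq * q
  Ed i := by
    linear_combination (norm := noncomm_ring) dr * r * dq * odd_q.d i - dr * r * odd_dq.d i * q
      + dr * odd_r.d i * dq * q - odd_dr.d i * r * dq * q
  σσ := M.σσ
  εσ := M.εσ
  εε := M.εε
  r := r
  dr := dr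
  q := q
  dq := dq
  rr := rr
  qq := qq
  drdr := drdr
  dqdq := dqdq
  qr := qr
  dqdr := dqdr
  dr_r := dr_r
  dq_q := dq_q
  dr_q := dr_q
  dq_r := dq_r
  odd_r := ⟨odd_r.u, odd_r.d⟩
  odd_dr := ⟨odd_dr.u, odd_dr.d⟩
  odd_q := ⟨odd_q.u, odd_q.d⟩
  odd_dq := ⟨odd_dq.u, odd_dq.d⟩
  E_eq := rfl

/-- The `gl(1|1)` fermions on an open chain of `2 * n + 2` sites, acting irreducibly. -/
structure Chain (n : ℕ) (A : Type*) [Ring A] [Algebra ℂ A] where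
  f : ℕ → A
  fd : ℕ → A
  ff : ∀ i j, f i * f j = -(f j * f i)
  dd : ∀ i j, fd i * fd j = -(fd j * fd i)
  df : ∀ i j, i < 2 * n + 2 → fd i * f j = (if i = j then (-1) ^ (i + 1) else 0) - f j * fd i
  vac : ∀ T T', (∀ j < 2 * n + 2, fd j * T = 0) → (∀ j < 2 * n + 2, T * f j = 0) →
    (∀ j < 2 * n + 2, fd j * T' = 0) → (∀ j < 2 * n + 2, T' * f j = 0) → T' ≠ 0 →
    ∃ c : ℂ, T = c • T'

theorem alternating_sum (A : Type*) [Ring A] {a b : ℕ} (hab : a ≤ b) :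
    ∑ i ∈ Finset.Ico a b, (-1 : A) ^ (i + 1) = (((a % 2 : ℕ) : ℤ) - ((b % 2 : ℕ) : ℤ) : ℤ) := by
  induction b, hab using Nat.le_induction with
  | base => simp
  | succ b hab ih =>
    rw [Finset.sum_Ico_succ_top hab, ih]
    rcases Nat.even_or_odd b with h | h
    · rw [h.add_one.neg_one_pow, Nat.even_iff.1 h, Nat.odd_iff.1 h.add_one]
      push_cast; abel
    · rw [h.add_one.neg_one_pow, Nat.odd_iff.1 h, Nat.even_iff.1 h.add_one]
      push_cast; abel

/-- The anticommutator of the interval sums of `fd` over `[a, b)` and of `f` over `[c, d)`. -/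
def pairing (a b c d : ℕ) : ℤ :=
  if max a c ≤ min b d then ((max a c % 2 : ℕ) : ℤ) - ((min b d % 2 : ℕ) : ℤ) else 0

namespace Chain

variable {n : ℕ} {A : Type*} [Ring A] [Algebra ℂ A] (K : Chain n A)

theorem isum_fd_mul_isum_f {a b c d : ℕ} (hb : b ≤ 2 * n + 2) :
    isum K.fd a b * isum K.f c d = (pairing a b c d : A) - isum K.f c d * isum K.fd a b := by
  have h1 : (pairing a b c d : A) = ∑ i ∈ Finset.Ico (max a c) (min b d), (-1 : A) ^ (i + 1) := by
    rw [pairing]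
    split_ifs with h
    · rw [alternating_sum A h]
    · rw [Finset.Ico_eq_empty_of_le (by omega)]; simp
  have h2 : ∑ i ∈ Finset.Ico a b, ∑ j ∈ Finset.Ico c d, (if i = j then (-1 : A) ^ (i + 1) else 0)
      = pairing a b c d := by
    rw [h1, ← Finset.Ico_inter_Ico, ← Finset.filter_mem_eq_inter, Finset.sum_filter]
    exact Finset.sum_congr rfl fun i _ => Finset.sum_ite_eq _ _ _
  rw [← h2, isum, isum, Finset.sum_mul_sum, Finset.sum_mul_sum,
    Finset.sum_comm (s := Finset.Ico c d),
    ← Finset.sum_sub_distrib]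
  refine Finset.sum_congr rfl fun i hi => ?_
  rw [← Finset.sum_sub_distrib]
  exact Finset.sum_congr rfl fun j _ => K.df i j ((Finset.mem_Ico.1 hi).2.trans_le hb)

theorem isum_fd_mul_isum_f_eq {a b c d : ℕ} {z : ℤ} (hz : pairing a b c d = z)
    (hb : b ≤ 2 * n + 2) :
    isum K.fd a b * isum K.f c d = (z : A) - isum K.f c d * isum K.fd a b := by
  rw [K.isum_fd_mul_isum_f hb, hz]

theorem isum_f_mul_isum_fd {a b c d : ℕ} (hz : pairing a b c d = 0) (hb : b ≤ 2 * n + 2) :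
    isum K.f c d * isum K.fd a b = -(isum K.fd a b * isum K.f c d) := by
  rw [K.isum_fd_mul_isum_f_eq hz hb]; simp

/-- The creators of the block modes. -/
def blockU : Fin n ⊕ Fin n → A :=
  Sum.elim (fun k => isum K.f (2 * k) (2 * k + 2)) fun k => isum K.f (2 * k + 1) (2 * n + 1)

/-- The annihilators of the block modes. -/
def blockD : Fin n ⊕ Fin n → A :=
  Sum.elim (fun k => isum K.fd (2 * k + 1) (2 * n + 1)) fun k => isum K.fd (2 * k) (2 * k + 2)

theorem blockD_mul_blockU (i j : Fin n ⊕ Fin n) :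
    K.blockD i * K.blockU j = (if i = j then 1 else 0) - K.blockU j * K.blockD i := by
  have main : ∀ a b c d, b ≤ 2 * n + 2 → pairing a b c d = (if i = j then 1 else 0) →
      isum K.fd a b * isum K.f c d = (if i = j then 1 else 0) - isum K.f c d * isum K.fd a b :=
    fun a b c d hb h => by rw [K.isum_fd_mul_isum_f_eq h hb]; split_ifs <;> simp
  rcases i with i | i <;> rcases j with j | j <;> refine main _ _ _ _ (by omega) ?_ <;>
    simp only [Sum.inl.injEq, Sum.inr.injEq, reduceCtorEq, if_false, Fin.ext_iff] <;>
    have := i.2 <;> have := j.2 <;> rw [pairing] <;> split_ifs <;> omega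

theorem mul_blockU_of_pairing {a b : ℕ} (hb : b ≤ 2 * n + 2)
    (h1 : ∀ k < n, pairing a b (2 * k) (2 * k + 2) = 0)
    (h2 : ∀ k < n, pairing a b (2 * k + 1) (2 * n + 1) = 0) (i : Fin n ⊕ Fin n) :
    isum K.fd a b * K.blockU i = -(K.blockU i * isum K.fd a b) := by
  rcases i with k | k
  · exact (K.isum_fd_mul_isum_f_eq (h1 k k.2) hb).trans (by simp [blockU])
  · exact (K.isum_fd_mul_isum_f_eq (h2 k k.2) hb).trans (by simp [blockU])

theorem mul_blockD_of_pairing {c d : ℕ}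
    (h1 : ∀ k < n, pairing (2 * k) (2 * k + 2) c d = 0)
    (h2 : ∀ k < n, pairing (2 * k + 1) (2 * n + 1) c d = 0) (i : Fin n ⊕ Fin n) :
    isum K.f c d * K.blockD i = -(K.blockD i * isum K.f c d) := by
  rcases i with k | k
  · exact K.isum_f_mul_isum_fd (h2 k k.2) (by omega)
  · exact K.isum_f_mul_isum_fd (h1 k k.2) (by omega)

theorem mul_blockU (c d : ℕ) (i : Fin n ⊕ Fin n) :
    isum K.f c d * K.blockU i = -(K.blockU i * isum K.f c d) := by
  rcases i with k | k <;> exact isum_anticomm K.ff _ _ _ _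

theorem mul_blockD (c d : ℕ) (i : Fin n ⊕ Fin n) :
    isum K.fd c d * K.blockD i = -(K.blockD i * isum K.fd c d) := by
  rcases i with k | k <;> exact isum_anticomm K.dd _ _ _ _

theorem fd_mul_f_of_pairing_one {a b c d : ℕ} (hz : pairing a b c d = 1) (hb : b ≤ 2 * n + 2) :
    isum K.fd a b * isum K.f c d = 1 - isum K.f c d * isum K.fd a b := by
  rw [K.isum_fd_mul_isum_f_eq hz hb, Int.cast_one]

theorem fd_mul_f_of_pairing_zero {a b c d : ℕ} (hz : pairing a b c d = 0) (hb : b ≤ 2 * n + 2) :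
    isum K.fd a b * isum K.f c d = -(isum K.f c d * isum K.fd a b) := by
  rw [K.isum_fd_mul_isum_f_eq hz hb, Int.cast_zero, zero_sub]

/-- The modes of the chain that pair symplectically. -/
def modes : SymplecticModes (Fin n ⊕ Fin n) A where
  u := K.blockU
  d := K.blockD
  E := 1
  σ := Sum.swap
  ε := Sum.elim (fun _ => -1) fun _ => 1
  uu i j := by rcases i with i | i <;> exact K.mul_blockU _ _ j
  dd i j := by rcases i with i | i <;> exact K.mul_blockD _ _ j
  du := K.blockD_mul_blockU
  EE := one_mul 1
  Eu _ := by rw [one_mul, mul_one]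
  Ed _ := by rw [one_mul, mul_one]
  σσ := Sum.swap_swap
  εσ := by rintro (i | i) <;> simp
  εε := by rintro (i | i) <;> simp

/-- The block modes of the chain: `r` and `dq` are the sums of all `f j` and of all `fd j`. -/
def block : BlockModes (Fin n ⊕ Fin n) A :=
  K.modes.withPair (isum K.f 0 (2 * n + 2)) (-isum K.fd 0 (2 * n + 1))
    (isum K.f (2 * n + 1) (2 * n + 2)) (isum K.fd 0 (2 * n + 2))
    (rr := eq_zero_of_eq_neg (isum_anticomm K.ff _ _ _ _))
    (qq := eq_zero_of_eq_neg (isum_anticomm K.ff _ _ _ _))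
    (drdr := by rw [neg_mul_neg]; exact eq_zero_of_eq_neg (isum_anticomm K.dd _ _ _ _))
    (dqdq := eq_zero_of_eq_neg (isum_anticomm K.dd _ _ _ _))
    (qr := isum_anticomm K.ff _ _ _ _)
    (dqdr := by rw [mul_neg, neg_mul, isum_anticomm K.dd])
    (dr_r := by
      rw [neg_mul, K.isum_fd_mul_isum_f_eq (z := -1) _ (by omega)]
      · simp; abel
      · rw [pairing]; split_ifs <;> omega)
    (dq_q := K.fd_mul_f_of_pairing_one (by rw [pairing]; split_ifs <;> omega) le_rfl)
    (dr_q := by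
      rw [neg_mul, mul_neg, K.fd_mul_f_of_pairing_zero _ (by omega)]
      rw [pairing]; split_ifs <;> omega)
    (dq_r := K.fd_mul_f_of_pairing_zero (by rw [pairing]; split_ifs <;> omega) le_rfl)
    (odd_r := ⟨K.mul_blockU _ _, K.mul_blockD_of_pairing
      (fun k hk => by rw [pairing]; split_ifs <;> omega)
      fun k hk => by rw [pairing]; split_ifs <;> omega⟩)
    (odd_q := ⟨K.mul_blockU _ _, K.mul_blockD_of_pairing
      (fun k hk => by rw [pairing]; split_ifs <;> omega)
      fun k hk => by rw [pairing]; split_ifs <;> omega⟩)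
    (odd_dr := ⟨fun i => by
      have h := K.mul_blockU_of_pairing (a := 0) (b := 2 * n + 1) (by omega)
        (fun k hk => by rw [pairing]; split_ifs <;> omega)
        (fun k hk => by rw [pairing]; split_ifs <;> omega) i
      show -_ * K.blockU i = -(K.blockU i * -_)
      rw [neg_mul, mul_neg, h], fun i => by
      show -_ * K.blockD i = -(K.blockD i * -_)
      rw [neg_mul, mul_neg, K.mul_blockD]⟩)
    (odd_dq := ⟨K.mul_blockU_of_pairing le_rfl
      (fun k hk => by rw [pairing]; split_ifs <;> omega)
      fun k hk => by rw [pairing]; split_ifs <;> omega, K.mul_blockD _ _⟩)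

end Chain

section SymmetricPairs

variable {A : Type*} [Ring A]

/-- Symmetrised products stay in `C` on passing from a set of pairs to the subgroup it spans. -/
theorem symm_mem_of_closure {C : AddSubgroup A} {G : Set (A × A)}
    (h : ∀ p ∈ G, ∀ p' ∈ G, p.1 * p'.2 + p'.1 * p.2 ∈ C) {p p' : A × A}
    (hp : p ∈ AddSubgroup.closure G) (hp' : p' ∈ AddSubgroup.closure G) :
    p.1 * p'.2 + p'.1 * p.2 ∈ C := by
  induction hp, hp' using AddSubgroup.closure_induction₂ with
  | mem p p' hp hp' => exact h p hp p' hp'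
  | zero_left p' => simp
  | zero_right p => simp
  | add_left p q p' _ _ _ h1 h2 =>
    convert C.add_mem h1 h2 using 1
    simp only [Prod.fst_add, Prod.snd_add]; noncomm_ring
  | add_right p q p' _ _ _ h1 h2 =>
    convert C.add_mem h1 h2 using 1
    simp only [Prod.fst_add, Prod.snd_add]; noncomm_ring
  | neg_left p p' _ _ h1 =>
    convert C.neg_mem h1 using 1
    simp only [Prod.fst_neg, Prod.snd_neg]; noncomm_ring
  | neg_right p p' _ _ h1 =>
    convert C.neg_mem h1 using 1
    simp only [Prod.fst_neg, Prod.snd_neg]; noncomm_ring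

variable [Algebra ℂ A]

theorem mem_of_add_self_mem {C : Subalgebra ℂ A} {x : A} (h : x + x ∈ C) : x ∈ C := by
  have := C.smul_mem h (2⁻¹ : ℂ)
  rwa [← two_smul ℂ, smul_smul, inv_mul_cancel₀ two_ne_zero, one_smul] at this

/-- A subalgebra containing the products `a j * b j` of a nearest-neighbour chain contains all the
symmetrised products. -/
theorem symm_mem_of_chain {C : Subalgebra ℂ A} {a b : ℕ → A} {m : ℕ}
    (aa : ∀ i j, a i * a j = -(a j * a i)) (bb : ∀ i j, b i * b j = -(b j * b i))
    (ba : ∀ i < m, ∀ j < m, b i * a j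
      = (if j = i + 1 then 1 else if i = j + 1 then -1 else 0) - a j * b i)
    (h : ∀ j < m, a j * b j ∈ C) {i j : ℕ} (hi : i < m) (hj : j < m) :
    a i * b j + a j * b i ∈ C := by
  have key : ∀ d i, i + d < m → a i * b (i + d) + a (i + d) * b i ∈ C := by
    intro d
    induction d with
    | zero => exact fun i hi => C.add_mem (h i hi) (h i hi)
    | succ d ih =>
      intro i hid
      have hC := C.sub_mem (C.mul_mem (ih i (by omega)) (h (i + d + 1) hid))
        (C.mul_mem (h (i + d + 1) hid) (ih i (by omega)))
      have r1 := ba (i + d) (by omega) (i + d + 1) hid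
      have r2 := ba (i + d + 1) hid (i + d) (by omega)
      have r3 := ba i (by omega) (i + d + 1) hid
      have r4 := ba (i + d + 1) hid i (by omega)
      rw [if_pos rfl] at r1
      rw [if_neg (by omega), if_pos rfl] at r2
      rw [← add_assoc]
      rcases Nat.eq_zero_or_pos d with rfl | hd
      · refine mem_of_add_self_mem ?_
        convert hC using 1
        simp only [add_zero] at *
        linear_combination (norm := noncomm_ring) -(2 • (a i * r1 * b (i + 1)))
          + 2 • (a (i + 1) * r2 * b i) + 2 • (aa i (i + 1) * b i * b (i + 1))
          - 2 • (a (i + 1) * a i * bb i (i + 1))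
      · rw [if_neg (by omega), if_neg (by omega)] at r3 r4
        convert hC using 1
        linear_combination (norm := noncomm_ring) -(a i * r1 * b (i + d + 1))
          - a (i + d) * r3 * b (i + d + 1) + a (i + d + 1) * r4 * b (i + d)
          + a (i + d + 1) * r2 * b i + aa i (i + d + 1) * b (i + d) * b (i + d + 1)
          + aa (i + d) (i + d + 1) * b i * b (i + d + 1)
          - a (i + d + 1) * a i * bb (i + d) (i + d + 1)
          - a (i + d + 1) * a (i + d) * bb i (i + d + 1)
  rcases le_total i j with hij | hij
  · obtain ⟨d, rfl⟩ := Nat.exists_eq_add_of_le hij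
    exact key d i hj
  · obtain ⟨d, rfl⟩ := Nat.exists_eq_add_of_le hij
    rw [add_comm]
    exact key d j hi

end SymmetricPairs

namespace Chain

variable {n : ℕ} {A : Type*} [Ring A] [Algebra ℂ A] (K : Chain n A)

/-- The periodic Temperley–Lieb generators of the chain. -/
def tlSet : Set A :=
  {x | (∃ j < 2 * n + 1, x = (K.f j + K.f (j + 1)) * (K.fd j + K.fd (j + 1))) ∨
    x = (K.f (2 * n + 1) + K.f 0) * (K.fd (2 * n + 1) + K.fd 0)}

/-- The pairs whose symmetrised products span the open Temperley–Lieb Lie algebra. -/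
def bond (j : ℕ) : A × A := (isum K.f j (j + 2), (-1) ^ j * isum K.fd j (j + 2))

def modePair (i : Fin n ⊕ Fin n) : A × A := (K.block.u i, -K.block.ds i)

def zeroPair : A × A := (K.block.r, K.block.dq)

theorem isum_odd_bonds {k m : ℕ} (hkm : k ≤ m) :
    ∑ l ∈ Finset.Ico k m, K.bond (2 * l + 1)
      = (isum K.f (2 * k + 1) (2 * m + 1), -isum K.fd (2 * k + 1) (2 * m + 1)) := by
  induction m, hkm using Nat.le_induction with
  | base => simp [isum_self]; rfl
  | succ m hkm ih =>
    rw [Finset.sum_Ico_succ_top hkm, ih, bond, Odd.neg_one_pow ⟨m, rfl⟩, Prod.mk_add_mk,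
      neg_one_mul, ← neg_add, isum_add _ (by omega) (by omega), isum_add _ (by omega) (by omega)]
    rfl

theorem isum_even_bonds (m : ℕ) :
    ∑ l ∈ Finset.range m, K.bond (2 * l) = (isum K.f 0 (2 * m), isum K.fd 0 (2 * m)) := by
  induction m with
  | zero => simp [isum_self]; rfl
  | succ m ih =>
    rw [Finset.sum_range_succ, ih, bond, Even.neg_one_pow (even_two_mul m), Prod.mk_add_mk,
      one_mul, isum_add _ (by omega) (by omega), isum_add _ (by omega) (by omega)]
    rfl

theorem modePair_inl (k : Fin n) : K.modePair (.inl k) = K.bond (2 * k) := by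
  have : K.block.ds (.inl k) = (-1 : ℂ) • isum K.fd (2 * k) (2 * k + 2) := rfl
  rw [modePair, this, bond, Even.neg_one_pow (even_two_mul _), one_mul, neg_one_smul, neg_neg]
  rfl

theorem modePair_inr (k : Fin n) : K.modePair (.inr k)
    = (isum K.f (2 * k + 1) (2 * n + 1), -isum K.fd (2 * k + 1) (2 * n + 1)) := by
  have : K.block.ds (.inr k) = (1 : ℂ) • isum K.fd (2 * k + 1) (2 * n + 1) := rfl
  rw [modePair, this, one_smul]
  rfl

theorem zeroPair_eq : K.zeroPair = ∑ l ∈ Finset.range (n + 1), K.bond (2 * l) := by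
  rw [isum_even_bonds]; rfl

theorem modePair_mem (i : Fin n ⊕ Fin n) :
    K.modePair i ∈ AddSubgroup.closure (K.bond '' Set.Iio (2 * n + 1)) := by
  rcases i with k | k
  · rw [modePair_inl]
    exact AddSubgroup.subset_closure ⟨_, by simp, rfl⟩
  · rw [modePair_inr, ← K.isum_odd_bonds k.2.le]
    refine AddSubgroup.sum_mem _ fun l hl => AddSubgroup.subset_closure ⟨_, ?_, rfl⟩
    rw [Finset.mem_Ico] at hl
    simp only [Set.mem_Iio]; omega

theorem zeroPair_mem :
    K.zeroPair ∈ AddSubgroup.closure (K.bond '' Set.Iio (2 * n + 1)) := by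
  rw [zeroPair_eq]
  refine AddSubgroup.sum_mem _ fun l hl => AddSubgroup.subset_closure ⟨_, ?_, rfl⟩
  rw [Finset.mem_range] at hl
  simp only [Set.mem_Iio]; omega

theorem bond_mem {j : ℕ} (hj : j < 2 * n + 1) :
    K.bond j ∈ AddSubgroup.closure (insert K.zeroPair (Set.range K.modePair)) := by
  set H := AddSubgroup.closure (insert K.zeroPair (Set.range K.modePair))
  have hm : ∀ i, K.modePair i ∈ H := fun i =>
    AddSubgroup.subset_closure (Set.mem_insert_of_mem _ ⟨i, rfl⟩)
  have h0 : K.zeroPair ∈ H := AddSubgroup.subset_closure (Set.mem_insert _ _)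
  have tail : ∀ k ≤ n, ∑ l ∈ Finset.Ico k n, K.bond (2 * l + 1) ∈ H := fun k hk => by
    rcases hk.lt_or_eq with hk | rfl
    · have := hm (.inr ⟨k, hk⟩)
      rwa [modePair_inr, ← K.isum_odd_bonds hk.le] at this
    · simp
  have even : ∀ k < n, K.bond (2 * k) ∈ H := fun k hk => by
    have := hm (.inl ⟨k, hk⟩)
    rwa [modePair_inl] at this
  rcases Nat.even_or_odd' j with ⟨k, rfl | rfl⟩
  · rcases (show k ≤ n by omega).lt_or_eq with hk | rfl
    · exact even k hk
    · rw [zeroPair_eq, Finset.sum_range_succ] at h0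
      exact (AddSubgroup.add_mem_cancel_left _
        (AddSubgroup.sum_mem _ fun l hl => even l (Finset.mem_range.1 hl))).1 h0
  · have hk : k < n := by omega
    have := tail k hk.le
    rw [Finset.sum_eq_sum_Ico_succ_bot hk] at this
    exact (AddSubgroup.add_mem_cancel_right _ (tail (k + 1) hk)).1 this

theorem last_f : K.f (2 * n + 1) + K.f 0 = K.block.r - isum K.f 1 (2 * n + 1) := by
  show _ = isum K.f 0 (2 * n + 2) - _
  rw [isum_succ_right _ (by omega), ← isum_add K.f zero_le_one (by omega : 1 ≤ 2 * n + 1),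
    show isum K.f 0 1 = K.f 0 from isum_succ K.f 0]
  abel

theorem last_fd : K.fd (2 * n + 1) + K.fd 0 = K.block.dq - isum K.fd 1 (2 * n + 1) := by
  show _ = isum K.fd 0 (2 * n + 2) - _
  rw [isum_succ_right _ (by omega), ← isum_add K.fd zero_le_one (by omega : 1 ≤ 2 * n + 1),
    show isum K.fd 0 1 = K.fd 0 from isum_succ K.fd 0]
  abel

theorem tlSet_subset {C : Subalgebra ℂ A} (h : K.block.lieSet ⊆ C) : K.tlSet ⊆ C := by
  have hrdq : K.block.r * K.block.dq ∈ C := h (.inl rfl)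
  have hud : ∀ i, K.block.u i * K.block.dq ∈ C := fun i => h (.inr (.inl ⟨i, rfl⟩))
  have hrd : ∀ i, K.block.r * K.block.d i ∈ C := fun i => h (.inr (.inr (.inl ⟨i, rfl⟩)))
  have hX : ∀ i j, K.block.X i j ∈ C := fun i j => h (.inr (.inr (.inr ⟨i, j, rfl⟩)))
  have hrds : ∀ i, K.block.r * K.block.ds i ∈ C := fun i => by
    rw [SymplecticModes.ds, mul_smul_comm]
    exact C.smul_mem (hrd _) _
  have cross : ∀ i, K.block.r * -K.block.ds i + K.block.u i * K.block.dq ∈ C := fun i => by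
    rw [mul_neg]
    exact C.add_mem (C.neg_mem (hrds i)) (hud i)
  have hC : ∀ p ∈ insert K.zeroPair (Set.range K.modePair),
      ∀ p' ∈ insert K.zeroPair (Set.range K.modePair),
      p.1 * p'.2 + p'.1 * p.2 ∈ C.toSubmodule.toAddSubgroup := by
    rintro p (rfl | ⟨i, rfl⟩) p' (rfl | ⟨j, rfl⟩)
    · exact C.add_mem hrdq hrdq
    · exact cross j
    · rw [add_comm]; exact cross i
    · have := C.neg_mem (hX i j)
      rw [SymplecticModes.X, neg_add, ← mul_neg, ← mul_neg] at this
      exact this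
  rintro x (⟨j, hj, rfl⟩ | rfl)
  · have := mem_of_add_self_mem (C := C) (symm_mem_of_closure hC (K.bond_mem hj) (K.bond_mem hj))
    have := C.mul_mem (C.pow_mem (C.neg_mem C.one_mem) j) this
    rw [bond, ← mul_assoc, ← mul_assoc, ((Commute.neg_one_left (isum K.f j (j + 2))).pow_left j).eq,
      mul_assoc, mul_assoc, ← mul_assoc ((-1) ^ j), ← pow_add, Even.neg_one_pow ⟨j, rfl⟩, one_mul,
      isum_two, isum_two] at this
    exact this
  · rw [last_f, last_fd]
    rcases Nat.eq_zero_or_pos n with rfl | hn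
    · simpa [isum_self] using hrdq
    · have e : (isum K.f 1 (2 * n + 1), -isum K.fd 1 (2 * n + 1)) = K.modePair (.inr ⟨0, hn⟩) :=
        (K.modePair_inr ⟨0, hn⟩).symm
      obtain ⟨e1, e2⟩ := Prod.mk.inj e
      rw [neg_inj] at e2
      rw [e1, e2]
      have hXX := mem_of_add_self_mem (C := C) (hX (.inr ⟨0, hn⟩) (.inr ⟨0, hn⟩))
      rw [SetLike.mem_coe]
      convert C.add_mem (C.sub_mem (C.sub_mem hrdq (hrds (.inr ⟨0, hn⟩)))
        (hud (.inr ⟨0, hn⟩))) hXX using 1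
      noncomm_ring

theorem lieSet_subset {C : Subalgebra ℂ A} (h : K.tlSet ⊆ C) : K.block.lieSet ⊆ C := by
  have hbond : ∀ j < 2 * n + 1, (K.bond j).1 * (K.bond j).2 ∈ C := fun j hj => by
    have := C.mul_mem (C.pow_mem (C.neg_mem C.one_mem) j) (h (.inl ⟨j, hj, rfl⟩))
    rw [bond, ← mul_assoc, ← ((Commute.neg_one_left (isum K.f j (j + 2))).pow_left j).eq,
      isum_two, isum_two, mul_assoc]
    exact this
  have hsymm : ∀ i < 2 * n + 1, ∀ j < 2 * n + 1,
      (K.bond i).1 * (K.bond j).2 + (K.bond j).1 * (K.bond i).2 ∈ C := by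
    intro i hi j hj
    refine symm_mem_of_chain (a := fun j => (K.bond j).1) (b := fun j => (K.bond j).2)
      (fun i j => isum_anticomm K.ff _ _ _ _) (fun i j => ?_) (fun i hi j hj => ?_) hbond hi hj
    · rcases Nat.even_or_odd i with hi | hi <;> rcases Nat.even_or_odd j with hj | hj <;>
        simp [bond, hi.neg_one_pow, hj.neg_one_pow, isum_anticomm K.dd i (i + 2) j (j + 2)]
    · rcases Nat.even_or_odd i with he | he
      · have hp : pairing i (i + 2) j (j + 2)
            = if j = i + 1 then 1 else if i = j + 1 then -1 else 0 := by
          rw [Nat.even_iff] at he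
          rw [pairing]; split_ifs <;> omega
        simp only [bond, he.neg_one_pow, one_mul]
        rw [K.isum_fd_mul_isum_f_eq hp (by omega)]
        split_ifs <;> simp
      · have hp : pairing i (i + 2) j (j + 2)
            = if j = i + 1 then -1 else if i = j + 1 then 1 else 0 := by
          rw [Nat.odd_iff] at he
          rw [pairing]; split_ifs <;> omega
        simp only [bond, he.neg_one_pow, neg_mul, one_mul, mul_neg]
        rw [K.isum_fd_mul_isum_f_eq hp (by omega)]
        split_ifs <;> simp <;> abel
  have hC : ∀ p ∈ K.bond '' Set.Iio (2 * n + 1), ∀ p' ∈ K.bond '' Set.Iio (2 * n + 1),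
      p.1 * p'.2 + p'.1 * p.2 ∈ C.toSubmodule.toAddSubgroup := by
    rintro _ ⟨i, hi, rfl⟩ _ ⟨j, hj, rfl⟩
    exact hsymm i hi j hj
  have hrdq : K.block.r * K.block.dq ∈ C :=
    mem_of_add_self_mem (symm_mem_of_closure hC K.zeroPair_mem K.zeroPair_mem)
  have hX : ∀ i j, K.block.X i j ∈ C := fun i j => by
    have := C.neg_mem (symm_mem_of_closure hC (K.modePair_mem i) (K.modePair_mem j))
    simpa [modePair, SymplecticModes.X, mul_neg, add_comm] using this
  have cross : ∀ i, K.block.r * -K.block.ds i + K.block.u i * K.block.dq ∈ C := fun i =>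
    symm_mem_of_closure hC K.zeroPair_mem (K.modePair_mem i)
  have hud : ∀ i, K.block.u i * K.block.dq ∈ C := fun i => by
    have hn : 0 < n := by rcases i with k | k <;> exact k.pos
    have hlast : (K.block.r - K.block.u (.inr ⟨0, hn⟩))
        * (K.block.dq - K.block.ds (.inr ⟨0, hn⟩)) ∈ C := by
      have := h (.inr rfl)
      have e : (isum K.f 1 (2 * n + 1), -isum K.fd 1 (2 * n + 1)) = K.modePair (.inr ⟨0, hn⟩) :=
        (K.modePair_inr ⟨0, hn⟩).symm
      obtain ⟨e1, e2⟩ := Prod.mk.inj e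
      rw [neg_inj] at e2
      rwa [last_f, last_fd, e1, e2] at this
    have h0 : K.block.u (.inr ⟨0, hn⟩) * K.block.dq ∈ C := by
      refine mem_of_add_self_mem ?_
      have hXX := mem_of_add_self_mem (C := C) (hX (.inr ⟨0, hn⟩) (.inr ⟨0, hn⟩))
      convert C.sub_mem (C.add_mem (C.add_mem (cross (.inr ⟨0, hn⟩)) hrdq) hXX) hlast using 1
      noncomm_ring
    have hσ : K.block.σ (.inr ⟨0, hn⟩) = .inl ⟨0, hn⟩ := rfl
    have hε : K.block.ε (.inl ⟨0, hn⟩) = -1 := rfl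
    have hbr := C.sub_mem (C.mul_mem (hX i (.inl ⟨0, hn⟩)) h0) (C.mul_mem h0 (hX i (.inl ⟨0, hn⟩)))
    have hXu := K.block.X_u i (.inl ⟨0, hn⟩) (.inr ⟨0, hn⟩)
    have hXq := K.block.odd_dq.X i (.inl ⟨0, hn⟩)
    rw [hσ, if_pos rfl, hε] at hXu
    by_cases hi : i = .inl ⟨0, hn⟩
    · rw [if_pos hi, hi, hε] at hXu
      rw [hi] at hXq hbr ⊢
      refine mem_of_add_self_mem ?_
      convert C.neg_mem hbr using 1
      simp only [map_neg, map_one] at hXu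
      linear_combination (norm := noncomm_ring) hXu * K.block.dq
        - K.block.u (.inr ⟨0, hn⟩) * hXq
    · rw [if_neg hi] at hXu
      convert C.neg_mem hbr using 1
      simp only [map_neg, map_one] at hXu
      linear_combination (norm := noncomm_ring) hXu * K.block.dq
        - K.block.u (.inr ⟨0, hn⟩) * hXq
  have hrds : ∀ i, K.block.r * K.block.ds i ∈ C := fun i => by
    convert C.sub_mem (hud i) (cross i) using 1
    noncomm_ring
  rintro x (rfl | ⟨i, rfl⟩ | ⟨i, rfl⟩ | ⟨i, j, rfl⟩)
  · exact hrdq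
  · exact hud i
  · have := C.smul_mem (hrds (K.block.σ i)) (K.block.ε (K.block.σ i))
    rwa [SymplecticModes.ds, mul_smul_comm, smul_smul, K.block.εε, one_smul, K.block.σσ] at this
  · exact hX i j

theorem centralizer_tlSet :
    Subalgebra.centralizer ℂ K.tlSet = Subalgebra.centralizer ℂ K.block.lieSet := by
  ext T
  have key : ∀ S : Set A, T ∈ Subalgebra.centralizer ℂ S ↔
      S ⊆ (Subalgebra.centralizer ℂ {T} : Subalgebra ℂ A) := fun S => by
    rw [Subalgebra.mem_centralizer_iff]
    refine forall₂_congr fun x _ => ?_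
    rw [SetLike.mem_coe, Subalgebra.mem_centralizer_iff]
    simp [eq_comm]
  rw [key, key]
  exact ⟨K.lieSet_subset, K.tlSet_subset⟩

end Chain

section ListProducts

variable {I A : Type*} [Ring A] {g h : I → A}

theorem mul_list_prod_of_anticomm {x : A} {l : List I} (hx : ∀ i ∈ l, x * g i = -(g i * x)) :
    x * (l.map g).prod = (-1) ^ l.length * ((l.map g).prod * x) := by
  induction l with
  | nil => simp
  | cons a l ih =>
    have h1 := hx a List.mem_cons_self
    have h2 := ih fun i hi => hx i (List.mem_cons_of_mem _ hi)
    rw [List.map_cons, List.prod_cons, List.length_cons, ← mul_assoc, h1, neg_mul, mul_assoc, h2,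
      pow_succ, ← mul_assoc (g a), ← ((Commute.neg_one_left (g a)).pow_left l.length).eq]
    noncomm_ring

variable [Algebra ℂ A]

theorem mul_list_prod_eq_zero (hg : ∀ i j, g i * g j = -(g j * g i)) {l : List I} {j : I}
    (hj : j ∈ l) : g j * (l.map g).prod = 0 := by
  induction l with
  | nil => simp at hj
  | cons a l ih =>
    rw [List.map_cons, List.prod_cons]
    rcases List.mem_cons.1 hj with rfl | hj
    · rw [← mul_assoc, eq_zero_of_eq_neg (hg j j), zero_mul]
    · rw [← mul_assoc, hg, neg_mul, mul_assoc, ih hj, mul_zero, neg_zero]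

theorem list_prod_mul_eq_zero (hg : ∀ i j, g i * g j = -(g j * g i)) {l : List I} {j : I}
    (hj : j ∈ l) : (l.map g).prod * g j = 0 := by
  have h := mul_list_prod_eq_zero hg hj
  rw [mul_list_prod_of_anticomm fun i _ => hg j i] at h
  rw [← one_mul ((l.map g).prod * g j), ← Even.neg_one_pow ⟨l.length, rfl⟩, pow_add, mul_assoc, h,
    mul_zero]

theorem list_prod_mul_list_prod_cons {a : I} {l : List I} (ha : a ∉ l)
    (hgh : ∀ j, a ≠ j → h a * g j = -(g j * h a)) : ((a :: l).map g).prod * ((a :: l).map h).prod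
      = (-1 : ℂ) ^ l.length • (g a * h a * ((l.map g).prod * (l.map h).prod)) := by
  have e := mul_list_prod_of_anticomm (g := g) (x := h a) (l := l)
    fun i hi => hgh i fun h' => ha (h' ▸ hi)
  have e' : (l.map g).prod * h a = (-1) ^ l.length * (h a * (l.map g).prod) := by
    rw [e, ← mul_assoc, ← pow_add, Even.neg_one_pow ⟨l.length, rfl⟩, one_mul]
  have e1 : ((-1 : ℂ) ^ l.length • (1 : A)) = (-1) ^ l.length := by
    rcases Nat.even_or_odd l.length with hl | hl <;> simp [hl.neg_one_pow]
  rw [← one_mul (g a * h a * _), ← smul_mul_assoc, e1, List.map_cons, List.map_cons, List.prod_cons,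
    List.prod_cons, mul_assoc (g a), ← mul_assoc _ (h a), e', ← mul_assoc, ← mul_assoc (g a),
    ← ((Commute.neg_one_left (g a)).pow_left l.length).eq]
  simp only [mul_assoc]

/-- The product of all raising and all lowering operators is invertible on the left top vectors. -/
theorem exists_smul_of_mul_eq_zero {s : I → ℂ} (hs : ∀ i, s i ≠ 0) {l : List I}
    (hgh : ∀ i ∈ l, ∀ j, i ≠ j → h i * g j = -(g j * h i))
    (hs' : ∀ i ∈ l, g i * h i + h i * g i = s i • 1)
    (hl : l.Nodup) {S : A} (hS : ∀ i ∈ l, g i * S = 0) :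
    ∃ c : ℂ, c ≠ 0 ∧ (l.map g).prod * (l.map h).prod * S = c • S := by
  induction l with
  | nil => exact ⟨1, one_ne_zero, by simp⟩
  | cons a l ih =>
    obtain ⟨ha, hl⟩ := List.nodup_cons.1 hl
    obtain ⟨c, hc, e⟩ := ih (fun i hi => hgh i (List.mem_cons_of_mem _ hi))
      (fun i hi => hs' i (List.mem_cons_of_mem _ hi)) hl
      fun i hi => hS i (List.mem_cons_of_mem _ hi)
    refine ⟨(-1) ^ l.length * c * s a,
      mul_ne_zero (mul_ne_zero (pow_ne_zero _ (by norm_num)) hc) (hs a), ?_⟩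
    have h0 : g a * h a * S = s a • S := by
      rw [eq_sub_of_add_eq (hs' a List.mem_cons_self), sub_mul, mul_assoc (h a),
        hS a List.mem_cons_self, mul_zero, sub_zero, smul_one_mul]
    rw [list_prod_mul_list_prod_cons ha (hgh a List.mem_cons_self), smul_mul_assoc,
      mul_assoc (g a * h a), e,
      mul_smul_comm, h0, smul_smul, smul_smul]

/-- The product of all raising and all lowering operators is invertible on the right top vectors. -/
theorem exists_smul_of_mul_eq_zero' {s : I → ℂ} (hs : ∀ i, s i ≠ 0) {l : List I}
    (hgh : ∀ i ∈ l, ∀ j, i ≠ j → h i * g j = -(g j * h i))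
    (hs' : ∀ i ∈ l, g i * h i + h i * g i = s i • 1)
    (hl : l.Nodup) {S : A} (hS : ∀ i ∈ l, S * h i = 0) :
    ∃ c : ℂ, c ≠ 0 ∧ S * ((l.map g).prod * (l.map h).prod) = c • S := by
  induction l with
  | nil => exact ⟨1, one_ne_zero, by simp⟩
  | cons a l ih =>
    obtain ⟨ha, hl⟩ := List.nodup_cons.1 hl
    obtain ⟨c, hc, e⟩ := ih (fun i hi => hgh i (List.mem_cons_of_mem _ hi))
      (fun i hi => hs' i (List.mem_cons_of_mem _ hi)) hl
      fun i hi => hS i (List.mem_cons_of_mem _ hi)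
    refine ⟨(-1) ^ l.length * s a * c,
      mul_ne_zero (mul_ne_zero (pow_ne_zero _ (by norm_num)) (hs a)) hc, ?_⟩
    have h0 : S * (g a * h a) = s a • S := by
      rw [eq_sub_of_add_eq (hs' a List.mem_cons_self), mul_sub, ← mul_assoc,
        hS a List.mem_cons_self, zero_mul, sub_zero, mul_smul_comm, mul_one]
    rw [list_prod_mul_list_prod_cons ha (hgh a List.mem_cons_self), mul_smul_comm,
      ← mul_assoc S, h0, smul_mul_assoc, e,
      smul_smul, smul_smul]

end ListProducts

theorem mul_pow_eq_mul_pow {A : Type*} [Ring A] {r x y : A} (h : r * x = r * y) (hc : Commute r y)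
    (k : ℕ) : r * x ^ k = r * y ^ k := by
  induction k with
  | zero => rw [pow_zero, pow_zero]
  | succ k ih =>
    rw [pow_succ, ← mul_assoc, ih, (hc.pow_right k).eq, mul_assoc, h, ← mul_assoc,
      ← (hc.pow_right k).eq, mul_assoc, ← pow_succ]

section RangeSums

variable {A : Type*} [Ring A]

theorem esum_one_range (g : ℕ → A) (m : ℕ) : esum g (Finset.range m) 1 = isum g 0 m := by
  rw [esum_one, isum, Finset.range_eq_Ico]

theorem isum_mul_eq_zero {g : ℕ → A} {S : A} {m : ℕ} (h : ∀ j < m, g j * S = 0) {a b : ℕ}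
    (hb : b ≤ m) : isum g a b * S = 0 := by
  rw [isum, Finset.sum_mul]
  exact Finset.sum_eq_zero fun j hj => h j ((Finset.mem_Ico.1 hj).2.trans_le hb)

theorem mul_isum_eq_zero {g : ℕ → A} {S : A} {m : ℕ} (h : ∀ j < m, S * g j = 0) {a b : ℕ}
    (hb : b ≤ m) : S * isum g a b = 0 := by
  rw [isum, Finset.mul_sum]
  exact Finset.sum_eq_zero fun j hj => h j ((Finset.mem_Ico.1 hj).2.trans_le hb)

theorem esum_top (g : ℕ → A) (m : ℕ) :
    esum g (Finset.range m) m = (((Finset.range m).sort (· ≤ ·)).map g).prod := by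
  have h := esum_card g (Finset.range m)
  rwa [Finset.card_range] at h

end RangeSums

namespace Chain

variable {n : ℕ} {A : Type*} [Ring A] [Algebra ℂ A] (K : Chain n A)

theorem block_om : K.block.om = (2 : ℂ) • ∑ k ∈ Finset.range n,
    isum K.f (2 * k) (2 * k + 2) * isum K.f (2 * k + 1) (2 * n + 1) := by
  have h1 : ∀ k : Fin n, K.block.us (.inl k) * K.block.u (.inl k)
      = isum K.f (2 * k) (2 * k + 2) * isum K.f (2 * k + 1) (2 * n + 1) := fun k => by
    show (-1 : ℂ) • isum K.f (2 * k + 1) (2 * n + 1) * isum K.f (2 * k) (2 * k + 2) = _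
    rw [isum_anticomm K.ff (2 * k), neg_one_smul, neg_mul]
  have h2 : ∀ k : Fin n, K.block.us (.inr k) * K.block.u (.inr k)
      = isum K.f (2 * k) (2 * k + 2) * isum K.f (2 * k + 1) (2 * n + 1) := fun k => by
    show (1 : ℂ) • isum K.f (2 * k) (2 * k + 2) * isum K.f (2 * k + 1) (2 * n + 1) = _
    rw [one_smul]
  rw [SymplecticModes.om, Fintype.sum_sum_type, Finset.sum_congr rfl fun k _ => h1 k,
    Finset.sum_congr rfl fun k _ => h2 k, Finset.sum_range, two_smul]

theorem block_la : K.block.la = (2 : ℂ) • ∑ k ∈ Finset.range n,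
    isum K.fd (2 * k) (2 * k + 2) * isum K.fd (2 * k + 1) (2 * n + 1) := by
  have h1 : ∀ k : Fin n, K.block.d (.inl k) * K.block.ds (.inl k)
      = isum K.fd (2 * k) (2 * k + 2) * isum K.fd (2 * k + 1) (2 * n + 1) := fun k => by
    show isum K.fd (2 * k + 1) (2 * n + 1) * (-1 : ℂ) • isum K.fd (2 * k) (2 * k + 2) = _
    rw [isum_anticomm K.dd (2 * k), neg_one_smul, mul_neg]
  have h2 : ∀ k : Fin n, K.block.d (.inr k) * K.block.ds (.inr k)
      = isum K.fd (2 * k) (2 * k + 2) * isum K.fd (2 * k + 1) (2 * n + 1) := fun k => by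
    show isum K.fd (2 * k) (2 * k + 2) * (1 : ℂ) • isum K.fd (2 * k + 1) (2 * n + 1) = _
    rw [one_smul]
  rw [SymplecticModes.la, Fintype.sum_sum_type, Finset.sum_congr rfl fun k _ => h1 k,
    Finset.sum_congr rfl fun k _ => h2 k, Finset.sum_range, two_smul]

theorem two_pow_mul_factorial_ne_zero (k : ℕ) : (2 ^ k * k.factorial : ℂ) ≠ 0 :=
  mul_ne_zero (pow_ne_zero _ two_ne_zero) (Nat.cast_ne_zero.2 k.factorial_ne_zero)

theorem r_mul_om_pow (k : ℕ) : K.block.r * K.block.om ^ k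
    = (2 ^ k * k.factorial : ℂ) • esum K.f (Finset.range (2 * n + 2)) (2 * k + 1) := by
  have h : K.block.r * K.block.om
      = K.block.r * ((2 : ℂ) • esum K.f (Finset.range (2 * n + 2)) 2) := by
    rw [esum_two_range K.ff, smul_add, mul_add, ← block_om, mul_smul_comm, ← mul_assoc,
      show isum K.f 0 (2 * n + 2) = K.block.r from rfl, K.block.rr, zero_mul, smul_zero, zero_add]
  rw [← mul_pow_eq_mul_pow h.symm K.block.odd_r.om, smul_pow, mul_smul_comm,
    show K.block.r = isum K.f 0 (2 * n + 2) from rfl, ← esum_one_range, factorial_mul_esum K.ff,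
    ← nsmul_eq_mul, ← Nat.cast_smul_eq_nsmul ℂ, smul_smul]

theorem dq_mul_la_pow (k : ℕ) : K.block.dq * K.block.la ^ k
    = (2 ^ k * k.factorial : ℂ) • esum K.fd (Finset.range (2 * n + 2)) (2 * k + 1) := by
  have h : K.block.dq * K.block.la
      = K.block.dq * ((2 : ℂ) • esum K.fd (Finset.range (2 * n + 2)) 2) := by
    rw [esum_two_range K.dd, smul_add, mul_add, ← block_la, mul_smul_comm, ← mul_assoc,
      show isum K.fd 0 (2 * n + 2) = K.block.dq from rfl, K.block.dqdq, zero_mul, smul_zero,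
      zero_add]
  rw [← mul_pow_eq_mul_pow h.symm K.block.odd_dq.la, smul_pow, mul_smul_comm,
    show K.block.dq = isum K.fd 0 (2 * n + 2) from rfl, ← esum_one_range, factorial_mul_esum K.dd,
    ← nsmul_eq_mul, ← Nat.cast_smul_eq_nsmul ℂ, smul_smul]

theorem block_Nh : K.block.Nh
    = ∑ j ∈ Finset.range (2 * n + 2), (-1) ^ (j + 1) * (K.f j * K.fd j) := by
  rw [← number_eq, BlockModes.Nh, SymplecticModes.num, Fintype.sum_sum_type, Finset.sum_range,
    Finset.sum_range, ← mul_neg, ← isum_succ K.f (2 * n + 1)]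
  rfl

theorem f_mul_eq_zero {S : A} (h : K.block.HighL S) {j : ℕ} (hj : j < 2 * n + 2) :
    K.f j * S = 0 := by
  refine mem_of_isum_mem K.f (AddMonoidHom.mulRight S).ker h.r ?_ (fun k hk => h.u (.inl ⟨k, hk⟩))
    (fun k hk => h.u (.inr ⟨k, hk⟩)) hj
  have e : isum K.f 0 (2 * n + 1) = K.block.r - K.block.q := by
    show _ = isum K.f 0 (2 * n + 2) - isum K.f (2 * n + 1) (2 * n + 2)
    rw [← isum_add K.f (Nat.zero_le (2 * n + 1)) (by omega : _ ≤ 2 * n + 2), add_sub_cancel_right]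
  show _ * S = 0
  rw [e, sub_mul, h.r, h.q, sub_zero]

theorem mul_f_eq_zero {S : A} (h : K.block.LowR S) {j : ℕ} (hj : j < 2 * n + 2) :
    S * K.f j = 0 := by
  refine mem_of_isum_mem K.f (AddMonoidHom.mulLeft S).ker h.r ?_ (fun k hk => h.u (.inl ⟨k, hk⟩))
    (fun k hk => h.u (.inr ⟨k, hk⟩)) hj
  have e : isum K.f 0 (2 * n + 1) = K.block.r - K.block.q := by
    show _ = isum K.f 0 (2 * n + 2) - isum K.f (2 * n + 1) (2 * n + 2)
    rw [← isum_add K.f (Nat.zero_le (2 * n + 1)) (by omega : _ ≤ 2 * n + 2), add_sub_cancel_right]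
  show S * _ = 0
  rw [e, mul_sub, h.r, h.q, sub_zero]

theorem fd_mul_eq_zero {S : A} (h : K.block.LowL S) {j : ℕ} (hj : j < 2 * n + 2) :
    K.fd j * S = 0 :=
  mem_of_isum_mem K.fd (AddMonoidHom.mulRight S).ker h.dq
    (by have := h.dr; rwa [show K.block.dr = -isum K.fd 0 (2 * n + 1) from rfl, neg_mul,
      neg_eq_zero] at this)
    (fun k hk => h.d (.inr ⟨k, hk⟩)) (fun k hk => h.d (.inl ⟨k, hk⟩)) hj

theorem mul_fd_eq_zero {S : A} (h : K.block.HighR S) {j : ℕ} (hj : j < 2 * n + 2) :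
    S * K.fd j = 0 :=
  mem_of_isum_mem K.fd (AddMonoidHom.mulLeft S).ker h.dq
    (by have := h.dr; rwa [show K.block.dr = -isum K.fd 0 (2 * n + 1) from rfl, mul_neg,
      neg_eq_zero] at this)
    (fun k hk => h.d (.inr ⟨k, hk⟩)) (fun k hk => h.d (.inl ⟨k, hk⟩)) hj

theorem vacUnique : K.block.full.VacUnique := by
  intro T T' h h' hT'
  obtain ⟨h1, h2⟩ := BlockModes.isVac_full_iff.1 h
  obtain ⟨h1', h2'⟩ := BlockModes.isVac_full_iff.1 h'
  exact K.vac T T' (fun _ => K.fd_mul_eq_zero h1) (fun _ => K.mul_f_eq_zero h2)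
    (fun _ => K.fd_mul_eq_zero h1') (fun _ => K.mul_f_eq_zero h2') hT'

theorem highL_of {S : A} (h : ∀ j < 2 * n + 2, K.f j * S = 0) : K.block.HighL S := by
  refine ⟨isum_mul_eq_zero h le_rfl, isum_mul_eq_zero h le_rfl, ?_⟩
  rintro (k | k) <;> exact isum_mul_eq_zero h (by omega)

theorem lowR_of {S : A} (h : ∀ j < 2 * n + 2, S * K.f j = 0) : K.block.LowR S := by
  refine ⟨mul_isum_eq_zero h le_rfl, mul_isum_eq_zero h le_rfl, ?_⟩
  rintro (k | k) <;> exact mul_isum_eq_zero h (by omega)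

theorem lowL_of {S : A} (h : ∀ j < 2 * n + 2, K.fd j * S = 0) : K.block.LowL S := by
  refine ⟨?_, isum_mul_eq_zero h le_rfl, ?_⟩
  · show -isum K.fd 0 (2 * n + 1) * S = 0
    rw [neg_mul, isum_mul_eq_zero h (by omega), neg_zero]
  · rintro (k | k) <;> exact isum_mul_eq_zero h (by omega)

theorem highR_of {S : A} (h : ∀ j < 2 * n + 2, S * K.fd j = 0) : K.block.HighR S := by
  refine ⟨?_, mul_isum_eq_zero h le_rfl, ?_⟩
  · show S * -isum K.fd 0 (2 * n + 1) = 0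
    rw [mul_neg, mul_isum_eq_zero h (by omega), neg_zero]
  · rintro (k | k) <;> exact mul_isum_eq_zero h (by omega)

theorem mul_esum_top {g : ℕ → A} (hg : ∀ i j, g i * g j = -(g j * g i)) {m j : ℕ} (hj : j < m) :
    g j * esum g (Finset.range m) m = 0 := by
  rw [esum_top]
  exact mul_list_prod_eq_zero hg (by simpa using hj)

theorem esum_top_mul {g : ℕ → A} (hg : ∀ i j, g i * g j = -(g j * g i)) {m j : ℕ} (hj : j < m) :
    esum g (Finset.range m) m * g j = 0 := by
  rw [esum_top]
  exact list_prod_mul_eq_zero hg (by simpa using hj)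

theorem fd_f_of_ne {i j : ℕ} (hi : i < 2 * n + 2) (hij : i ≠ j) :
    K.fd i * K.f j = -(K.f j * K.fd i) := by
  rw [K.df i j hi, if_neg hij, zero_sub]

theorem f_fd_self {i : ℕ} (hi : i < 2 * n + 2) :
    K.f i * K.fd i + K.fd i * K.f i = ((-1) ^ (i + 1) : ℂ) • 1 := by
  rw [K.df i i hi, if_pos rfl, add_sub_cancel]
  rcases Nat.even_or_odd (i + 1) with h | h <;> simp [h.neg_one_pow]

/-- Double commutant form of the main result for an abstract chain. -/
theorem centralizer_eq_adjoin {Z : A} {a : ℂ} (hZ : K.block.Nh = a • 1 - Z) :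
    Subalgebra.centralizer ℂ K.tlSet = Algebra.adjoin ℂ
      {T | (∃ k < n + 1, T = esum K.f (Finset.range (2 * n + 2)) (2 * k + 1)) ∨
        (∃ k < n + 1, T = esum K.fd (Finset.range (2 * n + 2)) (2 * k + 1)) ∨
        T = esum K.f (Finset.range (2 * n + 2)) (2 * n + 2) ∨
        T = esum K.fd (Finset.range (2 * n + 2)) (2 * n + 2) ∨ T = Z} := by
  rw [centralizer_tlSet]
  set G : Set A := _
  show _ = Algebra.adjoin ℂ G
  set P := esum K.f (Finset.range (2 * n + 2)) (2 * n + 2)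
  set Q := esum K.fd (Finset.range (2 * n + 2)) (2 * n + 2)
  have hZ' : Z = a • 1 - K.block.Nh := by rw [hZ, sub_sub_cancel]
  apply le_antisymm
  · have hr : ∀ k, K.block.r * K.block.om ^ k ∈ Algebra.adjoin ℂ G := fun k => by
      rw [r_mul_om_pow]
      refine Subalgebra.smul_mem _ ?_ _
      by_cases hk : k < n + 1
      · exact Algebra.subset_adjoin (.inl ⟨k, hk, rfl⟩)
      · rw [esum_eq_zero _ (by rw [Finset.card_range]; omega)]
        exact Subalgebra.zero_mem _
    have hd : ∀ k, K.block.dq * K.block.la ^ k ∈ Algebra.adjoin ℂ G := fun k => by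
      rw [dq_mul_la_pow]
      refine Subalgebra.smul_mem _ ?_ _
      by_cases hk : k < n + 1
      · exact Algebra.subset_adjoin (.inr (.inl ⟨k, hk, rfl⟩))
      · rw [esum_eq_zero _ (by rw [Finset.card_range]; omega)]
        exact Subalgebra.zero_mem _
    have hN : K.block.Nh ∈ Algebra.adjoin ℂ G := by
      rw [hZ]
      exact Subalgebra.sub_mem _ (Subalgebra.smul_mem _ (Subalgebra.one_mem _) _)
        (Algebra.subset_adjoin (.inr (.inr (.inr (.inr rfl)))))
    have hl : ∀ {i}, i ∈ (Finset.range (2 * n + 2)).sort (· ≤ ·) → i < 2 * n + 2 := fun hi => by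
      simpa using hi
    refine BlockModes.Good.centralizer_le K.vacUnique (BlockModes.Good.of_tops K.vacUnique hr hd hN
      (P := P) (Q := Q) (Algebra.subset_adjoin (.inr (.inr (.inl rfl))))
      (Algebra.subset_adjoin (.inr (.inr (.inr (.inl rfl)))))
      (K.lowR_of fun j => esum_top_mul K.ff) (K.lowL_of fun j => mul_esum_top K.dd)
      (fun S hS => ?_) fun S hS => ?_)
    · simp only [P, Q, esum_top]
      exact exists_smul_of_mul_eq_zero (s := fun i => (-1) ^ (i + 1))
        (fun i => pow_ne_zero _ (by norm_num)) (fun i hi j => K.fd_f_of_ne (hl hi))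
        (fun i hi => K.f_fd_self (hl hi)) (Finset.sort_nodup _ _)
        fun i hi => K.f_mul_eq_zero hS (hl hi)
    · simp only [P, Q, esum_top]
      exact exists_smul_of_mul_eq_zero' (s := fun i => (-1) ^ (i + 1))
        (fun i => pow_ne_zero _ (by norm_num)) (fun i hi j => K.fd_f_of_ne (hl hi))
        (fun i hi => K.f_fd_self (hl hi)) (Finset.sort_nodup _ _)
        fun i hi => K.mul_fd_eq_zero hS (hl hi)
  · refine Algebra.adjoin_le ?_
    rintro T (⟨k, -, rfl⟩ | ⟨k, -, rfl⟩ | rfl | rfl | rfl)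
    · have := Subalgebra.smul_mem _ (BlockModes.comm_iff.1 (BlockModes.comm_r_om (M := K.block) k))
        (2 ^ k * k.factorial : ℂ)⁻¹
      rwa [r_mul_om_pow, inv_smul_smul₀ (two_pow_mul_factorial_ne_zero k)] at this
    · have := Subalgebra.smul_mem _ (BlockModes.comm_iff.1 (BlockModes.comm_dq_la (M := K.block) k))
        (2 ^ k * k.factorial : ℂ)⁻¹
      rwa [dq_mul_la_pow, inv_smul_smul₀ (two_pow_mul_factorial_ne_zero k)] at this
    · exact BlockModes.comm_iff.1 (BlockModes.comm_of_highL_lowR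
        (K.highL_of fun j => mul_esum_top K.ff) (K.lowR_of fun j => esum_top_mul K.ff))
    · exact BlockModes.comm_iff.1 (BlockModes.comm_of_lowL_highR
        (K.lowL_of fun j => mul_esum_top K.dd) (K.highR_of fun j => esum_top_mul K.dd))
    · rw [hZ']
      exact Subalgebra.sub_mem _ (Subalgebra.smul_mem _ (Subalgebra.one_mem _) _)
        (BlockModes.comm_iff.1 BlockModes.comm_Nh)

end Chain

section Sites

variable {N : ℕ}

theorem site_mulVec (a : Matrix (Fin 2) (Fin 2) ℂ) (j : Fin N) (v : V N) (x : Fin N → Fin 2) :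
    (site N a j *ᵥ v) x = ∑ t, a (x j) t * v (Function.update x j t) := by
  symm
  refine Finset.sum_of_injOn (Function.update x j)
    ((Function.update_injective x j).injOn) (by simp) (fun y _ hy => ?_) fun t _ => ?_
  · have : ∃ k, k ≠ j ∧ x k ≠ y k := by
      by_contra! h
      refine hy ⟨y j, Finset.mem_coe.2 (Finset.mem_univ _), ?_⟩
      ext k
      by_cases hk : k = j
      · rw [hk, Function.update_self]
      · rw [Function.update_of_ne hk, h k hk]
    obtain ⟨k, hk, hxy⟩ := this
    show site N a j x y * v y = 0
    rw [site, of_apply, Finset.prod_eq_zero (i := k) (by simpa using hk) (if_neg hxy), mul_zero,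
      zero_mul]
  · show _ = site N a j x (Function.update x j t) * v (Function.update x j t)
    rw [site, of_apply, Function.update_self, Finset.prod_eq_one fun k hk => ?_, mul_one]
    rw [Function.update_of_ne (by simpa using hk), if_pos rfl]

theorem ext_of_mulVec {S T : Op N} (h : ∀ v x, (S *ᵥ v) x = (T *ᵥ v) x) : S = T :=
  Matrix.toLin'.injective (LinearMap.ext fun v => funext fun x => h v x)

theorem site_mul_site (a b : Matrix (Fin 2) (Fin 2) ℂ) (j : Fin N) :
    site N a j * site N b j = site N (a * b) j := by
  refine ext_of_mulVec fun v x => ?_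
  rw [← mulVec_mulVec]
  simp only [site_mulVec, Function.update_self, Function.update_idem, mul_apply, Finset.mul_sum,
    Finset.sum_mul, ← mul_assoc]
  exact Finset.sum_comm

theorem site_comm (a b : Matrix (Fin 2) (Fin 2) ℂ) {i j : Fin N} (hij : i ≠ j) :
    Commute (site N a i) (site N b j) := by
  refine ext_of_mulVec fun v x => ?_
  rw [← mulVec_mulVec, ← mulVec_mulVec]
  simp only [site_mulVec, Function.update_of_ne hij, Function.update_of_ne hij.symm,
    Finset.mul_sum]
  rw [Finset.sum_comm]
  refine Finset.sum_congr rfl fun s _ => Finset.sum_congr rfl fun t _ => ?_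
  rw [Function.update_comm hij, mul_left_comm]

theorem site_add (a b : Matrix (Fin 2) (Fin 2) ℂ) (j : Fin N) :
    site N (a + b) j = site N a j + site N b j := by
  ext x y
  simp [site, add_mul]

theorem site_smul (s : ℂ) (a : Matrix (Fin 2) (Fin 2) ℂ) (j : Fin N) :
    site N (s • a) j = s • site N a j := by
  ext x y
  simp [site, mul_assoc]

theorem site_diagonal (z : Fin 2 → ℂ) (j : Fin N) :
    site N (diagonal z) j = diagonal fun x => z (x j) := by
  refine ext_of_mulVec fun v x => ?_
  rw [site_mulVec, mulVec_diagonal]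
  simp [diagonal_apply]

theorem site_zero (j : Fin N) : site N 0 j = 0 := by
  ext x y
  simp [site]

theorem site_one (j : Fin N) : site N 1 j = 1 := by
  rw [← diagonal_one, site_diagonal, diagonal_one]

theorem string_eq (z : Fin 2 → ℂ) (j : Fin N) :
    string N z j = diagonal fun x => ∏ k ∈ Finset.univ.filter (· < j), z (x k) := by
  have h : ∀ l : List (Fin N), (l.map fun k => site N (diagonal z) k).prod
      = diagonal fun x => (l.map fun k => z (x k)).prod := fun l => by
    induction l with
    | nil => simp
    | cons k l ih =>
      rw [List.map_cons, List.prod_cons, ih, site_diagonal, diagonal_mul_diagonal]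
      simp
  rw [string, h]
  rfl

theorem diagonal_mul_site {D : (Fin N → Fin 2) → ℂ} {a : Matrix (Fin 2) (Fin 2) ℂ} {i : Fin N}
    {s : ℂ} (h : ∀ x t, D x * a (x i) t = s * (a (x i) t * D (Function.update x i t))) :
    diagonal D * site N a i = s • (site N a i * diagonal D) := by
  refine ext_of_mulVec fun v x => ?_
  rw [smul_mulVec, ← mulVec_mulVec, ← mulVec_mulVec, Pi.smul_apply, mulVec_diagonal]
  simp only [site_mulVec, mulVec_diagonal, smul_eq_mul, Finset.mul_sum]
  refine Finset.sum_congr rfl fun t _ => ?_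
  rw [← mul_assoc, h]
  ring

theorem string_mul_site_of_le (z : Fin 2 → ℂ) (a : Matrix (Fin 2) (Fin 2) ℂ) {i j : Fin N}
    (h : j ≤ i) : Commute (string N z j) (site N a i) := by
  have := diagonal_mul_site (D := fun x => ∏ k ∈ Finset.univ.filter (· < j), z (x k)) (a := a)
    (i := i) (s := 1) fun x t => by
      rw [one_mul, mul_comm]
      congr 1
      refine Finset.prod_congr rfl fun k hk => ?_
      rw [Function.update_of_ne ((Finset.mem_filter.1 hk).2.trans_le h).ne]
  rw [string_eq]
  exact this.trans (one_smul _ _)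

theorem string_mul_site_of_lt {z : Fin 2 → ℂ} {a : Matrix (Fin 2) (Fin 2) ℂ} {i j : Fin N}
    (h : i < j) (hz : ∀ s t, z s * a s t = -(a s t * z t)) :
    string N z j * site N a i = -(site N a i * string N z j) := by
  have key : ∀ (x : Fin N → Fin 2) t,
      ∏ k ∈ Finset.univ.filter (· < j), z (Function.update x i t k)
        = z t * ∏ k ∈ Finset.univ.filter (· < j) \ {i}, z (x k) := fun x t => by
    rw [← Finset.prod_update_of_mem (by simpa using h)]
    refine Finset.prod_congr rfl fun k _ => ?_
    exact Function.apply_update (fun _ => z) x i t k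
  have := diagonal_mul_site (D := fun x => ∏ k ∈ Finset.univ.filter (· < j), z (x k)) (a := a)
    (i := i) (s := -1) fun x t => by
      have h0 := key x (x i)
      rw [Function.update_eq_self] at h0
      rw [h0, key]
      linear_combination (∏ k ∈ Finset.univ.filter (· < j) \ {i}, z (x k)) * hz (x i) t
  rw [string_eq]
  exact this.trans (neg_one_smul _ _)

theorem string_comm (z w : Fin 2 → ℂ) (i j : Fin N) : Commute (string N z i) (string N w j) := by
  rw [string_eq, string_eq]
  exact commute_diagonal _ _

theorem string_mul_string {z w : Fin 2 → ℂ} (h : ∀ s, z s * w s = 1) (j : Fin N) :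
    string N z j * string N w j = 1 := by
  rw [string_eq, string_eq, diagonal_mul_diagonal, ← diagonal_one]
  congr 1
  ext x
  rw [← Finset.prod_mul_distrib]
  exact Finset.prod_eq_one fun k _ => h _

/-- The Jordan–Wigner dressing of a one-site operator. -/
def dressed (z : Fin 2 → ℂ) (a : Matrix (Fin 2) (Fin 2) ℂ) (j : Fin N) : Op N :=
  string N z j * site N a j

theorem dressed_mul_of_lt {z w : Fin 2 → ℂ} {a b : Matrix (Fin 2) (Fin 2) ℂ} {i j : Fin N}
    (h : i < j) (hw : ∀ s t, w s * a s t = -(a s t * w t)) :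
    dressed z a i * dressed w b j = -(dressed w b j * dressed z a i) := by
  have h1 := string_mul_site_of_lt h hw
  have h2 := (string_comm z w i j).eq
  have h3 := (string_mul_site_of_le z b h.le).eq
  have h4 := (site_comm a b h.ne).eq
  simp only [dressed]
  linear_combination (norm := noncomm_ring) string N z i * h1 * site N b j
    - h2 * site N a i * site N b j - string N w j * h3 * site N a i
    - string N w j * string N z i * h4

theorem dressed_mul_dressed (z w : Fin 2 → ℂ) (a b : Matrix (Fin 2) (Fin 2) ℂ) (j : Fin N) :
    dressed z a j * dressed w b j = string N z j * string N w j * site N (a * b) j := by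
  rw [dressed, dressed, ← site_mul_site, mul_assoc, ← mul_assoc (site N a j),
    ← (string_mul_site_of_le w a le_rfl).eq]
  simp only [mul_assoc]

end Sites

section Fermions

variable {N : ℕ}

theorem sigmaMinus_eq : sigmaMinus = !![0, 0; 1, 0] := by
  ext i j
  fin_cases i <;> fin_cases j <;> norm_num [sigmaMinus, sigmaX, sigmaY]

theorem sigmaPlus_eq : sigmaPlus = !![0, 1; 0, 0] := by
  ext i j
  fin_cases i <;> fin_cases j <;> norm_num [sigmaPlus, sigmaX, sigmaY]

theorem f_eq (j : Fin N) : f N j = I • dressed ![-I, I] sigmaMinus j := by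
  rw [f, c, smul_smul, pow_succ', mul_assoc, ← zpow_natCast, ← zpow_add₀ I_ne_zero, add_neg_cancel,
    zpow_zero, mul_one]
  rfl

theorem fd_eq (j : Fin N) : fd N j = (I * (-1) ^ (j : ℕ)) • dressed ![I, -I] sigmaPlus j := by
  rw [fd, cd, smul_smul, pow_succ', mul_assoc, ← mul_pow, I_mul_I]
  rfl

/-- Dressed operators anticommute at distinct sites. -/
theorem smul_dressed_anticomm {z w : Fin 2 → ℂ} {a b : Matrix (Fin 2) (Fin 2) ℂ} {i j : Fin N}
    (h : i ≠ j) (hw : ∀ s t, w s * a s t = -(a s t * w t))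
    (hz : ∀ s t, z s * b s t = -(b s t * z t)) (α β : ℂ) :
    α • dressed z a i * β • dressed w b j = -(β • dressed w b j * α • dressed z a i) := by
  have key : dressed z a i * dressed w b j = -(dressed w b j * dressed z a i) := by
    rcases h.lt_or_gt with h | h
    · exact dressed_mul_of_lt h hw
    · rw [dressed_mul_of_lt h hz, neg_neg]
  rw [smul_mul_smul_comm, smul_mul_smul_comm, key, mul_comm, smul_neg]

theorem minus_minus (s t : Fin 2) :
    ![-I, I] s * sigmaMinus s t = -(sigmaMinus s t * ![-I, I] t) := by
  rw [sigmaMinus_eq]; fin_cases s <;> fin_cases t <;> simp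

theorem plus_minus (s t : Fin 2) :
    ![I, -I] s * sigmaMinus s t = -(sigmaMinus s t * ![I, -I] t) := by
  rw [sigmaMinus_eq]; fin_cases s <;> fin_cases t <;> simp

theorem minus_plus (s t : Fin 2) :
    ![-I, I] s * sigmaPlus s t = -(sigmaPlus s t * ![-I, I] t) := by
  rw [sigmaPlus_eq]; fin_cases s <;> fin_cases t <;> simp

theorem plus_plus (s t : Fin 2) :
    ![I, -I] s * sigmaPlus s t = -(sigmaPlus s t * ![I, -I] t) := by
  rw [sigmaPlus_eq]; fin_cases s <;> fin_cases t <;> simp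

theorem dressed_sq (z w : Fin 2 → ℂ) {a : Matrix (Fin 2) (Fin 2) ℂ} (ha : a * a = 0) (α β : ℂ)
    (j : Fin N) : α • dressed z a j * β • dressed w a j = 0 := by
  rw [smul_mul_smul_comm, dressed_mul_dressed, ha, site_zero, mul_zero, smul_zero]

theorem f_anticomm (i j : Fin N) : f N i * f N j = -(f N j * f N i) := by
  rw [f_eq, f_eq]
  by_cases h : i = j
  · have h0 : sigmaMinus * sigmaMinus = 0 := by
      rw [sigmaMinus_eq]; ext s t; fin_cases s <;> fin_cases t <;> simp
    rw [h, dressed_sq _ _ h0, neg_zero]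
  · exact smul_dressed_anticomm h minus_minus minus_minus _ _

theorem fd_anticomm (i j : Fin N) : fd N i * fd N j = -(fd N j * fd N i) := by
  rw [fd_eq, fd_eq]
  by_cases h : i = j
  · have h0 : sigmaPlus * sigmaPlus = 0 := by
      rw [sigmaPlus_eq]; ext s t; fin_cases s <;> fin_cases t <;> simp
    rw [h, dressed_sq _ _ h0, neg_zero]
  · exact smul_dressed_anticomm h plus_plus plus_plus _ _

/-- The occupation number of a site. -/
def occ (j : Fin N) : Op N := diagonal fun x => (![0, 1] : Fin 2 → ℂ) (x j)

theorem f_mul_fd (j : Fin N) : f N j * fd N j = ((-1) ^ ((j : ℕ) + 1) : ℂ) • occ j := by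
  have h : sigmaMinus * sigmaPlus = diagonal ![0, 1] := by
    rw [sigmaMinus_eq, sigmaPlus_eq]; ext s t; fin_cases s <;> fin_cases t <;> simp
  rw [f_eq, fd_eq, smul_mul_smul_comm, dressed_mul_dressed,
    string_mul_string (by intro s; fin_cases s <;> simp), one_mul, h, site_diagonal, ← mul_assoc,
    I_mul_I, pow_succ', occ]

theorem fd_mul_f (j : Fin N) : fd N j * f N j = ((-1) ^ ((j : ℕ) + 1) : ℂ) • (1 - occ j) := by
  have h : sigmaPlus * sigmaMinus = 1 + (-1 : ℂ) • diagonal ![0, 1] := by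
    rw [sigmaMinus_eq, sigmaPlus_eq]; ext s t; fin_cases s <;> fin_cases t <;> simp
  rw [f_eq, fd_eq, smul_mul_smul_comm, dressed_mul_dressed,
    string_mul_string (by intro s; fin_cases s <;> simp), one_mul, h, site_add, site_one, site_smul,
    site_diagonal, mul_right_comm, I_mul_I, pow_succ', occ, neg_one_smul, sub_eq_add_neg]

theorem fd_mul_f_of_ne {i j : Fin N} (h : i ≠ j) : fd N i * f N j = -(f N j * fd N i) := by
  rw [f_eq, fd_eq]
  exact smul_dressed_anticomm h minus_plus plus_minus _ _

theorem Sz_eq : Sz N = ((N : ℂ) / 2) • 1 - ∑ j, occ j := by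
  have h : sigmaZ = 1 + (-2 : ℂ) • diagonal ![0, 1] := by
    ext s t; fin_cases s <;> fin_cases t <;> norm_num [sigmaZ]
  have h' : ∀ j : Fin N, site N sigmaZ j = 1 + (-2 : ℂ) • occ j := fun j => by
    rw [h, site_add, site_one, site_smul, site_diagonal, occ]
  rw [Sz, Finset.sum_congr rfl fun j _ => h' j, Finset.sum_add_distrib, ← Finset.smul_sum,
    Finset.sum_const, Finset.card_univ, Fintype.card_fin, smul_add, smul_smul,
    ← Nat.cast_smul_eq_nsmul ℂ, smul_smul]
  rw [show (1 / 2 : ℂ) * N = N / 2 by ring, show (1 / 2 : ℂ) * -2 = -1 by norm_num, neg_one_smul,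
    sub_eq_add_neg]

theorem eq_zero_of_fd_mul {T : Op N} {j : Fin N} (h : fd N j * T = 0) {x y : Fin N → Fin 2}
    (hx : x j = 1) : T x y = 0 := by
  have h1 : occ j * T = 0 := by
    have := congr_arg (f N j * ·) h
    simp only [mul_zero, ← mul_assoc, f_mul_fd, smul_mul_assoc] at this
    exact (smul_eq_zero.1 this).resolve_left (pow_ne_zero _ (by norm_num))
  have := congr_fun₂ h1 x y
  rw [occ, diagonal_mul, hx] at this
  simpa using this

theorem eq_zero_of_mul_f {T : Op N} {j : Fin N} (h : T * f N j = 0) {x y : Fin N → Fin 2}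
    (hy : y j = 1) : T x y = 0 := by
  have h1 : T * occ j = 0 := by
    have := congr_arg (· * fd N j) h
    simp only [zero_mul, mul_assoc, f_mul_fd, mul_smul_comm] at this
    exact (smul_eq_zero.1 this).resolve_left (pow_ne_zero _ (by norm_num))
  have := congr_fun₂ h1 x y
  rw [occ, mul_diagonal, hy] at this
  simpa using this

theorem apply_eq_zero {T : Op N} (h1 : ∀ j, fd N j * T = 0) (h2 : ∀ j, T * f N j = 0)
    {x y : Fin N → Fin 2} (h : x ≠ 0 ∨ y ≠ 0) : T x y = 0 := by
  rcases h with h | h <;> obtain ⟨j, hj⟩ := Function.ne_iff.1 h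
  · exact eq_zero_of_fd_mul (h1 j) (Fin.eq_one_of_ne_zero _ hj)
  · exact eq_zero_of_mul_f (h2 j) (Fin.eq_one_of_ne_zero _ hj)

theorem exists_smul_of_vacuum {T T' : Op N} (h1 : ∀ j, fd N j * T = 0) (h2 : ∀ j, T * f N j = 0)
    (h1' : ∀ j, fd N j * T' = 0) (h2' : ∀ j, T' * f N j = 0) (hT' : T' ≠ 0) :
    ∃ s : ℂ, T = s • T' := by
  have h0 : T' 0 0 ≠ 0 := fun h0 => hT' <| by
    ext x y
    by_cases h : x ≠ 0 ∨ y ≠ 0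
    · exact apply_eq_zero h1' h2' h
    · push Not at h
      rw [h.1, h.2, h0, Matrix.zero_apply]
  refine ⟨T 0 0 / T' 0 0, ?_⟩
  ext x y
  by_cases h : x ≠ 0 ∨ y ≠ 0
  · rw [Matrix.smul_apply, apply_eq_zero h1 h2 h, apply_eq_zero h1' h2' h, smul_zero]
  · push Not at h
    rw [h.1, h.2, Matrix.smul_apply, smul_eq_mul, div_mul_cancel₀ _ h0]

/-- Extension of a finite family by zero. -/
def extend {A : Type*} [Zero A] (g : Fin N → A) (k : ℕ) : A := if h : k < N then g ⟨k, h⟩ else 0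

theorem extend_of_lt {A : Type*} [Zero A] (g : Fin N → A) {k : ℕ} (h : k < N) :
    extend g k = g ⟨k, h⟩ := dif_pos h

theorem extend_val {A : Type*} [Zero A] (g : Fin N → A) (k : Fin N) : extend g k = g k :=
  extend_of_lt g k.2

theorem extend_of_not_lt {A : Type*} [Zero A] (g : Fin N → A) {k : ℕ} (h : ¬k < N) :
    extend g k = 0 := dif_neg h

theorem extend_anticomm {A : Type*} [Ring A] {g : Fin N → A}
    (hg : ∀ i j, g i * g j = -(g j * g i)) (i j : ℕ) :
    extend g i * extend g j = -(extend g j * extend g i) := by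
  by_cases hi : i < N <;> by_cases hj : j < N <;> simp [extend, hi, hj, hg ⟨i, _⟩ ⟨j, _⟩]

theorem esum_extend {A : Type*} [Ring A] (g : Fin N → A) (m : ℕ) :
    esum (extend g) (Finset.range N) m = esum g Finset.univ m := by
  have h := esum_map (Fin.valOrderEmb N) (extend g) (Finset.univ : Finset (Fin N)) m
  rw [show (extend g ∘ Fin.valOrderEmb N) = g from funext (extend_val g)] at h
  rw [← h]
  congr 1
  exact ((Fin.map_valEmbedding_univ (n := N)).trans (Nat.Iio_eq_range N)).symm

end Fermions

/-- The `gl(1|1)` fermions on `2n + 2` sites. -/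
def fermions (n : ℕ) : Chain n (Op (2 * n + 2)) where
  f := extend (f (2 * n + 2))
  fd := extend (fd (2 * n + 2))
  ff := extend_anticomm f_anticomm
  dd := extend_anticomm fd_anticomm
  df i j hi := by
    rw [extend_of_lt _ hi]
    by_cases hij : i = j
    · subst hij
      rw [extend_of_lt _ hi, if_pos rfl, f_mul_fd, fd_mul_f, smul_sub]
      congr 1
      rcases Nat.even_or_odd (i + 1) with h | h <;> simp [h.neg_one_pow]
    · rw [if_neg hij, zero_sub]
      by_cases hj : j < 2 * n + 2
      · rw [extend_of_lt _ hj, fd_mul_f_of_ne (by simpa using hij)]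
      · rw [extend_of_not_lt _ hj, mul_zero, zero_mul, neg_zero]
  vac T T' h1 h2 h1' h2' := by
    refine exists_smul_of_vacuum (fun j => ?_) (fun j => ?_) (fun j => ?_) fun j => ?_
    · rw [← extend_val (fd _) j, h1 j j.2]
    · rw [← extend_val (f _) j, h2 j j.2]
    · rw [← extend_val (fd _) j, h1' j j.2]
    · rw [← extend_val (f _) j, h2' j j.2]

theorem fermions_Nh (n : ℕ) :
    (fermions n).block.Nh = ((n + 1 : ℂ)) • 1 - Sz (2 * n + 2) := by
  rw [Sz_eq, Chain.block_Nh, Finset.sum_range,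
    show ((2 * n + 2 : ℕ) : ℂ) / 2 = n + 1 by push_cast; ring, sub_sub_cancel]
  refine Finset.sum_congr rfl fun j _ => ?_
  show _ * (extend (f (2 * n + 2)) j * extend (fd (2 * n + 2)) j) = _
  rw [extend_val, extend_val, f_mul_fd]
  rcases Nat.even_or_odd ((j : ℕ) + 1) with h | h <;> simp [h.neg_one_pow]

theorem fermions_tlSet (n : ℕ) : (fermions n).tlSet = Set.range (e (2 * n + 2)) := by
  have step : ∀ j : Fin (2 * n + 2), (j : ℕ) < 2 * n + 1 → (fsucc j : ℕ) = j + 1 := fun j hj =>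
    Nat.mod_eq_of_lt (by omega)
  have last : ∀ j : Fin (2 * n + 2), (j : ℕ) = 2 * n + 1 → (fsucc j : ℕ) = 0 := fun j hj => by
    show ((j : ℕ) + 1) % (2 * n + 2) = 0
    rw [hj, Nat.mod_self]
  have he : ∀ j : Fin (2 * n + 2), e (2 * n + 2) j
      = ((fermions n).f j + (fermions n).f (fsucc j : ℕ))
        * ((fermions n).fd j + (fermions n).fd (fsucc j : ℕ)) := fun j => by
    show _ = (extend _ _ + extend _ _) * (extend _ _ + extend _ _)
    simp only [extend_val]
    rfl
  ext x
  constructor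
  · rintro (⟨j, hj, rfl⟩ | rfl)
    · exact ⟨⟨j, by omega⟩, by rw [he, step _ hj]⟩
    · exact ⟨⟨2 * n + 1, by omega⟩, by rw [he, last _ rfl]⟩
  · rintro ⟨j, rfl⟩
    rw [he]
    by_cases hj : (j : ℕ) < 2 * n + 1
    · exact .inl ⟨j, hj, by rw [step j hj]⟩
    · have hj' : (j : ℕ) = 2 * n + 1 := by omega
      exact .inr (by rw [last j hj', hj'])

theorem centralizer_e (n : ℕ) :
    Subalgebra.centralizer ℂ (Set.range (e (2 * (n + 1)))) =
      Algebra.adjoin ℂ (centGens (n + 1)) := by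
  have h := (fermions n).centralizer_eq_adjoin (fermions_Nh n)
  rw [fermions_tlSet] at h
  refine h.trans (congr_arg (Algebra.adjoin ℂ) ?_)
  have h1 : ∀ m, esum (fermions n).f (Finset.range (2 * n + 2)) m = Fg (2 * (n + 1)) m :=
    esum_extend _
  have h2 : ∀ m, esum (fermions n).fd (Finset.range (2 * n + 2)) m = Fdg (2 * (n + 1)) m :=
    esum_extend _
  simp only [h1, h2]
  rfl

/-- **Corollary B.4: the centralizer of the periodic Temperley–Lieb algebra on
the gl(1|1) spin chain.**  The commutant `{T : T e_j = e_j T for all j}` of the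
periodic Temperley–Lieb generators `e_1, …, e_N` equals the unital subalgebra
generated by `{F_(2k+1), F†_(2k+1) : 0 ≤ k ≤ L−1} ∪ {F_(N), F†_(N), S^z}`. -/
theorem gl11_periodic_TL_centralizer (L : ℕ) (hL : 0 < L) :
    Subalgebra.centralizer ℂ (Set.range (e (2 * L))) =
      Algebra.adjoin ℂ (centGens L) := by
  obtain ⟨n, rfl⟩ := Nat.exists_eq_succ_of_ne_zero hL.ne'
  exact centralizer_e n

end SpinChain

end
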